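/- There exists a sequence of polynomials ĉ_k ∈ ℚ[p_2, p_3, …] (k ≥ 0), each involving only finitely many of the variables p_2, p_3, …, with ĉ_0 = 1 and ĉ_k(0,0,…) = 0 for k ≥ 1, such that: (i) assigning degree 2d+1 to the variable p_d, one has deg ĉ_k ≤ 3k−1 for every k ≥ 1; and (ii) for every n ≥ 1, every fixed tuple d' = (d_1,…,d_{n−1}) with all d_j ≥ 2, and every N ≥ 0, writing d = (d', d_n), one has Ĉ(d) = Σ_{k=0}^{N} ĉ_k(p_2(d'), p_3(d'), …)/X(d)^k + O(X(d)^{−N−1}) as d_n → ∞ along integers with g(d) ∈ Z. -/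

import Mathlib

open scoped BigOperators

noncomputable section

namespace WittenAsym

/-- `g(d)` as a rational number: `g(d) = 1 + (∑ⱼ dⱼ − n)/3`. -/
def gQ (l : List ℕ) : ℚ := 1 + ((l.sum : ℚ) - (l.length : ℚ)) / 3

/-- `X(d)` as a rational number: `X(d) = (∑ⱼ (2dⱼ+1))/3 = 2g(d) − 2 + n`. -/
def XQ (l : List ℕ) : ℚ := (2 * (l.sum : ℚ) + (l.length : ℚ)) / 3

/-- `X(d)` as a natural number (the correct value whenever `X(d)` is an integer). -/
def XN (l : List ℕ) : ℕ := (2 * l.sum + l.length) / 3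

/-- `g(d)` is a nonnegative integer. -/
def IntegralG (l : List ℕ) : Prop := ∃ g : ℕ, (g : ℚ) = gQ l

/-- The subtuple of `r` indexed by the finite index set `I`. -/
def select (r : List ℕ) (I : Finset (Fin r.length)) : List ℕ :=
  ((List.finRange r.length).filter (fun i => i ∈ I)).map r.get

/-- The characterization of the normalized Witten intersection numbers
`C(d) = 2^{2g(d)} ∏ⱼ (2dⱼ+1)!! / (3^{2g(d)-2+n} (2g(d)-3+n)!) ∫ ψ₁^{d₁}⋯ψₙ^{dₙ}`:
they form the unique family of rationals, symmetric in the entries of `d`, vanishing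
when `g(d)` is not a nonnegative integer, with `C(0,0,0) = 1/3`, `C(1) = 1/6`,
and satisfying the DVV recursion whenever `X(d) = 2g(d) - 2 + n ≥ 2`. -/
structure IsNormalizedWitten (C : List ℕ → ℚ) : Prop where
  symm : ∀ {l l' : List ℕ}, l.Perm l' → C l = C l'
  init3 : C [0, 0, 0] = 1/3
  init1 : C [1] = 1/6
  vanish : ∀ l : List ℕ, ¬ IntegralG l → C l = 0
  dvv : ∀ (d₁ : ℕ) (r : List ℕ), IntegralG (d₁ :: r) → 2 ≤ XQ (d₁ :: r) →
    C (d₁ :: r) =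
      (∑ j : Fin r.length,
        if 1 ≤ d₁ + r.get j then
          (2 * (r.get j : ℚ) + 1) / (3 * (XQ (d₁ :: r) - 1)) *
            C (r.set j.val (d₁ + r.get j - 1))
        else 0)
      + ∑ a ∈ Finset.range (d₁ - 1),
          (2 / (3 * (XQ (d₁ :: r) - 1)) * C (a :: (d₁ - 2 - a) :: r)
          + ∑ I : Finset (Fin r.length),
              if 3 ∣ (2 * (a + (select r I).sum) + (1 + (select r I).length)) then
                ((XN (a :: select r I) - 1).factorial : ℚ) *
                  ((XN ((d₁ - 2 - a) :: select r Iᶜ) - 1).factorial : ℚ) /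
                  (6 * ((XN (d₁ :: r) - 1).factorial : ℚ)) *
                  C (a :: select r I) * C ((d₁ - 2 - a) :: select r Iᶜ)
              else 0)

/-- `γ(X) = 2^X/(√π · 3^{(3X+1)/2}) · Γ(3X/2+1)/(Γ((X+3)/2)·Γ(X))`. -/
noncomputable def gam (X : ℝ) : ℝ :=
  (2 : ℝ) ^ X / (Real.sqrt Real.pi * (3 : ℝ) ^ ((3 * X + 1) / 2)) *
    (Real.Gamma (3 * X / 2 + 1) / (Real.Gamma ((X + 3) / 2) * Real.Gamma X))

/-- `Ĉ(d) := C(d)/γ(X(d))`. -/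
noncomputable def Chat (C : List ℕ → ℚ) (l : List ℕ) : ℝ :=
  (C l : ℝ) / gam (XN l : ℝ)

/-! ### Hurwitz algebra of functions on multisets -/

/-- Hurwitz (exponential) product of functions on multisets. -/
def conv (f g : Multiset ℕ → ℚ) : Multiset ℕ → ℚ := fun s =>
  (s.antidiagonal.map fun p => f p.1 * g p.2).sum

/-- Derivative in direction `d`. -/
def dd (d : ℕ) (f : Multiset ℕ → ℚ) : Multiset ℕ → ℚ := fun s => f (d ::ₘ s)

/-- weight of a multiset -/
def wt (s : Multiset ℕ) : ℕ := (s.map fun i => 2 * i + 1).sum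

@[simp] lemma wt_zero : wt 0 = 0 := by simp [wt]
@[simp] lemma wt_cons (a : ℕ) (s : Multiset ℕ) : wt (a ::ₘ s) = (2 * a + 1) + wt s := by
  simp [wt]
lemma wt_add (s t : Multiset ℕ) : wt (s + t) = wt s + wt t := by simp [wt]

lemma dd_apply (d : ℕ) (f : Multiset ℕ → ℚ) (s) : dd d f s = f (d ::ₘ s) := rfl

lemma dd_comm (a b : ℕ) (f : Multiset ℕ → ℚ) : dd a (dd b f) = dd b (dd a f) := by
  funext s; simp only [dd, Multiset.cons_swap]

lemma dd_add (d : ℕ) (f g : Multiset ℕ → ℚ) : dd d (f + g) = dd d f + dd d g := rfl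
lemma dd_smul (d : ℕ) (c : ℚ) (f : Multiset ℕ → ℚ) : dd d (c • f) = c • dd d f := rfl

lemma conv_zero' (f g : Multiset ℕ → ℚ) : conv f g 0 = f 0 * g 0 := by
  simp [conv]

lemma conv_cons (f g : Multiset ℕ → ℚ) (d : ℕ) (s : Multiset ℕ) :
    conv f g (d ::ₘ s) = conv (dd d f) g s + conv f (dd d g) s := by
  simp [conv, Multiset.antidiagonal_cons, Multiset.map_map, Function.comp_def, dd, add_comm]

lemma dd_conv (d : ℕ) (f g : Multiset ℕ → ℚ) :
    dd d (conv f g) = conv (dd d f) g + conv f (dd d g) := by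
  funext s; exact conv_cons f g d s

/-- congruence: only values on submultisets matter -/
lemma conv_congr {f f' g g' : Multiset ℕ → ℚ} {s : Multiset ℕ}
    (hf : ∀ t, t ≤ s → f t = f' t) (hg : ∀ t, t ≤ s → g t = g' t) :
    conv f g s = conv f' g' s := by
  unfold conv
  congr 1
  apply Multiset.map_congr rfl
  intro p hp
  rw [Multiset.mem_antidiagonal] at hp
  rw [hf p.1 (by rw [← hp]; exact Multiset.le_add_right _ _),
    hg p.2 (by rw [← hp]; exact Multiset.le_add_left _ _)]

lemma conv_add_left (f f' g : Multiset ℕ → ℚ) : conv (f + f') g = conv f g + conv f' g := by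
  funext s; simp [conv, add_mul, Multiset.sum_map_add]

lemma conv_add_right (f g g' : Multiset ℕ → ℚ) : conv f (g + g') = conv f g + conv f g' := by
  funext s; simp [conv, mul_add, Multiset.sum_map_add]

lemma conv_smul_left (c : ℚ) (f g : Multiset ℕ → ℚ) : conv (c • f) g = c • conv f g := by
  funext s; simp [conv, mul_assoc, Multiset.sum_map_mul_left]

lemma conv_smul_right (c : ℚ) (f g : Multiset ℕ → ℚ) : conv f (c • g) = c • conv f g := by
  funext s; simp [conv, mul_left_comm, Multiset.sum_map_mul_left]

lemma conv_zero_left (g : Multiset ℕ → ℚ) : conv 0 g = 0 := by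
  funext s; simp [conv]

lemma conv_zero_right (g : Multiset ℕ → ℚ) : conv g 0 = 0 := by
  funext s; simp [conv]

lemma conv_sum_left {ι : Type} (t : Finset ι) (f : ι → Multiset ℕ → ℚ) (g : Multiset ℕ → ℚ) :
    conv (∑ i ∈ t, f i) g = ∑ i ∈ t, conv (f i) g := by
  classical
  induction t using Finset.induction_on with
  | empty => simp [conv_zero_left]
  | insert a t ha ih => rw [Finset.sum_insert ha, Finset.sum_insert ha, conv_add_left, ih]

lemma conv_comm (f g : Multiset ℕ → ℚ) : conv f g = conv g f := by
  funext s
  induction s using Multiset.induction_on generalizing f g with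
  | empty => simp [conv_zero', mul_comm]
  | cons d s ih => rw [conv_cons, conv_cons, ih, ih f, add_comm]

lemma conv_sum_right {ι : Type} (t : Finset ι) (f : ι → Multiset ℕ → ℚ) (g : Multiset ℕ → ℚ) :
    conv g (∑ i ∈ t, f i) = ∑ i ∈ t, conv g (f i) := by
  rw [conv_comm, conv_sum_left]; simp only [conv_comm g]

lemma conv_assoc (f g h : Multiset ℕ → ℚ) : conv (conv f g) h = conv f (conv g h) := by
  funext s
  induction s using Multiset.induction_on generalizing f g h with
  | empty => simp [conv_zero', mul_assoc]
  | cons d s ih =>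
    rw [conv_cons, conv_cons, dd_conv, dd_conv, conv_add_left, conv_add_right]
    simp only [Pi.add_apply, ih]; ring

lemma conv_left_comm (f g h : Multiset ℕ → ℚ) : conv f (conv g h) = conv g (conv f h) := by
  rw [← conv_assoc, conv_comm f g, conv_assoc]

/-- unit -/
def dlt : Multiset ℕ → ℚ := fun s => if s = 0 then 1 else 0

@[simp] lemma dd_dlt (d : ℕ) : dd d dlt = 0 := by
  funext s; simp [dd, dlt]

lemma dlt_conv (f : Multiset ℕ → ℚ) : conv dlt f = f := by
  funext s
  induction s using Multiset.induction_on generalizing f with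
  | empty => simp [conv_zero', dlt]
  | cons d s ih => rw [conv_cons, dd_dlt, conv_zero_left, ih]; simp [dd]

lemma conv_dlt (f : Multiset ℕ → ℚ) : conv f dlt = f := by rw [conv_comm, dlt_conv]

/-- The vector field `∑ (k+1/2) t_k ∂_{k+d-1}`. -/
def E (d : ℕ) (f : Multiset ℕ → ℚ) : Multiset ℕ → ℚ := fun s =>
  (s.map fun k => if 1 ≤ k + d then ((k : ℚ) + 1/2) * f ((k + d - 1) ::ₘ s.erase k) else 0).sum

/-- `(e+1/2) ∂_{e+d-1}` -/
def sh (d e : ℕ) (f : Multiset ℕ → ℚ) : Multiset ℕ → ℚ := fun s =>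
  if 1 ≤ e + d then ((e : ℚ) + 1/2) * f ((e + d - 1) ::ₘ s) else 0

lemma E_zero (d : ℕ) (f : Multiset ℕ → ℚ) : E d f 0 = 0 := by simp [E]

lemma E_cons (d e : ℕ) (f : Multiset ℕ → ℚ) (s : Multiset ℕ) :
    E d f (e ::ₘ s) = E d (dd e f) s + sh d e f s := by
  unfold E sh
  rw [Multiset.map_cons, Multiset.sum_cons, Multiset.erase_cons_head, add_comm]
  congr 2
  apply Multiset.map_congr rfl
  intro k hk
  have : (e ::ₘ s).erase k = e ::ₘ s.erase k := by
    by_cases h : e = k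
    · subst h; rw [Multiset.erase_cons_head, Multiset.cons_erase hk]
    · rw [Multiset.erase_cons_tail _ (by simpa using h)]
  rw [this]; simp [dd, Multiset.cons_swap]

lemma dd_E (d e : ℕ) (f : Multiset ℕ → ℚ) : dd e (E d f) = E d (dd e f) + sh d e f := by
  funext s; exact E_cons d e f s

lemma E_add (d : ℕ) (f g : Multiset ℕ → ℚ) : E d (f + g) = E d f + E d g := by
  funext s
  simp only [E, Pi.add_apply, ← Multiset.sum_map_add]
  congr 1; apply Multiset.map_congr rfl; intro k _; split_ifs <;> ring

lemma E_smul (d : ℕ) (c : ℚ) (f : Multiset ℕ → ℚ) : E d (c • f) = c • E d f := by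
  funext s
  simp only [E, Pi.smul_apply, smul_eq_mul, ← Multiset.sum_map_mul_left]
  congr 1; apply Multiset.map_congr rfl; intro k _; split_ifs <;> ring

lemma sh_conv (d e : ℕ) (f g : Multiset ℕ → ℚ) :
    sh d e (conv f g) = conv (sh d e f) g + conv f (sh d e g) := by
  by_cases h : 1 ≤ e + d
  · have hs : ∀ f, sh d e f = ((e : ℚ) + 1/2) • dd (e + d - 1) f := by
      intro f; funext s; simp [sh, h, dd]
    rw [hs, hs, hs, dd_conv, conv_smul_left, conv_smul_right, smul_add]
  · have hs : ∀ f, sh d e f = 0 := by intro f; funext s; simp [sh, h]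
    simp [hs, conv_zero_left, conv_zero_right]

lemma E_conv (d : ℕ) (f g : Multiset ℕ → ℚ) :
    E d (conv f g) = conv (E d f) g + conv f (E d g) := by
  funext s
  induction s using Multiset.induction_on generalizing f g with
  | empty => simp [conv_zero', E_zero]
  | cons e s ih =>
    rw [E_cons, Pi.add_apply, conv_cons, conv_cons, dd_E, dd_E, dd_conv, E_add, Pi.add_apply, ih,
      ih, conv_add_left, conv_add_right, sh_conv]
    simp only [Pi.add_apply]; ring

lemma E_congr {d : ℕ} {f f' : Multiset ℕ → ℚ} {s : Multiset ℕ}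
    (hf : ∀ t, t.card ≤ s.card → wt t + 2 = wt s + 2 * d → f t = f' t) : E d f s = E d f' s := by
  unfold E
  congr 1; apply Multiset.map_congr rfl; intro k hk
  split_ifs with h
  · rw [hf]
    · rw [Multiset.card_cons, Multiset.card_erase_of_mem hk]
      have := Multiset.card_pos_iff_exists_mem.2 ⟨k, hk⟩
      simp; omega
    · have h2 : wt s = (2 * k + 1) + wt (s.erase k) := by
        conv_lhs => rw [← Multiset.cons_erase hk]
        simp
      rw [h2, wt_cons]; omega
  · rfl

/-! ### From the DVV recursion to the Hurwitz algebra -/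

lemma select_cons_mem (x : ℕ) (r : List ℕ) (J : Finset (Fin (x :: r).length))
    (I : Finset (Fin r.length)) (h0 : (⟨0, by simp⟩ : Fin (x :: r).length) ∈ J)
    (hs : ∀ i : Fin r.length, (Fin.succ i : Fin (r.length + 1)) ∈ J ↔ i ∈ I) :
    select (x :: r) J = x :: select r I := by
  unfold select
  have : List.finRange (x :: r).length = (0 : Fin (r.length + 1)) :: (List.finRange r.length).map Fin.succ :=
    List.finRange_succ
  rw [this, List.filter_cons_of_pos (by simpa using h0), List.map_cons, List.filter_map, List.map_map]
  congr 1
  have h2 : ((fun i => decide (i ∈ J)) ∘ Fin.succ : Fin r.length → Bool) = fun i => decide (i ∈ I) := by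
    funext i; simp only [Function.comp]; exact decide_eq_decide.2 (hs i)
  rw [h2]
  rfl

lemma select_cons_not_mem (x : ℕ) (r : List ℕ) (J : Finset (Fin (x :: r).length))
    (I : Finset (Fin r.length)) (h0 : (⟨0, by simp⟩ : Fin (x :: r).length) ∉ J)
    (hs : ∀ i : Fin r.length, (Fin.succ i : Fin (r.length + 1)) ∈ J ↔ i ∈ I) :
    select (x :: r) J = select r I := by
  unfold select
  have : List.finRange (x :: r).length = (0 : Fin (r.length + 1)) :: (List.finRange r.length).map Fin.succ :=
    List.finRange_succ
  rw [this, List.filter_cons_of_neg (by simpa using h0), List.filter_map, List.map_map]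
  have h2 : ((fun i => decide (i ∈ J)) ∘ Fin.succ : Fin r.length → Bool) = fun i => decide (i ∈ I) := by
    funext i; simp only [Function.comp]; exact decide_eq_decide.2 (hs i)
  rw [h2]
  rfl

lemma sum_finset_fin_succ (n : ℕ) (F : Finset (Fin (n + 1)) → ℚ) :
    ∑ I : Finset (Fin (n + 1)), F I =
      (∑ I : Finset (Fin n), F (I.map (Fin.succEmb n))) +
      ∑ I : Finset (Fin n), F (insert 0 (I.map (Fin.succEmb n))) := by
  classical
  have h1 : (Finset.univ : Finset (Finset (Fin (n+1)))) =
      (insert 0 ((Finset.univ : Finset (Fin n)).map (Fin.succEmb n))).powerset := by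
    rw [← Finset.powerset_univ]; congr 1
    ext i; simp only [Finset.mem_univ, true_iff, Finset.mem_insert, Finset.mem_map]
    rcases Fin.eq_zero_or_eq_succ i with h | ⟨j, rfl⟩
    · exact Or.inl h
    · exact Or.inr ⟨j, trivial, rfl⟩
  rw [h1, Finset.sum_powerset_insert (by simp [Fin.succ_ne_zero])]
  have h2 : ∀ G : Finset (Fin (n+1)) → ℚ,
      ∑ t ∈ ((Finset.univ : Finset (Fin n)).map (Fin.succEmb n)).powerset, G t =
      ∑ I : Finset (Fin n), G (I.map (Fin.succEmb n)) := by
    intro G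
    symm
    apply Finset.sum_bij (fun (I : Finset (Fin n)) _ => I.map (Fin.succEmb n))
    · intro I _; rw [Finset.mem_powerset]; exact Finset.map_subset_map.2 (Finset.subset_univ _)
    · intro a _ b _ h; exact Finset.map_injective _ h
    · intro b hb
      rw [Finset.mem_powerset, Finset.subset_map_iff] at hb
      obtain ⟨u, _, hu⟩ := hb
      exact ⟨u, Finset.mem_univ _, hu.symm⟩
    · intros; rfl
  rw [h2, h2]

lemma sum_select (f g : Multiset ℕ → ℚ) (r : List ℕ) :
    ∑ I : Finset (Fin r.length), f (select r I : List ℕ) * g (select r Iᶜ : List ℕ) =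
      conv f g (r : Multiset ℕ) := by
  induction r generalizing f g with
  | nil =>
    rw [show ((([] : List ℕ)) : Multiset ℕ) = 0 from rfl, conv_zero']
    have : ∀ I, select [] I = [] := by intro I; simp [select]
    simp only [this]
    simp only [List.length_nil, Finset.sum_const, Finset.card_univ, Fintype.card_finset, Fintype.card_fin]
    simp
  | cons x r ih =>
    rw [← Multiset.cons_coe, conv_cons, ← ih, ← ih]
    have := sum_finset_fin_succ r.length (fun I => f (select (x :: r) I : List ℕ) * g (select (x :: r) Iᶜ : List ℕ))
    refine this.trans ?_
    rw [add_comm]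
    congr 1
    · apply Finset.sum_congr rfl
      intro I _
      have e1 : select (x :: r) (insert 0 (I.map (Fin.succEmb r.length))) = x :: select r I := by
        apply select_cons_mem
        · exact Finset.mem_insert_self _ _
        · intro i; simp [Fin.succ_ne_zero]
      have e2 : select (x :: r) (insert 0 (I.map (Fin.succEmb r.length)))ᶜ = select r Iᶜ := by
        apply select_cons_not_mem
        · intro h; exact (Finset.mem_compl.1 h) (Finset.mem_insert_self _ _)
        · intro i
          refine Iff.trans Finset.mem_compl ?_
          simp [Fin.succ_ne_zero]
      refine (congrArg₂ (fun a b : List ℕ => f a * g b) e1 e2).trans ?_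
      simp [dd]
    · apply Finset.sum_congr rfl
      intro I _
      have e1 : select (x :: r) (I.map (Fin.succEmb r.length)) = select r I := by
        apply select_cons_not_mem
        · intro h; obtain ⟨a, _, ha⟩ := Finset.mem_map.1 h; exact Fin.succ_ne_zero a ha
        · intro i; simp
      have e2 : select (x :: r) (I.map (Fin.succEmb r.length))ᶜ = x :: select r Iᶜ := by
        apply select_cons_mem
        · refine Finset.mem_compl.2 ?_
          intro h; obtain ⟨a, _, ha⟩ := Finset.mem_map.1 h; exact Fin.succ_ne_zero a ha
        · intro i
          refine Iff.trans Finset.mem_compl ?_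
          simp
      refine (congrArg₂ (fun a b : List ℕ => f a * g b) e1 e2).trans ?_
      simp [dd]

/-- rescaled connected correlators on lists -/
def Ml (C : List ℕ → ℚ) (l : List ℕ) : ℚ :=
  C l * ((XN l - 1).factorial : ℚ) * (3/2) ^ (XN l) / 4

/-- rescaled connected correlators on multisets -/
def MM (C : List ℕ → ℚ) : Multiset ℕ → ℚ := fun s => Ml C s.toList

lemma XN_perm {l l' : List ℕ} (h : l.Perm l') : XN l = XN l' := by
  unfold XN; rw [h.sum_eq, h.length_eq]

lemma MM_coe {C : List ℕ → ℚ} (hC : IsNormalizedWitten C) (l : List ℕ) :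
    MM C (l : Multiset ℕ) = Ml C l := by
  have h : ((l : Multiset ℕ).toList).Perm l := by
    rw [← Multiset.coe_eq_coe, Multiset.coe_toList]
  unfold MM Ml
  rw [hC.symm h, XN_perm h]

lemma wt_coe (l : List ℕ) : wt (l : Multiset ℕ) = 2 * l.sum + l.length := by
  induction l with
  | nil => simp
  | cons a l ih => rw [← Multiset.cons_coe, wt_cons, ih]; simp; ring

lemma integralG_iff (l : List ℕ) : IntegralG l ↔ ∃ g : ℕ, l.sum + 3 = 3 * g + l.length := by
  unfold IntegralG gQ
  apply exists_congr
  intro g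
  rw [← @Nat.cast_inj ℚ]
  push_cast
  constructor <;> intro h <;> linarith

lemma XN_of {l : List ℕ} {X : ℕ} (h : 2 * l.sum + l.length = 3 * X) : XN l = X := by
  unfold XN; rw [h]; simp

lemma integralG_X {l : List ℕ} (h : IntegralG l) : 2 * l.sum + l.length = 3 * XN l := by
  obtain ⟨g, hg⟩ := (integralG_iff l).1 h
  unfold XN
  omega

lemma Ml_vanish {C : List ℕ → ℚ} (hC : IsNormalizedWitten C) {l : List ℕ} (h : ¬ IntegralG l) :
    Ml C l = 0 := by
  simp [Ml, hC.vanish l h]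

/-- constants in the Virasoro operators -/
def cc (d : ℕ) : Multiset ℕ → ℚ :=
  if d = 1 then (1/16 : ℚ) • dlt else if d = 0 then fun s => if s = {0, 0} then 1/8 else 0 else 0

lemma coe_set (r : List ℕ) (j : Fin r.length) (v : ℕ) :
    ((r.set j.val v : List ℕ) : Multiset ℕ) = v ::ₘ (r : Multiset ℕ).erase (r.get j) := by
  induction r with
  | nil => exact j.elim0
  | cons x r ih =>
    refine Fin.cases ?_ (fun i => ?_) j
    · simp
    · have h := ih i
      have hg : (x :: r).get i.succ = r.get i := rfl
      simp only [Fin.val_succ, List.set_cons_succ]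
      rw [hg, ← Multiset.cons_coe, h, ← Multiset.cons_coe]
      have hm : r.get i ∈ (r : Multiset ℕ) := by simp
      by_cases hx : x = r.get i
      · rw [← hx, Multiset.erase_cons_head, Multiset.cons_swap, Multiset.cons_erase]
        rw [hx]; exact hm
      · rw [Multiset.erase_cons_tail _ (by simpa using hx), Multiset.cons_swap]

lemma E_coe (d : ℕ) (f : Multiset ℕ → ℚ) (r : List ℕ) :
    E d f (r : Multiset ℕ) = ∑ j : Fin r.length,
      if 1 ≤ d + r.get j then ((r.get j : ℚ) + 1/2) * f ((r.set j.val (d + r.get j - 1) : List ℕ)) else 0 := by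
  have : ∀ F : ℕ → ℚ, (Multiset.map F (r : Multiset ℕ)).sum = ∑ j : Fin r.length, F (r.get j) := by
    intro F
    rw [Multiset.map_coe, Multiset.sum_coe]
    conv_lhs => rw [← List.ofFn_get r]
    rw [List.map_ofFn, List.sum_ofFn]; rfl
  unfold E
  rw [this]
  apply Finset.sum_congr rfl
  intro j _
  rw [coe_set, add_comm d]

lemma select_sum_len (r : List ℕ) (I : Finset (Fin r.length)) :
    (select r I).sum + (select r Iᶜ).sum = r.sum ∧
      (select r I).length + (select r Iᶜ).length = r.length := by
  have key : ((select r I : List ℕ) : Multiset ℕ) + ((select r Iᶜ : List ℕ) : Multiset ℕ) = (r : Multiset ℕ) := by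
    unfold select
    simp only [← Multiset.map_coe, ← Multiset.filter_coe, ← Multiset.map_add]
    have : Multiset.filter (fun i => i ∈ I) ((List.finRange r.length : List _) : Multiset (Fin r.length)) +
        Multiset.filter (fun i => i ∈ Iᶜ) ((List.finRange r.length : List _) : Multiset (Fin r.length)) =
        ((List.finRange r.length : List _) : Multiset (Fin r.length)) := by
      simp only [Finset.mem_compl]
      exact Multiset.filter_add_not _ _
    have h3 := congrArg (Multiset.map r.get) this
    refine Eq.trans ?_ (h3.trans ?_)
    · simp [Membership.mem]
    · rw [Multiset.map_coe]; simp
  constructor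
  · have := congrArg Multiset.sum key
    simpa using this
  · have := congrArg Multiset.card key
    simpa using this

/-- The DVV recursion for rescaled correlators, generic case. -/
lemma Ml_rec {C : List ℕ → ℚ} (hC : IsNormalizedWitten C) (d : ℕ) (r : List ℕ)
    (hG : IntegralG (d :: r)) (hX : 2 ≤ XQ (d :: r)) :
    Ml C (d :: r) = E d (MM C) (r : Multiset ℕ) +
      ∑ a ∈ Finset.range (d - 1), (Ml C (a :: (d - 2 - a) :: r) +
        conv (dd a (MM C)) (dd (d - 2 - a) (MM C)) (r : Multiset ℕ)) := by
  have hXN := integralG_X hG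
  set X := XN (d :: r) with hXdef
  have hXQ : XQ (d :: r) = X := by
    unfold XQ
    have : (2 * ((d :: r).sum : ℚ) + ((d :: r).length : ℚ)) = 3 * X := by exact_mod_cast hXN
    rw [this]; field_simp
  rw [hXQ] at hX
  have hX2 : 2 ≤ X := by exact_mod_cast hX
  obtain ⟨Y, hY⟩ : ∃ Y, X = Y + 2 := ⟨X - 2, by omega⟩
  have hfac : ((X - 1).factorial : ℚ) = (Y + 1) * (Y.factorial : ℚ) := by
    rw [hY]; simp [Nat.factorial_succ]
  have hpow : (3/2 : ℚ) ^ X = 3/2 * (3/2) ^ (Y + 1) := by rw [hY, pow_succ]; ring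
  have hYne : ((Y : ℚ) + 1) ≠ 0 := by positivity
  have hX1 : ((X : ℚ) - 1) = Y + 1 := by rw [hY]; push_cast; ring
  simp only [List.sum_cons, List.length_cons] at hXN
  have hdvv := hC.dvv d r hG (by rw [hXQ]; exact hX)
  rw [hXQ] at hdvv
  unfold Ml
  rw [← hXdef, hdvv, E_coe, add_mul, add_mul, add_div, Finset.sum_mul, Finset.sum_mul, Finset.sum_div,
    Finset.sum_mul, Finset.sum_mul, Finset.sum_div]
  congr 1
  · apply Finset.sum_congr rfl
    intro j _
    split_ifs with h
    · rw [MM_coe hC]; unfold Ml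
      have hset : XN (r.set j.val (d + r.get j - 1)) = Y + 1 := by
        apply XN_of
        have h1 : wt ((r.set j.val (d + r.get j - 1) : List ℕ) : Multiset ℕ) + (2 * r.get j + 1) =
            (2 * (d + r.get j - 1) + 1) + wt (r : Multiset ℕ) := by
          rw [coe_set, wt_cons]
          have hm : r.get j ∈ (r : Multiset ℕ) := by simp
          conv_rhs => rw [← Multiset.cons_erase hm, wt_cons]
          ring
        rw [wt_coe, wt_coe] at h1
        omega
      rw [hset, hfac, hpow, hX1]
      simp only [Nat.add_sub_cancel]
      field_simp
    · simp
  · apply Finset.sum_congr rfl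
    intro a ha
    rw [Finset.mem_range] at ha
    rw [add_mul, add_mul, add_div]
    congr 1
    · have hset : XN (a :: (d - 2 - a) :: r) = Y + 1 := by
        apply XN_of
        simp only [List.sum_cons, List.length_cons]
        omega
      rw [hset, hfac, hpow, hX1]
      simp only [Nat.add_sub_cancel]
      field_simp
    · rw [← sum_select, Finset.sum_mul, Finset.sum_mul, Finset.sum_div]
      apply Finset.sum_congr rfl
      intro I _
      obtain ⟨hs, hl⟩ := select_sum_len r I
      simp only [dd, Multiset.cons_coe, MM_coe hC]
      split_ifs with h3
      · obtain ⟨X1, hX1'⟩ := h3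
        have h1 : XN (a :: select r I) = X1 := by
          apply XN_of; simp only [List.sum_cons, List.length_cons]; omega
        have h2 : XN ((d - 2 - a) :: select r Iᶜ) = Y + 1 - X1 := by
          apply XN_of; simp only [List.sum_cons, List.length_cons]; omega
        have hle : X1 ≤ Y + 1 := by omega
        unfold Ml
        rw [h1, h2]
        have hp : (3/2 : ℚ) ^ (Y + 1) = (3/2) ^ X1 * (3/2) ^ (Y + 1 - X1) := by
          rw [← pow_add]; congr 1; omega
        rw [hpow, hp]
        have hfne : ((X - 1).factorial : ℚ) ≠ 0 := by positivity
        field_simp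
        ring
      · have : ¬ IntegralG (a :: select r I) := by
          intro hI
          apply h3
          have := integralG_X hI
          simp only [List.sum_cons, List.length_cons] at this
          exact ⟨_, by rw [← this]; ring⟩
        rw [Ml_vanish hC this]; simp

lemma cc_ge_two {d : ℕ} (hd : 2 ≤ d) : cc d = 0 := by
  unfold cc; rw [if_neg (by omega), if_neg (by omega)]

lemma cc_weight (d : ℕ) (s : Multiset ℕ) (h : wt s + 2 * d ≠ 2) : cc d s = 0 := by
  unfold cc
  split_ifs with h1 h2
  · by_cases hs : s = 0
    · subst hs; simp [h1] at h
    · simp [dlt, hs]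
  · by_cases hs : s = {0, 0}
    · subst hs; exfalso; apply h; subst h2; decide
    · exact if_neg hs
  · rfl

/-- Virasoro constraints for the connected correlators. -/
lemma vir_MM {C : List ℕ → ℚ} (hC : IsNormalizedWitten C) (d : ℕ) :
    dd d (MM C) = E d (MM C) +
      ∑ a ∈ Finset.range (d - 1), (dd a (dd (d - 2 - a) (MM C)) +
        conv (dd a (MM C)) (dd (d - 2 - a) (MM C))) + cc d := by
  funext s
  obtain ⟨r, rfl⟩ : ∃ r : List ℕ, (r : Multiset ℕ) = s := ⟨s.toList, Multiset.coe_toList s⟩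
  simp only [Pi.add_apply, Finset.sum_apply]
  have hl : dd d (MM C) (r : Multiset ℕ) = Ml C (d :: r) := by
    rw [dd_apply, Multiset.cons_coe, MM_coe hC]
  have hab : ∀ a b, dd a (dd b (MM C)) (r : Multiset ℕ) = Ml C (a :: b :: r) := by
    intro a b
    rw [dd_apply, dd_apply, Multiset.cons_coe, Multiset.cons_coe, MM_coe hC]
    unfold Ml
    rw [hC.symm (List.Perm.swap a b r), XN_perm (List.Perm.swap a b r)]
  simp only [hl, hab]
  by_cases hG : IntegralG (d :: r)
  · have hXN := integralG_X hG
    have hXQ : XQ (d :: r) = XN (d :: r) := by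
      unfold XQ
      have : (2 * ((d :: r).sum : ℚ) + ((d :: r).length : ℚ)) = 3 * XN (d :: r) := by exact_mod_cast hXN
      rw [this]; field_simp
    by_cases hX : 2 ≤ XQ (d :: r)
    · have hz : cc d (r : Multiset ℕ) = 0 := by
        apply cc_weight
        rw [wt_coe]
        rw [hXQ] at hX
        have : 2 ≤ XN (d :: r) := by exact_mod_cast hX
        simp only [List.sum_cons, List.length_cons] at hXN
        omega
      rw [Ml_rec hC d r hG hX, hz, add_zero]
    · rw [hXQ] at hX
      have hX' : XN (d :: r) < 2 := by
        by_contra hcon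
        exact hX (by exact_mod_cast (not_lt.1 hcon))
      simp only [List.sum_cons, List.length_cons] at hXN
      have hcase : (d = 1 ∧ r = []) ∨ (d = 0 ∧ r = [0, 0]) := by
        match r with
        | [] => left; simp at hXN; constructor; omega; rfl
        | [x] => simp at hXN; omega
        | [x, y] => simp at hXN; right; constructor; omega; congr 1; omega; congr 1; omega
        | (x :: y :: z :: t) => simp at hXN; omega
      rcases hcase with ⟨rfl, rfl⟩ | ⟨rfl, rfl⟩
      · simp [Ml, hC.init1, XN, cc, dlt, E]; norm_num
      · have h0 : ((([0, 0] : List ℕ)) : Multiset ℕ) = {0, 0} := rfl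
        rw [h0]
        simp [Ml, hC.init3, XN, cc, E]; norm_num
  · rw [Ml_vanish hC hG]
    have hnG : ¬ ∃ g : ℕ, d + r.sum + 3 = 3 * g + (r.length + 1) := by
      rw [integralG_iff] at hG; simpa using hG
    have h1 : E d (MM C) (r : Multiset ℕ) = 0 := by
      rw [E_coe]
      apply Finset.sum_eq_zero
      intro j _
      split_ifs with h
      · rw [MM_coe hC, Ml_vanish hC, mul_zero]
        rw [integralG_iff]
        rintro ⟨g, hg⟩
        apply hnG
        refine ⟨g, ?_⟩
        have hm : r.get j ∈ (r : Multiset ℕ) := by simp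
        have e := coe_set r j (d + r.get j - 1)
        have e1 := congrArg Multiset.sum e
        have e2 := congrArg Multiset.card e
        have e3 := congrArg Multiset.sum (Multiset.cons_erase hm)
        rw [Multiset.sum_cons] at e1 e3
        simp only [Multiset.sum_coe, List.length_set, Multiset.coe_card] at e1 e2 e3 hg
        have : 0 < r.length := j.pos
        omega
      · rfl
    have h2 : cc d (r : Multiset ℕ) = 0 := by
      by_contra hcon
      have hw : wt (r : Multiset ℕ) + 2 * d = 2 := by
        by_contra hw; exact hcon (cc_weight d _ hw)
      rw [wt_coe] at hw
      have hd : d = 0 ∨ d = 1 := by omega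
      rcases hd with rfl | rfl
      · by_cases hr : (r : Multiset ℕ) = {0, 0}
        · have e1 := congrArg Multiset.sum hr
          have e2 := congrArg Multiset.card hr
          simp at e1 e2
          apply hnG; exact ⟨0, by simp only [e2]; have : r.sum = 0 := by simpa using congrArg Multiset.sum hr
                                  omega⟩
        · apply hcon; unfold cc; rw [if_neg (by omega), if_pos rfl]; exact if_neg hr
      · apply hnG; exact ⟨1, by omega⟩
    rw [h1, h2]
    symm
    rw [zero_add, add_zero]
    apply Finset.sum_eq_zero
    intro a ha
    rw [Finset.mem_range] at ha
    have h3 : Ml C (a :: (d - 2 - a) :: r) = 0 := by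
      apply Ml_vanish hC
      rw [integralG_iff]
      rintro ⟨g, hg⟩
      simp only [List.sum_cons, List.length_cons] at hg
      exact hnG ⟨g + 1, by omega⟩
    rw [h3, zero_add, ← sum_select]
    apply Finset.sum_eq_zero
    intro I _
    obtain ⟨hs, hl⟩ := select_sum_len r I
    simp only [dd, Multiset.cons_coe, MM_coe hC]
    by_cases hg1 : IntegralG (a :: select r I)
    · by_cases hg2 : IntegralG ((d - 2 - a) :: select r Iᶜ)
      · exfalso
        rw [integralG_iff] at hg1 hg2
        obtain ⟨g1, hg1⟩ := hg1
        obtain ⟨g2, hg2⟩ := hg2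
        simp only [List.sum_cons, List.length_cons] at hg1 hg2
        exact hnG ⟨g1 + g2, by omega⟩
      · rw [Ml_vanish hC hg2, mul_zero]
    · rw [Ml_vanish hC hg1, zero_mul]

/-- convolution powers -/
def pw (f : Multiset ℕ → ℚ) : ℕ → Multiset ℕ → ℚ
  | 0 => dlt
  | n + 1 => conv f (pw f n)

/-- truncated exponential -/
def exN (f : Multiset ℕ → ℚ) (N : ℕ) : Multiset ℕ → ℚ :=
  ∑ n ∈ Finset.range N, (1 / (n.factorial : ℚ)) • pw f n

/-- convolution exponential -/
def ex (f : Multiset ℕ → ℚ) : Multiset ℕ → ℚ := fun s => exN f (s.card + 1) s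

lemma dd_pw (f : Multiset ℕ → ℚ) (d n : ℕ) :
    dd d (pw f (n + 1)) = ((n : ℚ) + 1) • conv (dd d f) (pw f n) := by
  induction n with
  | zero => simp [pw, conv_dlt]
  | succ n ih =>
    rw [show pw f (n + 1 + 1) = conv f (pw f (n + 1)) from rfl, dd_conv, ih, conv_smul_right,
      conv_left_comm, show conv f (pw f n) = pw f (n + 1) from rfl]
    push_cast
    module

lemma pw_vanish {f : Multiset ℕ → ℚ} (hf : f 0 = 0) (n : ℕ) (s : Multiset ℕ) (h : s.card < n) :
    pw f n s = 0 := by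
  induction n generalizing s with
  | zero => omega
  | succ n ih =>
    induction s using Multiset.induction_on with
    | empty => simp [pw, conv_zero', hf]
    | cons d s _ =>
      rw [← dd_apply d (pw f (n + 1)), dd_pw]
      rw [Multiset.card_cons] at h
      have : conv (dd d f) (pw f n) s = conv (dd d f) 0 s := by
        apply conv_congr
        · intros; rfl
        · intro t ht
          rw [ih t (by have := Multiset.card_le_card ht; omega)]; rfl
      rw [Pi.smul_apply, this, conv_zero_right]; simp

lemma ex_eq {f : Multiset ℕ → ℚ} (hf : f 0 = 0) (N : ℕ) (s : Multiset ℕ) (h : s.card < N) :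
    ex f s = exN f N s := by
  unfold ex exN
  simp only [Finset.sum_apply, Pi.smul_apply]
  apply Finset.sum_subset
  · intro x; simp only [Finset.mem_range]; omega
  · intro x _ hx
    rw [Finset.mem_range] at hx
    rw [pw_vanish hf x s (by omega)]; simp

lemma ex_zero (f : Multiset ℕ → ℚ) : ex f 0 = 1 := by
  simp [ex, exN, pw, dlt]

lemma dd_sum (d : ℕ) {ι : Type} (t : Finset ι) (f : ι → Multiset ℕ → ℚ) :
    dd d (∑ i ∈ t, f i) = ∑ i ∈ t, dd d (f i) := by
  funext s; simp [dd]

lemma E_sum (d : ℕ) {ι : Type} (t : Finset ι) (f : ι → Multiset ℕ → ℚ) :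
    E d (∑ i ∈ t, f i) = ∑ i ∈ t, E d (f i) := by
  classical
  induction t using Finset.induction_on with
  | empty => funext s; simp [E]
  | insert a t ha ih => rw [Finset.sum_insert ha, E_add, ih, Finset.sum_insert ha]

lemma exN_step (f g : Multiset ℕ → ℚ) (D : (Multiset ℕ → ℚ) → Multiset ℕ → ℚ)
    (hD : ∀ n, D (pw f (n + 1)) = ((n : ℚ) + 1) • conv g (pw f n)) (N : ℕ) :
    ∑ n ∈ Finset.range N, (1 / ((n + 1).factorial : ℚ)) • D (pw f (n + 1)) = conv g (exN f N) := by
  unfold exN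
  rw [conv_sum_right]
  apply Finset.sum_congr rfl
  intro n _
  rw [hD, conv_smul_right, smul_smul]
  congr 1
  rw [Nat.factorial_succ]
  have : (n.factorial : ℚ) ≠ 0 := by positivity
  push_cast
  field_simp

lemma dd_ex {f : Multiset ℕ → ℚ} (hf : f 0 = 0) (d : ℕ) :
    dd d (ex f) = conv (dd d f) (ex f) := by
  funext s
  have h1 : conv (dd d f) (ex f) s = conv (dd d f) (exN f (s.card + 1)) s := by
    apply conv_congr
    · intros; rfl
    · intro t ht
      exact ex_eq hf _ t (by have := Multiset.card_le_card ht; omega)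
  rw [h1, dd_apply, ex_eq hf (s.card + 1 + 1) _ (by simp),
    ← dd_apply d (exN f (s.card + 1 + 1)), exN, dd_sum,
    Finset.sum_range_succ']
  rw [← exN_step f (dd d f) (dd d) (fun n => dd_pw f d n)]
  simp [dd_smul, pw]

lemma E_dlt (d : ℕ) : E d dlt = 0 := by
  funext s; simp [E, dlt]

lemma E_pw (f : Multiset ℕ → ℚ) (d n : ℕ) :
    E d (pw f (n + 1)) = ((n : ℚ) + 1) • conv (E d f) (pw f n) := by
  induction n with
  | zero => simp [pw, conv_dlt]
  | succ n ih =>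
    rw [show pw f (n + 1 + 1) = conv f (pw f (n + 1)) from rfl, E_conv, ih, conv_smul_right,
      conv_left_comm, show conv f (pw f n) = pw f (n + 1) from rfl]
    push_cast
    module

lemma E_ex {f : Multiset ℕ → ℚ} (hf : f 0 = 0) (d : ℕ) :
    E d (ex f) = conv (E d f) (ex f) := by
  funext s
  have h1 : conv (E d f) (ex f) s = conv (E d f) (exN f (s.card + 1)) s := by
    apply conv_congr
    · intros; rfl
    · intro t ht
      exact ex_eq hf _ t (by have := Multiset.card_le_card ht; omega)
  have h2 : E d (ex f) s = E d (exN f (s.card + 1 + 1)) s := by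
    apply E_congr
    intro t ht _
    exact ex_eq hf _ t (by omega)
  rw [h1, h2, exN, E_sum, Finset.sum_range_succ', ← exN_step f (E d f) (E d) (fun n => E_pw f d n)]
  simp [E_smul, pw, E_dlt]

lemma ext_dd {f g : Multiset ℕ → ℚ} (h0 : f 0 = g 0) (h : ∀ d, dd d f = dd d g) : f = g := by
  funext s
  induction s using Multiset.induction_on with
  | empty => exact h0
  | cons d s _ => exact congrFun (h d) s

lemma ex_neg_conv {f : Multiset ℕ → ℚ} (hf : f 0 = 0) : conv (ex f) (ex (-f)) = dlt := by
  apply ext_dd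
  · simp [conv_zero', ex_zero, dlt]
  · intro d
    have hn : dd d (-f) = (-1 : ℚ) • dd d f := by funext s; simp [dd]
    rw [dd_conv, dd_ex hf, dd_ex (f := -f) (by simp [hf]), dd_dlt, hn, conv_smul_left,
      conv_smul_right, conv_assoc, conv_left_comm (ex f)]
    module

/-- connected correlators, with constant term removed -/
def M0 (C : List ℕ → ℚ) : Multiset ℕ → ℚ := fun s => if s = 0 then 0 else MM C s

/-- partition function -/
def Z (C : List ℕ → ℚ) : Multiset ℕ → ℚ := ex (M0 C)

/-- inverse partition function -/
def Zi (C : List ℕ → ℚ) : Multiset ℕ → ℚ := ex (-M0 C)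

lemma M0_zero (C : List ℕ → ℚ) : M0 C 0 = 0 := by simp [M0]

lemma dd_M0 (C : List ℕ → ℚ) (d : ℕ) : dd d (M0 C) = dd d (MM C) := by
  funext s; simp [dd, M0]

lemma E_M0 (C : List ℕ → ℚ) (d : ℕ) : E d (M0 C) = E d (MM C) := by
  funext s; simp [E, M0]

lemma Z_zero (C : List ℕ → ℚ) : Z C 0 = 1 := ex_zero _
lemma Zi_zero (C : List ℕ → ℚ) : Zi C 0 = 1 := ex_zero _

lemma dd_Z (C : List ℕ → ℚ) (d : ℕ) : dd d (Z C) = conv (dd d (MM C)) (Z C) := by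
  rw [Z, dd_ex (M0_zero C), dd_M0]

lemma E_Z (C : List ℕ → ℚ) (d : ℕ) : E d (Z C) = conv (E d (MM C)) (Z C) := by
  rw [Z, E_ex (M0_zero C), E_M0]

lemma Z_Zi (C : List ℕ → ℚ) : conv (Z C) (Zi C) = dlt := ex_neg_conv (M0_zero C)

lemma dd_Z_Zi (C : List ℕ → ℚ) (d : ℕ) : conv (dd d (Z C)) (Zi C) = dd d (MM C) := by
  rw [dd_Z, conv_assoc, Z_Zi, conv_dlt]

/-- Virasoro constraints for the partition function -/
lemma vir_Z {C : List ℕ → ℚ} (hC : IsNormalizedWitten C) (d : ℕ) :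
    dd d (Z C) = E d (Z C) +
      ∑ a ∈ Finset.range (d - 1), dd a (dd (d - 2 - a) (Z C)) + conv (cc d) (Z C) := by
  conv_lhs => rw [dd_Z, vir_MM hC d]
  rw [conv_add_left, conv_add_left, E_Z, conv_sum_left]
  congr 2
  apply Finset.sum_congr rfl
  intro a _
  rw [dd_Z C (d - 2 - a), dd_conv, dd_Z C a, conv_add_left, conv_left_comm, conv_assoc,
    conv_left_comm]

lemma conv_wt {f g : Multiset ℕ → ℚ} (hf : ∀ s, ¬ 3 ∣ wt s → f s = 0)
    (hg : ∀ s, ¬ 3 ∣ wt s → g s = 0) : ∀ s, ¬ 3 ∣ wt s → conv f g s = 0 := by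
  intro s hs
  unfold conv
  apply Multiset.sum_eq_zero
  intro x hx
  rw [Multiset.mem_map] at hx
  obtain ⟨p, hp, rfl⟩ := hx
  rw [Multiset.mem_antidiagonal] at hp
  rw [← hp, wt_add] at hs
  by_cases h1 : 3 ∣ wt p.1
  · rw [hg p.2 (by omega), mul_zero]
  · rw [hf p.1 h1, zero_mul]

lemma ex_wt {f : Multiset ℕ → ℚ} (hf : ∀ s, ¬ 3 ∣ wt s → f s = 0) :
    ∀ s, ¬ 3 ∣ wt s → ex f s = 0 := by
  have : ∀ n s, ¬ 3 ∣ wt s → pw f n s = 0 := by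
    intro n
    induction n with
    | zero =>
      intro s hs
      have : s ≠ 0 := by rintro rfl; simp at hs
      simp [pw, dlt, this]
    | succ n ih => exact conv_wt hf ih
  intro s hs
  simp [ex, exN, this _ s hs]

lemma M0_wt {C : List ℕ → ℚ} (hC : IsNormalizedWitten C) (s : Multiset ℕ) (hs : ¬ 3 ∣ wt s) :
    M0 C s = 0 := by
  unfold M0
  split_ifs with h
  · rfl
  · obtain ⟨r, rfl⟩ : ∃ r : List ℕ, (r : Multiset ℕ) = s := ⟨s.toList, Multiset.coe_toList s⟩
    rw [MM_coe hC, Ml_vanish hC]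
    intro hG
    apply hs
    rw [wt_coe, integralG_X hG]
    exact dvd_mul_right _ _

lemma Zi_wt {C : List ℕ → ℚ} (hC : IsNormalizedWitten C) (s : Multiset ℕ) (hs : ¬ 3 ∣ wt s) :
    Zi C s = 0 := by
  apply ex_wt _ s hs
  intro t ht
  simp [M0_wt hC t ht]

lemma Z_wt {C : List ℕ → ℚ} (hC : IsNormalizedWitten C) (s : Multiset ℕ) (hs : ¬ 3 ∣ wt s) :
    Z C s = 0 := ex_wt (M0_wt hC) s hs

lemma Z_single (C : List ℕ → ℚ) (n : ℕ) : Z C {n} = MM C {n} := by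
  have : Z C {n} = dd n (Z C) 0 := rfl
  rw [this, dd_Z, conv_zero', Z_zero, mul_one]; rfl

lemma tri_sum (M : ℕ) (c : ℕ) (hc : c ∈ Finset.range (M + 1)) (G : ℕ → ℕ → ℚ) :
    ∑ a ∈ Finset.range (M + 1 - c), G a (M - c - a) =
      ∑ a ∈ Finset.range (M + 1), ∑ b ∈ Finset.range (M + 1),
        if a + b + c = M then G a b else 0 := by
  rw [Finset.mem_range] at hc
  have : ∀ a ∈ Finset.range (M + 1), (∑ b ∈ Finset.range (M + 1),
        if a + b + c = M then G a b else 0) = if a ∈ Finset.range (M + 1 - c) then G a (M - c - a) else 0 := by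
    intro a ha
    split_ifs with h
    · rw [Finset.mem_range] at h
      rw [Finset.sum_eq_single (M - c - a)]
      · rw [if_pos (by omega)]
      · intro b _ hb; rw [if_neg (by omega)]
      · intro hb; rw [Finset.mem_range] at hb; omega
    · apply Finset.sum_eq_zero
      intro b _
      rw [Finset.mem_range] at h
      rw [if_neg (by omega)]
  rw [Finset.sum_congr rfl this, ← Finset.sum_filter]
  apply Finset.sum_congr
  · ext a; simp only [Finset.mem_range, Finset.mem_filter]; omega
  · intros; rfl

lemma tri_symm (M : ℕ) (F : ℕ → ℕ → ℕ → ℚ) (h1 : ∀ a b c, F a b c = F b a c)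
    (h2 : ∀ a b c, F a b c = F a c b) :
    ∑ c ∈ Finset.range (M + 1), (3 * (c : ℚ) - M) *
      ∑ a ∈ Finset.range (M + 1 - c), F a (M - c - a) c = 0 := by
  set R := Finset.range (M + 1) with hR
  have e : ∀ c ∈ R, (3 * (c : ℚ) - M) * ∑ a ∈ Finset.range (M + 1 - c), F a (M - c - a) c =
      ∑ a ∈ R, ∑ b ∈ R, if a + b + c = M then (3 * (c : ℚ) - (a + b + c)) * F a b c else 0 := by
    intro c hc
    rw [tri_sum M c hc (fun a b => F a b c), Finset.mul_sum]
    apply Finset.sum_congr rfl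
    intro a _
    rw [Finset.mul_sum]
    apply Finset.sum_congr rfl
    intro b _
    split_ifs with h
    · rw [← h]; push_cast; ring
    · simp
  rw [Finset.sum_congr rfl e]
  set W : (ℕ → ℕ → ℕ → ℚ) → ℚ := fun w => ∑ c ∈ R, ∑ a ∈ R, ∑ b ∈ R,
    if a + b + c = M then w a b c * F a b c else 0 with hW
  have lin : (∑ c ∈ R, ∑ a ∈ R, ∑ b ∈ R,
      if a + b + c = M then (3 * (c : ℚ) - (a + b + c)) * F a b c else 0) =
      2 * W (fun a b c => c) - W (fun a b c => a) - W (fun a b c => b) := by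
    simp only [hW, Finset.mul_sum, ← Finset.sum_sub_distrib]
    refine Finset.sum_congr rfl fun c _ => Finset.sum_congr rfl fun a _ => Finset.sum_congr rfl fun b _ => ?_
    split_ifs
    · ring
    · simp
  have wab : W (fun a b c => a) = W (fun a b c => b) := by
    simp only [hW]
    refine Finset.sum_congr rfl fun c _ => ?_
    rw [Finset.sum_comm]
    refine Finset.sum_congr rfl fun a _ => Finset.sum_congr rfl fun b _ => ?_
    rw [h1 b a c, add_comm b a]
  have wac : W (fun a b c => c) = W (fun a b c => a) := by
    simp only [hW]
    rw [Finset.sum_comm]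
    refine Finset.sum_congr rfl fun c _ => Finset.sum_congr rfl fun a _ => Finset.sum_congr rfl fun b _ => ?_
    rw [show F c b a = F a b c by rw [h2 c b a, h1 c a b, h2 a c b]]
    simp only [show c + b + a = a + b + c by ring]
  rw [lin, wac, wab]; ring

lemma sum_refl_weight (L : ℕ) (G : ℕ → ℚ) (hG : ∀ c ≤ L, G c = G (L - c)) :
    ∑ c ∈ Finset.range (L + 1), (c : ℚ) * G c = (L : ℚ) / 2 * ∑ c ∈ Finset.range (L + 1), G c := by
  have h := Finset.sum_range_reflect (fun c => (c : ℚ) * G c) (L + 1)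
  have h2 : ∑ c ∈ Finset.range (L + 1), (((L + 1 - 1 - c : ℕ) : ℚ)) * G (L + 1 - 1 - c) =
      ∑ c ∈ Finset.range (L + 1), ((L : ℚ) * G c - c * G c) := by
    apply Finset.sum_congr rfl
    intro c hc
    rw [Finset.mem_range] at hc
    rw [Nat.add_sub_cancel, ← hG c (by omega), Nat.cast_sub (by omega)]; ring
  rw [h2, Finset.sum_sub_distrib, ← Finset.mul_sum] at h
  linarith

lemma poly_sum (n : ℕ) (A : ℚ) : ∑ c ∈ Finset.range n, (3 * (c : ℚ) - A) * (c + 1/2) =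
    n * (n - 1) * (2 * n - 1) / 2 + (3/2 - A) * (n * (n - 1) / 2) - A / 2 * n := by
  induction n with
  | zero => simp
  | succ n ih => rw [Finset.sum_range_succ, ih]; push_cast; ring

lemma conv_dlt_smul (c : ℚ) (f : Multiset ℕ → ℚ) : conv (c • dlt) f = c • f := by
  rw [conv_smul_left, dlt_conv]

lemma cc_one : cc 1 = (1/16 : ℚ) • dlt := by simp [cc]

/-- indicator of `{0}` -/
def t0 : Multiset ℕ → ℚ := fun s => if s = {0} then 1 else 0

lemma dd_zero_cc_zero : dd 0 (cc 0) = (1/8 : ℚ) • t0 := by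
  funext s
  have : cc 0 = fun s => if s = {0, 0} then (1/8 : ℚ) else 0 := by unfold cc; simp
  rw [this]
  simp only [dd, t0, Pi.smul_apply, smul_eq_mul]
  have : (0 ::ₘ s = ({0, 0} : Multiset ℕ)) ↔ s = {0} := by
    rw [show ({0, 0} : Multiset ℕ) = 0 ::ₘ {0} from rfl, Multiset.cons_inj_right]
  simp only [this]
  split_ifs <;> simp

lemma dd_pos_cc_zero {e : ℕ} (he : e ≠ 0) : dd e (cc 0) = 0 := by
  funext s
  have : cc 0 = fun s => if s = {0, 0} then (1/8 : ℚ) else 0 := by unfold cc; simp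
  rw [this]
  simp only [dd]
  rw [if_neg]; rfl
  intro h
  have : e ∈ ({0, 0} : Multiset ℕ) := by rw [← h]; simp
  simp at this; exact he this

lemma dd_zero_t0 : dd 0 t0 = dlt := by
  funext s
  simp only [dd, t0, dlt]
  rw [show ({0} : Multiset ℕ) = 0 ::ₘ 0 from rfl]
  simp only [Multiset.cons_inj_right]

lemma dd_pos_t0 {e : ℕ} (he : e ≠ 0) : dd e t0 = 0 := by
  funext s
  simp only [dd, t0]
  rw [if_neg]; rfl
  intro h
  have : e ∈ ({0} : Multiset ℕ) := by rw [← h]; simp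
  simp at this; exact he this

lemma cc_zero_zero : cc 0 0 = 0 := by
  apply cc_weight; simp

lemma Z_two {C : List ℕ → ℚ} (hC : IsNormalizedWitten C) (d c : ℕ) (h : 1 ≤ c + d) (hdc : d ≠ 0 ∨ c ≠ 0) :
    Z C (d ::ₘ c ::ₘ 0) = ((c : ℚ) + 1/2) * Z C {c + d - 1} +
      ∑ a ∈ Finset.range (d - 1), Z C (a ::ₘ (d - 2 - a) ::ₘ c ::ₘ 0) +
      if d = 1 then 1/16 * Z C {c} else 0 := by
  have h0 : Z C (d ::ₘ c ::ₘ 0) = dd d (Z C) (c ::ₘ 0) := rfl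
  rw [h0, vir_Z hC d]
  simp only [Pi.add_apply, Finset.sum_apply]
  congr 1
  · congr 1
    · rw [E_cons, E_zero, sh, if_pos h, zero_add]; rfl
    · apply Finset.sum_congr rfl
      intro a _
      rw [dd_apply, dd_apply, Multiset.cons_swap]
  · split_ifs with h1
    · subst h1
      rw [cc_one, conv_dlt_smul]; rfl
    · rcases Nat.eq_zero_or_pos d with rfl | h2
      · rw [conv_cons, dd_pos_cc_zero (by tauto), conv_zero_left, conv_zero', cc_zero_zero]; simp
      · rw [cc_ge_two (by omega), conv_zero_left]; rfl

lemma Z_one {C : List ℕ → ℚ} (hC : IsNormalizedWitten C) (d : ℕ) (hd : 2 ≤ d) :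
    Z C {d} = ∑ a ∈ Finset.range (d - 1), Z C (a ::ₘ (d - 2 - a) ::ₘ 0) := by
  have h0 : Z C {d} = dd d (Z C) 0 := rfl
  rw [h0, vir_Z hC d]
  simp only [Pi.add_apply, Finset.sum_apply]
  rw [E_zero, cc_ge_two hd, conv_zero_left, zero_add]
  simp only [Pi.zero_apply, add_zero]
  apply Finset.sum_congr rfl
  intro a _
  rw [dd_apply, dd_apply, Multiset.cons_swap]

lemma Z_one_rec {C : List ℕ → ℚ} (hC : IsNormalizedWitten C) (L : ℕ) (hL : 2 ≤ L) :
    ((L : ℚ) / 2 + 2) * Z C {L + 2} = Z C {L - 1} *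
      ((2 * L - 1) * (L - 7/16) + (2 * L + 2) * (L + 1/2) +
        ∑ c ∈ Finset.range (L - 1), (3 * (c : ℚ) - (L - 2)) * (c + 1/2)) := by
  obtain ⟨M, rfl⟩ : ∃ M, L = M + 2 := ⟨L - 2, by omega⟩
  have hsum : Z C {M + 2 + 2} = ∑ c ∈ Finset.range (M + 2 + 1), Z C (c ::ₘ (M + 2 - c) ::ₘ 0) := by
    rw [Z_one hC _ (by omega)]
    apply Finset.sum_congr
    · congr 1
    · intro c _; congr 1
  have hw : ∑ c ∈ Finset.range (M + 2 + 1), (3 * (c : ℚ) - M) * Z C (c ::ₘ (M + 2 - c) ::ₘ 0) =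
      (((M + 2 : ℕ) : ℚ) / 2 + 2) * Z C {M + 2 + 2} := by
    have h1 := sum_refl_weight (M + 2) (fun c => Z C (c ::ₘ (M + 2 - c) ::ₘ 0)) (by
      intro c hc
      rw [show M + 2 - (M + 2 - c) = c by omega, Multiset.cons_swap])
    have : ∑ c ∈ Finset.range (M + 2 + 1), (3 * (c : ℚ) - M) * Z C (c ::ₘ (M + 2 - c) ::ₘ 0) =
      3 * ∑ c ∈ Finset.range (M + 2 + 1), (c : ℚ) * Z C (c ::ₘ (M + 2 - c) ::ₘ 0) -
      M * ∑ c ∈ Finset.range (M + 2 + 1), Z C (c ::ₘ (M + 2 - c) ::ₘ 0) := by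
      rw [Finset.mul_sum, Finset.mul_sum, ← Finset.sum_sub_distrib]
      apply Finset.sum_congr rfl; intros; ring
    rw [this, h1, ← hsum]; push_cast; ring
  rw [← hw, Finset.sum_range_succ, Finset.sum_range_succ]
  have hlast : Z C ((M + 2) ::ₘ (M + 2 - (M + 2)) ::ₘ 0) = ((M : ℚ) + 2 + 1/2) * Z C {M + 1} := by
    rw [Nat.sub_self, Multiset.cons_swap, Z_two hC 0 (M + 2) (by omega) (by omega)]
    simp
  have hpen : Z C ((M + 1) ::ₘ (M + 2 - (M + 1)) ::ₘ 0) = ((M : ℚ) + 1 + 1/2 + 1/16) * Z C {M + 1} := by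
    rw [show M + 2 - (M + 1) = 1 by omega, Multiset.cons_swap, Z_two hC 1 (M + 1) (by omega) (by omega)]
    simp; ring
  have hmain : ∑ c ∈ Finset.range (M + 1), (3 * (c : ℚ) - M) * Z C (c ::ₘ (M + 2 - c) ::ₘ 0) =
      Z C {M + 1} * ∑ c ∈ Finset.range (M + 1), (3 * (c : ℚ) - M) * (c + 1/2) := by
    have key := tri_symm M (fun a b c => Z C (a ::ₘ b ::ₘ c ::ₘ 0))
      (fun a b c => by rw [Multiset.cons_swap])
      (fun a b c => by rw [Multiset.cons_swap b c])
    rw [← sub_eq_zero, Finset.mul_sum, ← Finset.sum_sub_distrib]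
    rw [← key]
    apply Finset.sum_congr rfl
    intro c hc
    rw [Finset.mem_range] at hc
    rw [Multiset.cons_swap, Z_two hC (M + 2 - c) c (by omega) (by omega), if_neg (by omega),
      show c + (M + 2 - c) - 1 = M + 1 by omega, show M + 2 - c - 1 = M + 1 - c by omega,
      show M + 2 - c - 2 = M - c by omega]
    ring
  rw [hmain, hlast, hpen, show M + 2 - 1 = M + 1 by omega]
  push_cast
  rw [show ((M : ℚ) + 2 - 2) = M by ring]
  ring

lemma C_one_rec {C : List ℕ → ℚ} (hC : IsNormalizedWitten C) (g : ℕ) :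
    C [3 * g + 4] * ((2 * g + 4 : ℚ) * (2 * g + 2) * (2 * g + 1)) = C [3 * g + 1] *
      ((2 * g + 3) * (2 * g + 1 + 4/3) * (2 * g + 1 + 2/3)) := by
  have h := Z_one_rec hC (3 * g + 2) (by omega)
  rw [poly_sum, Z_single, Z_single, show ({3 * g + 2 + 2} : Multiset ℕ) = (([3 * g + 4] : List ℕ) : Multiset ℕ) from rfl,
    show ({3 * g + 2 - 1} : Multiset ℕ) = (([3 * g + 1] : List ℕ) : Multiset ℕ) from rfl, MM_coe hC, MM_coe hC] at h
  unfold Ml at h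
  rw [XN_of (X := 2 * g + 3) (by simp; ring), XN_of (X := 2 * g + 1) (by simp; ring)] at h
  have hf : ((2 * g + 3 - 1).factorial : ℚ) = (2 * g + 2) * (2 * g + 1) * ((2 * g).factorial : ℚ) := by
    rw [show 2 * g + 3 - 1 = 2 * g + 1 + 1 by omega, Nat.factorial_succ, Nat.factorial_succ]
    push_cast; ring
  rw [hf, show 2 * g + 1 - 1 = 2 * g by omega, show 3 * g + 2 - 1 = 3 * g + 1 by omega] at h
  have hne : ((2 * g).factorial : ℚ) * (3/2) ^ (2 * g + 1) ≠ 0 := by positivity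
  apply mul_left_cancel₀ hne
  rw [show (3/2 : ℚ) ^ (2 * g + 3) = 9/4 * (3/2) ^ (2 * g + 1) by rw [pow_succ, pow_succ]; ring] at h
  push_cast at h
  linear_combination (64/27) * h

lemma gam_rec (X : ℝ) (hX : 0 < X) : gam (X + 2) * ((X + 3) * (X + 1) * X) =
    gam X * ((X + 2) * (X + 4/3) * (X + 2/3)) := by
  unfold gam
  have h1 : Real.Gamma (3 * (X + 2) / 2 + 1) = (3 * X / 2 + 3) * (3 * X / 2 + 2) * (3 * X / 2 + 1) *
      Real.Gamma (3 * X / 2 + 1) := by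
    rw [show 3 * (X + 2) / 2 + 1 = (3 * X / 2 + 1 + 1 + 1) + 1 by ring, Real.Gamma_add_one (by positivity),
      Real.Gamma_add_one (by positivity), Real.Gamma_add_one (by positivity)]
    ring
  have h2 : Real.Gamma ((X + 2 + 3) / 2) = (X + 3) / 2 * Real.Gamma ((X + 3) / 2) := by
    rw [show (X + 2 + 3) / 2 = (X + 3) / 2 + 1 by ring, Real.Gamma_add_one (by positivity)]
  have h3 : Real.Gamma (X + 2) = (X + 1) * X * Real.Gamma X := by
    rw [show X + 2 = X + 1 + 1 by ring, Real.Gamma_add_one (by positivity), Real.Gamma_add_one (by positivity)]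
    ring
  have h4 : (2 : ℝ) ^ (X + 2) = 4 * 2 ^ X := by
    rw [Real.rpow_add (by norm_num)]; norm_num; ring
  have h5 : (3 : ℝ) ^ ((3 * (X + 2) + 1) / 2) = 27 * 3 ^ ((3 * X + 1) / 2) := by
    rw [show (3 * (X + 2) + 1) / 2 = (3 * X + 1) / 2 + 3 by ring, Real.rpow_add (by norm_num)]; norm_num; ring
  rw [h1, h2, h3, h4, h5]
  have := Real.Gamma_pos_of_pos hX
  have := Real.Gamma_pos_of_pos (show 0 < (X + 3) / 2 by positivity)
  have := Real.Gamma_pos_of_pos (show 0 < 3 * X / 2 + 1 by positivity)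
  have : (0:ℝ) < 3 ^ ((3 * X + 1) / 2) := by positivity
  have : 0 < Real.sqrt Real.pi := Real.sqrt_pos.2 Real.pi_pos
  field_simp
  ring

lemma gam_one : gam 1 = 1/6 := by
  unfold gam
  have : 0 < Real.sqrt Real.pi := Real.sqrt_pos.2 Real.pi_pos
  have h : Real.Gamma (3 * 1 / 2 + 1) = 3/4 * Real.sqrt Real.pi := by
    rw [show (3 * 1 / 2 + 1 : ℝ) = 1/2 + 1 + 1 by norm_num, Real.Gamma_add_one (by norm_num),
      Real.Gamma_add_one (by norm_num), Real.Gamma_one_half_eq]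
    ring
  rw [h, show ((1:ℝ) + 3) / 2 = 2 by norm_num, show ((3:ℝ) * 1 + 1) / 2 = ((2:ℕ):ℝ) by norm_num,
    Real.Gamma_one, Real.Gamma_two, Real.rpow_natCast]
  field_simp
  norm_num

lemma gam_pos (X : ℝ) (hX : 0 < X) : 0 < gam X := by
  unfold gam
  have := Real.Gamma_pos_of_pos hX
  have := Real.Gamma_pos_of_pos (show 0 < (X + 3) / 2 by positivity)
  have := Real.Gamma_pos_of_pos (show 0 < 3 * X / 2 + 1 by positivity)
  have : 0 < Real.sqrt Real.pi := Real.sqrt_pos.2 Real.pi_pos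
  positivity

/-- one-point formula -/
lemma C_one {C : List ℕ → ℚ} (hC : IsNormalizedWitten C) (g : ℕ) :
    (C [3 * g + 1] : ℝ) = gam (2 * g + 1) := by
  induction g with
  | zero => simp [hC.init1, gam_one]
  | succ g ih =>
    have h1 := gam_rec (2 * g + 1) (by positivity)
    have h2 : (C [3 * g + 4] : ℝ) * ((2 * g + 4 : ℝ) * (2 * g + 2) * (2 * g + 1)) = C [3 * g + 1] *
      ((2 * g + 3) * (2 * g + 1 + 4/3) * (2 * g + 1 + 2/3)) := by
      have h3 := congrArg (fun q : ℚ => (q : ℝ)) (C_one_rec hC g)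
      push_cast at h3
      exact h3
    rw [ih] at h2
    rw [show 3 * (g + 1) + 1 = 3 * g + 4 by ring]
    have hne : ((2 * g + 4 : ℝ) * (2 * g + 2) * (2 * g + 1)) ≠ 0 := by positivity
    apply mul_right_cancel₀ hne
    rw [h2]
    push_cast
    rw [show (2 * ((g:ℝ) + 1) + 1) = 2 * g + 1 + 2 by ring]
    linear_combination -h1

lemma conv_congr2 {f f' g g' : Multiset ℕ → ℚ} {u : Multiset ℕ}
    (h : ∀ s t, s + t = u → f s * g t = f' s * g' t) : conv f g u = conv f' g' u := by
  unfold conv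
  congr 1
  apply Multiset.map_congr rfl
  intro p hp
  rw [Multiset.mem_antidiagonal] at hp
  exact h _ _ hp

/-- The functions `h_k`. -/
def hh (C : List ℕ → ℚ) (k : ℕ) (u : Multiset ℕ) : ℚ :=
  if h0 : wt u = 3 * k then Z C u else if h1 : 3 * k < wt u then 0 else
    -4 / (3 * (k : ℚ) - wt u) * ∑ j ∈ Finset.range (3 * k), hh C k (j ::ₘ u)
termination_by 3 * k - wt u
decreasing_by
  rw [wt_cons]; omega

lemma hh_eq (C : List ℕ → ℚ) (k : ℕ) (u : Multiset ℕ) (h : wt u = 3 * k) : hh C k u = Z C u := by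
  rw [hh]; simp [h]

lemma hh_gt (C : List ℕ → ℚ) (k : ℕ) (u : Multiset ℕ) (h : 3 * k < wt u) : hh C k u = 0 := by
  rw [hh, dif_neg (by omega), dif_pos h]

lemma hh_P1 (C : List ℕ → ℚ) (k K : ℕ) (hK : 3 * k ≤ K) (u : Multiset ℕ) :
    (3 * (k : ℚ) - wt u) * hh C k u = -4 * ∑ j ∈ Finset.range K, hh C k (j ::ₘ u) := by
  have hext : ∑ j ∈ Finset.range K, hh C k (j ::ₘ u) = ∑ j ∈ Finset.range (3 * k), hh C k (j ::ₘ u) := by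
    symm
    apply Finset.sum_subset
    · intro x; simp only [Finset.mem_range]; omega
    · intro x _ hx
      rw [Finset.mem_range] at hx
      apply hh_gt; rw [wt_cons]; omega
  rw [hext]
  rcases lt_trichotomy (wt u) (3 * k) with h | h | h
  · rw [hh, dif_neg (by omega), dif_neg (by omega)]
    have : (3 * (k : ℚ) - wt u) ≠ 0 := by
      have : (wt u : ℚ) < 3 * k := by exact_mod_cast h
      linarith
    field_simp
  · rw [show (3 * (k : ℚ) - wt u) = 0 by rw [h]; push_cast; ring]
    rw [Finset.sum_eq_zero]
    · simp
    · intro j _; apply hh_gt; rw [wt_cons]; omega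
  · rw [hh_gt C k u h, Finset.sum_eq_zero]
    · simp
    · intro j _; apply hh_gt; rw [wt_cons]; omega

/-- right hand side of the recursion for `h_{k+1}` -/
def RR (C : List ℕ → ℚ) (k d : ℕ) : Multiset ℕ → ℚ := fun u =>
  E d (hh C k) u + ∑ a ∈ Finset.range (d - 1), hh C k (a ::ₘ (d - 2 - a) ::ₘ u) +
    1/2 * ((3 * (k : ℚ) - wt u) * hh C k u) + 2 * ∑ j ∈ Finset.range (d - 1), hh C k (j ::ₘ u) +
    conv (cc d) (hh C k) u +
    if d = 0 then hh C k u - 1/2 * conv t0 (hh C k) u else 0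

lemma cc_ne {d : ℕ} {s : Multiset ℕ} (h : cc d s ≠ 0) : wt s + 2 * d = 2 := by
  by_contra hw; exact h (cc_weight d s hw)

lemma t0_ne {s : Multiset ℕ} (h : t0 s ≠ 0) : wt s = 1 := by
  unfold t0 at h
  split_ifs at h with h1
  · rw [h1]; decide
  · exact absurd rfl h

lemma P1_fun (C : List ℕ → ℚ) (k K : ℕ) (hK : 3 * k ≤ K) :
    ∑ j ∈ Finset.range K, dd j (hh C k) = fun u => (-1/4 : ℚ) * ((3 * (k : ℚ) - wt u) * hh C k u) := by
  funext u
  rw [hh_P1 C k K hK u, Finset.sum_apply]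
  simp only [dd]; ring

lemma shift_sum (x : ℕ → ℚ) (K0 K e : ℕ) (hx : ∀ i, K0 ≤ i → x i = 0) (hK : K0 ≤ K) :
    ∑ j ∈ Finset.range K, ((j : ℚ) + 1/2) * x (j + e) =
      ∑ i ∈ Finset.range K, ((i : ℚ) - e + 1/2) * x i - ∑ i ∈ Finset.range e, ((i : ℚ) - e + 1/2) * x i := by
  have h1 : ∑ i ∈ Finset.range K, ((i : ℚ) - e + 1/2) * x i =
      ∑ i ∈ Finset.range (e + K), ((i : ℚ) - e + 1/2) * x i := by
    apply Finset.sum_subset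
    · intro i; simp only [Finset.mem_range]; omega
    · intro i _ hi
      rw [Finset.mem_range] at hi
      rw [hx i (by omega), mul_zero]
  rw [h1, Finset.sum_range_add, add_sub_cancel_left]
  apply Finset.sum_congr rfl
  intro j _
  rw [add_comm e j]; push_cast; ring

lemma shift_zero (x : ℕ → ℚ) (K : ℕ) (hx : ∀ i, K ≤ i + 1 → x i = 0) :
    ∑ j ∈ Finset.range K, (if 1 ≤ j + 0 then ((j : ℚ) + 1/2) * x (j + 0 - 1) else 0) =
      ∑ i ∈ Finset.range K, ((i : ℚ) + 3/2) * x i := by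
  cases K with
  | zero => simp
  | succ K =>
    rw [Finset.sum_range_succ', Finset.sum_range_succ, hx K (by omega)]
    simp only [add_zero, mul_zero]
    rw [if_neg (by omega), add_zero]
    apply Finset.sum_congr rfl
    intro j _
    rw [if_pos (by omega), Nat.add_sub_cancel]; push_cast; ring

lemma RR_P1 (C : List ℕ → ℚ) (k d K : ℕ) (hK : 3 * k + d + 1 ≤ K) (u : Multiset ℕ) :
    (3 * ((k : ℚ) + 1) - (2 * d + 1 + wt u)) * RR C k d u =
      -4 * ∑ j ∈ Finset.range K, RR C k d (j ::ₘ u) := by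
  set Q : ℚ := 3 * (k : ℚ) - wt u with hQ
  have hn : (3 * ((k : ℚ) + 1) - (2 * d + 1 + wt u)) = Q - 2 * d + 2 := by rw [hQ]; ring
  set H := hh C k with hH
  set x : ℕ → ℚ := fun j => H (j ::ₘ u) with hx
  have hx0 : ∀ i, 3 * k ≤ i → x i = 0 := by
    intro i hi; apply hh_gt; rw [wt_cons]; omega
  have hP : Q * H u = -4 * ∑ j ∈ Finset.range K, x j := hh_P1 C k K (by omega) u
  -- T1
  have T1 : -4 * ∑ j ∈ Finset.range K, E d H (j ::ₘ u) = (Q - 2 * d + 2) * E d H u -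
      4 * ∑ j ∈ Finset.range K, (if 1 ≤ j + d then ((j : ℚ) + 1/2) * x (j + d - 1) else 0) := by
    have e1 : ∑ j ∈ Finset.range K, E d H (j ::ₘ u) = E d (∑ j ∈ Finset.range K, dd j H) u +
        ∑ j ∈ Finset.range K, (if 1 ≤ j + d then ((j : ℚ) + 1/2) * x (j + d - 1) else 0) := by
      rw [E_sum, Finset.sum_apply, ← Finset.sum_add_distrib]
      apply Finset.sum_congr rfl
      intro j _
      rw [E_cons]; rfl
    have e2 : E d (∑ j ∈ Finset.range K, dd j H) u = -1/4 * (Q - 2 * d + 2) * E d H u := by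
      rw [P1_fun C k K (by omega)]
      rw [show -1/4 * (Q - 2 * d + 2) * E d H u = E d ((-1/4 * (Q - 2 * d + 2)) • H) u by rw [E_smul]; rfl]
      apply E_congr
      intro t _ ht
      have ht' : (wt t : ℚ) + 2 = wt u + 2 * d := by exact_mod_cast ht
      simp only [Pi.smul_apply, smul_eq_mul]
      rw [show (wt t : ℚ) = wt u + 2 * d - 2 by linarith, hQ]; ring
    rw [e1, e2]; ring
  have T2 : -4 * ∑ j ∈ Finset.range K, ∑ a ∈ Finset.range (d - 1), H (a ::ₘ (d - 2 - a) ::ₘ j ::ₘ u) =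
      (Q - 2 * d + 2) * ∑ a ∈ Finset.range (d - 1), H (a ::ₘ (d - 2 - a) ::ₘ u) := by
    rw [Finset.sum_comm, Finset.mul_sum, Finset.mul_sum]
    apply Finset.sum_congr rfl
    intro a ha
    rw [Finset.mem_range] at ha
    have := hh_P1 C k K (by omega) (a ::ₘ (d - 2 - a) ::ₘ u)
    have e : ∀ j, j ::ₘ a ::ₘ (d - 2 - a) ::ₘ u = a ::ₘ (d - 2 - a) ::ₘ j ::ₘ u := by
      intro j; rw [Multiset.cons_swap j a, Multiset.cons_swap j]
    simp only [e] at this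
    rw [← this]
    congr 1
    rw [wt_cons, wt_cons, hQ]
    have : (a : ℚ) + (d - 2 - a : ℕ) = d - 2 := by
      have : a + (d - 2 - a) + 2 = d := by omega
      have : ((a + (d - 2 - a) + 2 : ℕ) : ℚ) = d := by rw [this]
      push_cast at this; linarith
    push_cast
    linarith
  have T3 : -4 * ∑ j ∈ Finset.range K, 1/2 * ((3 * (k : ℚ) - wt (j ::ₘ u)) * H (j ::ₘ u)) =
      1/2 * Q * (Q * H u) + 4 * ∑ j ∈ Finset.range K, ((j : ℚ) + 1/2) * x j := by
    rw [hP, Finset.mul_sum, Finset.mul_sum, Finset.mul_sum, Finset.mul_sum, ← Finset.sum_add_distrib]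
    apply Finset.sum_congr rfl
    intro j _
    rw [wt_cons, hQ, hx]; push_cast; ring
  have T4 : -4 * ∑ j ∈ Finset.range K, 2 * ∑ i ∈ Finset.range (d - 1), H (i ::ₘ j ::ₘ u) =
      2 * ∑ i ∈ Finset.range (d - 1), (Q - 2 * i - 1) * x i := by
    rw [← Finset.mul_sum, Finset.sum_comm, mul_left_comm, Finset.mul_sum]
    congr 1
    apply Finset.sum_congr rfl
    intro i _
    have := hh_P1 C k K (by omega) (i ::ₘ u)
    simp only [fun j => Multiset.cons_swap j i u] at this
    rw [← this, wt_cons, hQ]; push_cast; simp only [hx]; ring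
  have hK1 : 0 ∈ Finset.range K := by rw [Finset.mem_range]; omega
  have T5 : -4 * ∑ j ∈ Finset.range K, conv (cc d) H (j ::ₘ u) =
      (Q - 2 * d + 2) * conv (cc d) H u - if d = 0 then 1/2 * conv t0 H u else 0 := by
    have e1 : ∑ j ∈ Finset.range K, conv (cc d) H (j ::ₘ u) =
        conv (cc d) (∑ j ∈ Finset.range K, dd j H) u + conv (∑ j ∈ Finset.range K, dd j (cc d)) H u := by
      rw [conv_sum_right, conv_sum_left, Finset.sum_apply, Finset.sum_apply, ← Finset.sum_add_distrib]
      apply Finset.sum_congr rfl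
      intro j _
      rw [conv_cons, add_comm]
    have e2 : conv (cc d) (∑ j ∈ Finset.range K, dd j H) u = -1/4 * (Q - 2 * d + 2) * conv (cc d) H u := by
      rw [P1_fun C k K (by omega)]
      rw [show -1/4 * (Q - 2 * d + 2) * conv (cc d) H u = conv (cc d) ((-1/4 * (Q - 2 * d + 2)) • H) u by
        rw [conv_smul_right]; rfl]
      apply conv_congr2
      intro s t hst
      by_cases hs : cc d s = 0
      · rw [hs]; simp
      · have hw : (wt s : ℚ) + 2 * d = 2 := by exact_mod_cast cc_ne hs
        have hw2 : (wt u : ℚ) = wt s + wt t := by rw [← hst, wt_add]; push_cast; ring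
        simp only [Pi.smul_apply, smul_eq_mul]
        rw [hQ, hw2, show (wt s : ℚ) = 2 - 2 * d by linarith]; ring
    have e3 : conv (∑ j ∈ Finset.range K, dd j (cc d)) H u = if d = 0 then 1/8 * conv t0 H u else 0 := by
      split_ifs with h
      · subst h
        rw [Finset.sum_eq_single_of_mem 0 hK1 (fun b _ hb => dd_pos_cc_zero hb), dd_zero_cc_zero,
          conv_smul_left]; rfl
      · have : ∀ j ∈ Finset.range K, dd j (cc d) = 0 := by
          intro j _
          by_cases h1 : d = 1
          · subst h1; rw [cc_one, dd_smul, dd_dlt, smul_zero]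
          · rw [cc_ge_two (by omega)]; rfl
        rw [Finset.sum_eq_zero this, conv_zero_left]; rfl
    rw [e1, e2, e3]
    split_ifs <;> ring
  have T6 : -4 * ∑ j ∈ Finset.range K, conv t0 H (j ::ₘ u) = (Q + 1) * conv t0 H u - 4 * H u := by
    have e1 : ∑ j ∈ Finset.range K, conv t0 H (j ::ₘ u) =
        conv t0 (∑ j ∈ Finset.range K, dd j H) u + conv (∑ j ∈ Finset.range K, dd j t0) H u := by
      rw [conv_sum_right, conv_sum_left, Finset.sum_apply, Finset.sum_apply, ← Finset.sum_add_distrib]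
      apply Finset.sum_congr rfl
      intro j _
      rw [conv_cons, add_comm]
    have e2 : conv t0 (∑ j ∈ Finset.range K, dd j H) u = -1/4 * (Q + 1) * conv t0 H u := by
      rw [P1_fun C k K (by omega)]
      rw [show -1/4 * (Q + 1) * conv t0 H u = conv t0 ((-1/4 * (Q + 1)) • H) u by
        rw [conv_smul_right]; rfl]
      apply conv_congr2
      intro s t hst
      by_cases hs : t0 s = 0
      · rw [hs]; simp
      · have hw : (wt s : ℚ) = 1 := by exact_mod_cast t0_ne hs
        have hw2 : (wt u : ℚ) = wt s + wt t := by rw [← hst, wt_add]; push_cast; ring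
        simp only [Pi.smul_apply, smul_eq_mul]
        rw [hQ, hw2, hw]; ring
    have e3 : conv (∑ j ∈ Finset.range K, dd j t0) H u = H u := by
      rw [Finset.sum_eq_single_of_mem 0 hK1 (fun b _ hb => dd_pos_t0 hb), dd_zero_t0, dlt_conv]
    rw [e1, e2, e3]; ring
  rw [hn]
  simp only [RR]
  rw [← hH]
  simp only [Finset.sum_add_distrib, mul_add]
  rw [T1, T2, T3, T4, T5]
  rcases Nat.eq_zero_or_pos d with rfl | hd
  · simp only [if_true, Finset.sum_sub_distrib, ← Finset.mul_sum]
    rw [mul_sub (-4 : ℚ), show -4 * (1/2 * ∑ j ∈ Finset.range K, conv t0 H (j ::ₘ u)) =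
      1/2 * (-4 * ∑ j ∈ Finset.range K, conv t0 H (j ::ₘ u)) by ring, T6]
    rw [show -4 * ∑ i ∈ Finset.range K, H (i ::ₘ u) = Q * H u from hP.symm]
    rw [shift_zero x K (fun i hi => hx0 i (by omega))]
    have : ∑ i ∈ Finset.range K, ((i : ℚ) + 3/2) * x i = ∑ i ∈ Finset.range K, ((i : ℚ) + 1/2) * x i
        + ∑ i ∈ Finset.range K, x i := by
      rw [← Finset.sum_add_distrib]; apply Finset.sum_congr rfl; intros; ring
    rw [this]
    simp
    linear_combination hP
  · obtain ⟨e, rfl⟩ : ∃ e, d = e + 1 := ⟨d - 1, by omega⟩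
    simp only [Nat.add_sub_cancel, Nat.succ_ne_zero, if_false, Finset.sum_const_zero]
    have hsh : ∑ j ∈ Finset.range K, (if 1 ≤ j + (e + 1) then ((j : ℚ) + 1/2) * x (j + (e + 1) - 1) else 0)
        = ∑ j ∈ Finset.range K, ((j : ℚ) + 1/2) * x (j + e) := by
      apply Finset.sum_congr rfl
      intro j _
      rw [if_pos (by omega)]; rfl
    rw [hsh, shift_sum x (3 * k) K e hx0 (by omega)]
    have s1 : ∑ i ∈ Finset.range K, ((i : ℚ) - e + 1/2) * x i = ∑ i ∈ Finset.range K, ((i : ℚ) + 1/2) * x i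
        - e * ∑ i ∈ Finset.range K, x i := by
      rw [Finset.mul_sum, ← Finset.sum_sub_distrib]; apply Finset.sum_congr rfl; intros; ring
    have s2 : ∑ i ∈ Finset.range e, (Q - 2 * i - 1) * x i = (Q - 2 * e) * ∑ i ∈ Finset.range e, x i -
       2 * ∑ i ∈ Finset.range e, ((i : ℚ) - e + 1/2) * x i := by
      rw [Finset.mul_sum, Finset.mul_sum, ← Finset.sum_sub_distrib]
      apply Finset.sum_congr rfl; intros; ring
    have s3 : ∑ j ∈ Finset.range e, H (j ::ₘ u) = ∑ i ∈ Finset.range e, x i := rfl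
    rw [s1, s2, s3]
    push_cast
    linear_combination (-(e:ℚ)) * hP

lemma conv_apply_zero {f g : Multiset ℕ → ℚ} {u : Multiset ℕ}
    (h : ∀ s t, s + t = u → f s ≠ 0 → g t = 0) : conv f g u = 0 := by
  rw [conv_congr2 (f' := 0) (g' := 0), conv_zero_left]
  · rfl
  · intro s t hst
    by_cases hs : f s = 0
    · rw [hs]; simp
    · rw [h s t hst hs]; simp

lemma tail_zero (C : List ℕ → ℚ) (k d : ℕ) (hd : 1 ≤ d) (u : Multiset ℕ) (h : 3 * (k + 1) ≤ wt (d ::ₘ u)) :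
    1/2 * ((3 * (k : ℚ) - wt u) * hh C k u) + 2 * ∑ j ∈ Finset.range (d - 1), hh C k (j ::ₘ u) = 0 := by
  rw [wt_cons] at h
  rw [hh_P1 C k (3 * k + d) (by omega)]
  have : ∑ j ∈ Finset.range (3 * k + d), hh C k (j ::ₘ u) = ∑ j ∈ Finset.range (d - 1), hh C k (j ::ₘ u) := by
    symm
    apply Finset.sum_subset
    · intro x; simp only [Finset.mem_range]; omega
    · intro x _ hx
      rw [Finset.mem_range] at hx
      apply hh_gt; rw [wt_cons]; omega
  rw [this]; ring

lemma RR_base (C : List ℕ → ℚ) (k d : ℕ) (u : Multiset ℕ) (h : 3 * (k + 1) ≤ wt (d ::ₘ u)) :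
    RR C k d u = E d (hh C k) u + ∑ a ∈ Finset.range (d - 1), hh C k (a ::ₘ (d - 2 - a) ::ₘ u) +
      conv (cc d) (hh C k) u := by
  unfold RR
  rcases Nat.eq_zero_or_pos d with rfl | hd
  · rw [wt_cons] at h
    rw [hh_gt C k u (by omega), conv_apply_zero (f := t0)]
    · simp
    · intro s t hst hs
      have := t0_ne hs
      rw [← hst, wt_add] at h
      apply hh_gt; omega
  · have := tail_zero C k d hd u h
    rw [if_neg (by omega)]
    linear_combination this

lemma E_apply_zero {d : ℕ} {f : Multiset ℕ → ℚ} {u : Multiset ℕ}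
    (h : ∀ t, wt t + 2 = wt u + 2 * d → f t = 0) : E d f u = 0 := by
  rw [E_congr (f' := 0) (fun t _ ht => h t ht)]
  simp [E]

lemma hh_P2 {C : List ℕ → ℚ} (hC : IsNormalizedWitten C) (k d : ℕ) (u : Multiset ℕ) :
    hh C (k + 1) (d ::ₘ u) = RR C k d u := by
  induction hn : 3 * (k + 1) - wt (d ::ₘ u) using Nat.strong_induction_on generalizing u with
  | _ n ih =>
  rcases lt_trichotomy (wt (d ::ₘ u)) (3 * (k + 1)) with h | h | h
  · have h1 := hh_P1 C (k + 1) (3 * k + d + 3) (by omega) (d ::ₘ u)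
    have h2 := RR_P1 C k d (3 * k + d + 3) (by omega) u
    have h3 : ∑ j ∈ Finset.range (3 * k + d + 3), hh C (k + 1) (j ::ₘ d ::ₘ u) =
        ∑ j ∈ Finset.range (3 * k + d + 3), RR C k d (j ::ₘ u) := by
      apply Finset.sum_congr rfl
      intro j _
      rw [Multiset.cons_swap]
      refine ih _ ?_ (j ::ₘ u) rfl
      rw [← hn, Multiset.cons_swap, wt_cons j]; omega
    rw [h3, ← h2] at h1
    have hne : (3 * ((k : ℚ) + 1) - (2 * d + 1 + wt u)) ≠ 0 := by
      have : (wt (d ::ₘ u) : ℚ) < 3 * (k + 1) := by exact_mod_cast h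
      rw [wt_cons] at this
      push_cast at this
      linarith
    apply mul_left_cancel₀ hne
    rw [← h1, wt_cons]; push_cast; ring
  · rw [RR_base C k d u (by omega), hh_eq C _ _ h]
    have hv := congrFun (vir_Z hC d) u
    rw [dd_apply] at hv
    rw [hv]
    simp only [Pi.add_apply, Finset.sum_apply]
    rw [wt_cons] at h
    congr 1
    · congr 1
      · apply E_congr
        intro t _ ht
        rw [hh_eq]; omega
      · apply Finset.sum_congr rfl
        intro a ha
        rw [Finset.mem_range] at ha
        rw [hh_eq, dd_apply, dd_apply, Multiset.cons_swap]
        rw [wt_cons, wt_cons]; omega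
    · apply conv_congr2
      intro s t hst
      by_cases hs : cc d s = 0
      · rw [hs]; simp
      · have hw := cc_ne hs
        rw [hh_eq]
        rw [← hst, wt_add] at h
        omega
  · rw [RR_base C k d u (by omega), hh_gt C _ _ h]
    rw [wt_cons] at h
    rw [E_apply_zero, Finset.sum_eq_zero, conv_apply_zero]
    · simp
    · intro s t hst hs
      have hw := cc_ne hs
      rw [← hst, wt_add] at h
      apply hh_gt; omega
    · intro a ha
      rw [Finset.mem_range] at ha
      apply hh_gt; rw [wt_cons, wt_cons]; omega
    · intro t ht
      apply hh_gt; omega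

lemma hh_zero_zero (C : List ℕ → ℚ) : hh C 0 0 = 1 := by
  rw [hh_eq C 0 0 (by simp), Z_zero]

lemma hh_zero (C : List ℕ → ℚ) : hh C 0 = dlt := by
  funext s
  induction s using Multiset.induction_on with
  | empty => rw [hh_zero_zero]; simp [dlt]
  | cons d s _ => rw [hh_gt]; simp [dlt]; rw [wt_cons]; omega

lemma diag_sum (K e : ℕ) (he : e < K) (G : ℕ → ℕ → ℚ) :
    ∑ a ∈ Finset.range (e + 1), G a (e - a) =
      ∑ a ∈ Finset.range K, ∑ b ∈ Finset.range K, if a + b = e then G a b else 0 := by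
  have : ∀ a ∈ Finset.range K, (∑ b ∈ Finset.range K,
        if a + b = e then G a b else 0) = if a ∈ Finset.range (e + 1) then G a (e - a) else 0 := by
    intro a ha
    split_ifs with h
    · rw [Finset.mem_range] at h
      rw [Finset.sum_eq_single (e - a)]
      · rw [if_pos (by omega)]
      · intro b _ hb; rw [if_neg (by omega)]
      · intro hb; rw [Finset.mem_range] at hb; omega
    · apply Finset.sum_eq_zero
      intro b _
      rw [Finset.mem_range] at h
      rw [if_neg (by omega)]
  rw [Finset.sum_congr rfl this, ← Finset.sum_filter]
  apply Finset.sum_congr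
  · ext a; simp only [Finset.mem_range, Finset.mem_filter]; omega
  · intros; rfl

lemma diag_total (K : ℕ) (G : ℕ → ℕ → ℚ) (w : ℕ → ℚ) (hG : ∀ a b, K ≤ a + b → G a b = 0) :
    ∑ e ∈ Finset.range K, w e * ∑ a ∈ Finset.range (e + 1), G a (e - a) =
      ∑ a ∈ Finset.range K, ∑ b ∈ Finset.range K, w (a + b) * G a b := by
  have h1 : ∀ e ∈ Finset.range K, w e * ∑ a ∈ Finset.range (e + 1), G a (e - a) =
      ∑ a ∈ Finset.range K, ∑ b ∈ Finset.range K, if a + b = e then w (a + b) * G a b else 0 := by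
    intro e he
    rw [Finset.mem_range] at he
    rw [diag_sum K e he, Finset.mul_sum]
    apply Finset.sum_congr rfl; intro a _
    rw [Finset.mul_sum]
    apply Finset.sum_congr rfl; intro b _
    split_ifs with h
    · rw [h]
    · simp
  rw [Finset.sum_congr rfl h1, Finset.sum_comm]
  apply Finset.sum_congr rfl; intro a _
  rw [Finset.sum_comm]
  apply Finset.sum_congr rfl; intro b _
  rw [Finset.sum_ite_eq]
  split_ifs with h
  · rfl
  · rw [Finset.mem_range, not_lt] at h
    rw [hG a b h, mul_zero]

lemma tail_total (K : ℕ) (x w : ℕ → ℚ) :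
    ∑ e ∈ Finset.range K, w e * (∑ j ∈ Finset.range K, x j - ∑ j ∈ Finset.range (e + 1), x j) =
      ∑ j ∈ Finset.range K, (∑ e ∈ Finset.range j, w e) * x j := by
  have h1 : ∀ e ∈ Finset.range K, w e * (∑ j ∈ Finset.range K, x j - ∑ j ∈ Finset.range (e + 1), x j) =
      ∑ j ∈ Finset.range K, if e < j then w e * x j else 0 := by
    intro e he
    rw [Finset.mem_range] at he
    have h2 := Finset.sum_filter_add_sum_filter_not (Finset.range K) (fun j => e < j) x
    have h3 : Finset.filter (fun j => ¬ e < j) (Finset.range K) = Finset.range (e + 1) := by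
      ext j; simp only [Finset.mem_filter, Finset.mem_range]; omega
    rw [h3] at h2
    rw [← h2, add_sub_cancel_right, Finset.sum_filter, Finset.mul_sum]
    apply Finset.sum_congr rfl
    intro j _
    split_ifs <;> simp
  rw [Finset.sum_congr rfl h1, Finset.sum_comm]
  apply Finset.sum_congr rfl
  intro j hj
  rw [Finset.mem_range] at hj
  rw [Finset.sum_mul, ← Finset.sum_filter]
  apply Finset.sum_congr
  · ext e; simp only [Finset.mem_filter, Finset.mem_range]; omega
  · intros; rfl

lemma hh_single {C : List ℕ → ℚ} (hC : IsNormalizedWitten C) (k e : ℕ) :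
    hh C (k + 1) {e + 2} = ∑ a ∈ Finset.range (e + 1), hh C k (a ::ₘ {e - a}) +
      1/2 * (3 * k * hh C k 0) + 2 * ∑ j ∈ Finset.range (e + 1), hh C k {j} := by
  have : hh C (k + 1) {e + 2} = hh C (k + 1) ((e + 2) ::ₘ 0) := rfl
  rw [this, hh_P2 hC, RR, E_zero, cc_ge_two (by omega), conv_zero_left, if_neg (by omega)]
  simp only [Pi.zero_apply, wt_zero, Nat.cast_zero, sub_zero, add_zero, zero_add]
  rfl

lemma hh_single_zero {C : List ℕ → ℚ} (hC : IsNormalizedWitten C) (k : ℕ) :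
    hh C (k + 1) {0} = (3 * k / 2 + 1) * hh C k 0 := by
  have : hh C (k + 1) {0} = hh C (k + 1) (0 ::ₘ 0) := rfl
  rw [this, hh_P2 hC, RR, E_zero, conv_zero', cc_zero_zero, conv_zero']
  simp [t0]; ring

lemma hh_single_one {C : List ℕ → ℚ} (hC : IsNormalizedWitten C) (k : ℕ) :
    hh C (k + 1) {1} = (3 * k / 2 + 1/16) * hh C k 0 := by
  have : hh C (k + 1) {1} = hh C (k + 1) (1 ::ₘ 0) := rfl
  rw [this, hh_P2 hC, RR, E_zero, cc_one, conv_dlt_smul]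
  simp; ring

/-- first moment -/
def E1 (C : List ℕ → ℚ) (k K : ℕ) : ℚ := ∑ j ∈ Finset.range K, (j : ℚ) * hh C k {j}

lemma hh_sv (C : List ℕ → ℚ) (k j : ℕ) (h : 3 * k ≤ j) : hh C k {j} = 0 := by
  apply hh_gt
  rw [show ({j} : Multiset ℕ) = j ::ₘ 0 from rfl, wt_cons]; omega

lemma drop_two (x w : ℕ → ℚ) (K : ℕ) (h1 : x K = 0) (h2 : x (K + 1) = 0) :
    ∑ e ∈ Finset.range K, w (e + 2) * x (e + 2) =
      ∑ d ∈ Finset.range K, w d * x d - w 0 * x 0 - w 1 * x 1 := by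
  have h := Finset.sum_range_succ' (fun d => w d * x d) (K + 1)
  rw [Finset.sum_range_succ, Finset.sum_range_succ, Finset.sum_range_succ' _ K, h1, h2] at h
  simp only [mul_zero, add_zero, zero_add] at h
  rw [h]; ring_nf

lemma moments {C : List ℕ → ℚ} (hC : IsNormalizedWitten C) (k K : ℕ) (hK : 3 * k + 3 ≤ K) :
    6 * E1 C k K = 3 * (k + 1) * hh C (k + 1) 0 + (9 * k ^ 2 + 45 * k + 17) / 4 * hh C k 0 ∧
    (3 * k - 3) * E1 C k K + 2 * E1 C (k + 1) K =
      -3 * (k + 1) * hh C (k + 1) 0 - (9 * k + 33/8) * hh C k 0 := by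
  set x : ℕ → ℚ := fun j => hh C k {j} with hx
  set y : ℕ → ℚ := fun j => hh C (k + 1) {j} with hy
  set G : ℕ → ℕ → ℚ := fun a b => hh C k (a ::ₘ {b}) with hG
  have hGs : ∀ a b, G a b = G b a := by
    intro a b
    simp only [hG]
    rw [show ({b} : Multiset ℕ) = b ::ₘ 0 from rfl, Multiset.cons_swap]; rfl
  have hGv : ∀ a b, K ≤ a + b → G a b = 0 := by
    intro a b h
    apply hh_gt
    rw [show ({b} : Multiset ℕ) = b ::ₘ 0 from rfl, wt_cons, wt_cons]; omega
  have p0 : 3 * k * hh C k 0 = -4 * ∑ j ∈ Finset.range K, x j := by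
    have := hh_P1 C k K (by omega) 0
    simpa using this
  have p0' : 3 * (k + 1) * hh C (k + 1) 0 = -4 * ∑ j ∈ Finset.range K, y j := by
    have := hh_P1 C (k + 1) K (by omega) 0
    simpa using this
  have p1 : ∀ j, (3 * (k : ℚ) - 2 * j - 1) * x j = -4 * ∑ i ∈ Finset.range K, G i j := by
    intro j
    have := hh_P1 C k K (by omega) {j}
    rw [show ({j} : Multiset ℕ) = j ::ₘ 0 from rfl, wt_cons] at this
    rw [← show hh C k (j ::ₘ 0) = x j from rfl]
    simp only [hG]
    rw [show ({j} : Multiset ℕ) = j ::ₘ 0 from rfl, ← this]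
    push_cast [wt_zero]; ring
  have hye : ∀ e, y (e + 2) = ∑ a ∈ Finset.range (e + 1), G a (e - a) -
      2 * (∑ j ∈ Finset.range K, x j - ∑ j ∈ Finset.range (e + 1), x j) := by
    intro e
    simp only [hy]
    rw [hh_single hC, p0]; ring
  have tot : ∀ w : ℕ → ℚ, ∑ e ∈ Finset.range K, w e * y (e + 2) =
      ∑ a ∈ Finset.range K, ∑ b ∈ Finset.range K, w (a + b) * G a b -
      2 * ∑ j ∈ Finset.range K, (∑ e ∈ Finset.range j, w e) * x j := by
    intro w
    rw [← diag_total K G w hGv, ← tail_total, Finset.mul_sum, ← Finset.sum_sub_distrib]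
    apply Finset.sum_congr rfl
    intro e _
    rw [hye]; ring
  have tot0 := tot (fun _ => 1)
  have tot1 := tot (fun e => e)
  have dr0 := drop_two y (fun _ => 1) K (hh_sv C _ _ (by omega)) (hh_sv C _ _ (by omega))
  have dr1 := drop_two y (fun d => (d : ℚ) - 2) K (hh_sv C _ _ (by omega)) (hh_sv C _ _ (by omega))
  have y0 : y 0 = (3 * k / 2 + 1) * hh C k 0 := hh_single_zero hC k
  have y1 : y 1 = (3 * k / 2 + 1/16) * hh C k 0 := hh_single_one hC k
  have s0 : (3 * (k : ℚ) - 1) * ∑ j ∈ Finset.range K, x j - 2 * E1 C k K =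
      -4 * ∑ a ∈ Finset.range K, ∑ b ∈ Finset.range K, G a b := by
    rw [Finset.sum_comm, E1, Finset.mul_sum, Finset.mul_sum, Finset.mul_sum, ← Finset.sum_sub_distrib]
    apply Finset.sum_congr rfl
    intro j _
    rw [← p1 j]; simp only [hx]; ring
  have s1 : (3 * (k : ℚ) - 1) * E1 C k K - 2 * ∑ j ∈ Finset.range K, (j : ℚ) ^ 2 * x j =
      -4 * ∑ a ∈ Finset.range K, ∑ b ∈ Finset.range K, (b : ℚ) * G a b := by
    rw [Finset.sum_comm, E1, Finset.mul_sum, Finset.mul_sum, Finset.mul_sum, ← Finset.sum_sub_distrib]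
    apply Finset.sum_congr rfl
    intro j _
    rw [← Finset.mul_sum]
    have := p1 j
    simp only [hx] at this ⊢
    linear_combination (j : ℚ) * this
  have s2 : ∑ a ∈ Finset.range K, ∑ b ∈ Finset.range K, (((a + b : ℕ) : ℚ)) * G a b =
      2 * ∑ a ∈ Finset.range K, ∑ b ∈ Finset.range K, (b : ℚ) * G a b := by
    have : ∑ a ∈ Finset.range K, ∑ b ∈ Finset.range K, (a : ℚ) * G a b =
        ∑ a ∈ Finset.range K, ∑ b ∈ Finset.range K, (b : ℚ) * G a b := by
      rw [Finset.sum_comm]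
      refine Finset.sum_congr rfl fun a _ => Finset.sum_congr rfl fun b _ => ?_
      rw [hGs]
    rw [two_mul]
    nth_rw 1 [← this]
    rw [← Finset.sum_add_distrib]
    refine Finset.sum_congr rfl fun a _ => ?_
    rw [← Finset.sum_add_distrib]
    refine Finset.sum_congr rfl fun b _ => ?_
    push_cast; ring
  have gs : ∀ j : ℕ, ∑ e ∈ Finset.range j, (e : ℚ) = (j : ℚ) * (j - 1) / 2 := by
    intro j
    induction j with
    | zero => simp
    | succ j ih => rw [Finset.sum_range_succ, ih]; push_cast; ring
  have g2 : ∑ j ∈ Finset.range K, (∑ e ∈ Finset.range j, (e : ℚ)) * x j =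
      1/2 * ∑ j ∈ Finset.range K, (j : ℚ) ^ 2 * x j - 1/2 * E1 C k K := by
    rw [E1, Finset.mul_sum, Finset.mul_sum, ← Finset.sum_sub_distrib]
    apply Finset.sum_congr rfl
    intro j _
    rw [gs]; simp only [hx]; ring
  have g1 : ∑ j ∈ Finset.range K, (∑ e ∈ Finset.range j, (1 : ℚ)) * x j = E1 C k K := by
    simp [E1, hx]
  have d1 : ∑ d ∈ Finset.range K, ((d : ℚ) - 2) * y d = E1 C (k + 1) K - 2 * ∑ j ∈ Finset.range K, y j := by
    rw [E1, Finset.mul_sum, ← Finset.sum_sub_distrib]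
    apply Finset.sum_congr rfl
    intro j _
    simp only [hy]; ring
  simp only [one_mul] at tot0 dr0
  rw [g1] at tot0
  rw [g2, s2] at tot1
  rw [d1] at dr1
  have dr1' : ∑ e ∈ Finset.range K, (e : ℚ) * y (e + 2) =
      ∑ e ∈ Finset.range K, (((e + 2 : ℕ) : ℚ) - 2) * y (e + 2) := by
    apply Finset.sum_congr rfl; intros; push_cast; ring
  rw [← dr1'] at dr1
  rw [y0, y1] at dr0 dr1
  push_cast at dr1
  constructor
  · linear_combination (-4) * dr0 + (4:ℚ) * tot0 - p0' + (1 - 3 * (k:ℚ)) / 4 * p0 + s0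
  · linear_combination (-2) * dr1 + (2:ℚ) * tot1 + s1 + p0'

lemma three_term {C : List ℕ → ℚ} (hC : IsNormalizedWitten C) (j : ℕ) :
    (8/9 : ℚ) * (j + 2) * hh C (j + 2) 0 +
      2/3 * (3 * (j + 1) ^ 2 + 5 * (j + 1) + 17/9) * hh C (j + 1) 0 +
      (j + 2) * (j + 4/3) * (j + 2/3) * hh C j 0 = 0 := by
  obtain ⟨h1, h2⟩ := moments hC j (3 * j + 6) (by omega)
  obtain ⟨h3, -⟩ := moments hC (j + 1) (3 * j + 6) (by omega)
  push_cast at h3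
  linear_combination (8/9 : ℚ) * h2 - (8/9) * (3 * j - 3) / 6 * h1 - (8/9) * 2 / 6 * h3

lemma hh_one_zero {C : List ℕ → ℚ} (hC : IsNormalizedWitten C) : hh C 1 0 = -17/12 := by
  obtain ⟨h1, -⟩ := moments hC 0 3 (by omega)
  have : E1 C 0 3 = 0 := by
    rw [E1]
    apply Finset.sum_eq_zero
    intro j _
    rw [hh_sv _ _ _ (by omega), mul_zero]
  rw [this, hh_zero_zero] at h1
  norm_num at h1
  linarith

/-- constant function one -/
def one : Multiset ℕ → ℚ := fun _ => 1

/-- multiplication by the weight -/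
def wm (f : Multiset ℕ → ℚ) : Multiset ℕ → ℚ := fun s => (wt s : ℚ) * f s

lemma wm_conv (f g : Multiset ℕ → ℚ) : wm (conv f g) = conv (wm f) g + conv f (wm g) := by
  funext s
  simp only [wm, Pi.add_apply, conv]
  rw [← Multiset.sum_map_add, ← Multiset.sum_map_mul_left]
  congr 1
  apply Multiset.map_congr rfl
  intro p hp
  rw [Multiset.mem_antidiagonal] at hp
  rw [← hp, wt_add]; push_cast; ring

lemma dd_one (d : ℕ) : dd d one = one := rfl

lemma E_one_pos {d : ℕ} (hd : 1 ≤ d) : E d one = (1/2 : ℚ) • wm one := by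
  funext s
  induction s using Multiset.induction_on with
  | empty => simp [E_zero, wm]
  | cons e s ih =>
    rw [E_cons, dd_one, ih, sh, if_pos (by omega)]
    simp [wm, one]; ring

lemma E_one_zero : E 0 one = (1/2 : ℚ) • wm one - (1/2 : ℚ) • conv t0 one := by
  funext s
  induction s using Multiset.induction_on with
  | empty => simp [E_zero, wm, conv_zero', t0]
  | cons e s ih =>
    rw [E_cons, dd_one, ih, sh]
    simp only [Pi.sub_apply, Pi.smul_apply, conv_cons, dd_one]
    by_cases he : e = 0
    · subst he
      rw [dd_zero_t0, dlt_conv]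
      simp [wm, one]; ring
    · rw [dd_pos_t0 he, conv_zero_left, if_pos (by omega)]
      simp [wm, one]; ring

/-- The functions `Ĥ_k`. -/
def Hk (C : List ℕ → ℚ) (k : ℕ) : Multiset ℕ → ℚ := conv (hh C k) one

lemma Hk_zero (C : List ℕ → ℚ) : Hk C 0 = one := by rw [Hk, hh_zero, dlt_conv]

lemma Hk_empty (C : List ℕ → ℚ) (k : ℕ) : Hk C k 0 = hh C k 0 := by
  rw [Hk, conv_zero']; simp [one]

lemma Hk_rec {C : List ℕ → ℚ} (hC : IsNormalizedWitten C) (k d : ℕ) (s : Multiset ℕ) :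
    Hk C (k + 1) (d ::ₘ s) = Hk C (k + 1) s + E d (Hk C k) s +
      ∑ a ∈ Finset.range (d - 1), Hk C k (a ::ₘ (d - 2 - a) ::ₘ s) - ((d : ℚ) - 1) * Hk C k s +
      1/2 * (3 * k - wt s) * Hk C k s + conv (cc d) (Hk C k) s := by
  have h1 : dd d (hh C (k + 1)) = E d (hh C k) +
      ∑ a ∈ Finset.range (d - 1), dd a (dd (d - 2 - a) (hh C k)) +
      ((3 * (k : ℚ) / 2) • hh C k - (1/2 : ℚ) • wm (hh C k)) +
      (2 : ℚ) • ∑ j ∈ Finset.range (d - 1), dd j (hh C k) + conv (cc d) (hh C k) +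
      if d = 0 then hh C k - (1/2 : ℚ) • conv t0 (hh C k) else 0 := by
    funext u
    rw [dd_apply, hh_P2 hC, RR]
    simp only [Pi.add_apply, Finset.sum_apply, Pi.sub_apply, Pi.smul_apply, smul_eq_mul, wm, dd_apply]
    have : ∀ a, hh C k (a ::ₘ (d - 2 - a) ::ₘ u) = hh C k ((d - 2 - a) ::ₘ a ::ₘ u) := fun a => by
      rw [Multiset.cons_swap]
    simp only [this]
    split_ifs
    · simp only [Pi.sub_apply, Pi.smul_apply, smul_eq_mul]; ring
    · simp only [Pi.zero_apply]; ring
  have hE : conv (E d (hh C k)) one = E d (Hk C k) - conv (hh C k) (E d one) := by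
    rw [Hk, E_conv]; simp
  have hab : ∀ a b, conv (dd a (dd b (hh C k))) one = dd a (dd b (Hk C k)) -
      conv (dd a (hh C k)) one - conv (dd b (hh C k)) one - Hk C k := by
    intro a b
    simp only [Hk, dd_conv, dd_add, dd_one]
    abel
  have hwm : conv (wm (hh C k)) one = wm (Hk C k) - conv (hh C k) (wm one) := by
    rw [Hk, wm_conv]; simp
  have h2 : conv (dd d (hh C (k + 1))) one = E d (Hk C k) +
      ∑ a ∈ Finset.range (d - 1), dd a (dd (d - 2 - a) (Hk C k)) - ((d : ℚ) - 1) • Hk C k +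
      (3 * (k : ℚ) / 2) • Hk C k - (1/2 : ℚ) • wm (Hk C k) + conv (cc d) (Hk C k) := by
    have hsub : ∀ f g h : Multiset ℕ → ℚ, conv (f - g) h = conv f h - conv g h := by
      intro f g h
      rw [sub_eq_add_neg, show -g = (-1 : ℚ) • g by simp, conv_add_left, conv_smul_left]; simp [sub_eq_add_neg]
    have hsubr : ∀ f g h : Multiset ℕ → ℚ, conv h (f - g) = conv h f - conv h g := by
      intro f g h
      rw [conv_comm, hsub, conv_comm f, conv_comm g]
    rw [h1]
    simp only [conv_add_left, conv_sum_left, conv_smul_left, hsub, hE, hab, hwm, conv_assoc]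
    rw [← Hk]
    simp only [Finset.sum_sub_distrib, Finset.sum_const, Finset.card_range]
    rcases Nat.eq_zero_or_pos d with rfl | hd
    · simp only [if_true]
      rw [hsub, conv_smul_left, conv_assoc, ← Hk, E_one_zero, hsubr, conv_smul_right, conv_smul_right,
        conv_left_comm (hh C k) t0, ← Hk]
      simp
      module
    · rw [if_neg (by omega), conv_zero_left, E_one_pos hd, conv_smul_right]
      have hr : ∑ a ∈ Finset.range (d - 1), conv (dd (d - 2 - a) (hh C k)) one =
          ∑ a ∈ Finset.range (d - 1), conv (dd a (hh C k)) one := by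
        rw [← Finset.sum_range_reflect]
        apply Finset.sum_congr rfl
        intro a ha
        rw [Finset.mem_range] at ha
        congr 2; omega
      rw [hr]
      have hdc : ((d - 1 : ℕ) : ℚ) = (d : ℚ) - 1 := by rw [Nat.cast_sub hd]; simp
      rw [← hdc, Nat.cast_smul_eq_nsmul]
      module
  have h3 : Hk C (k + 1) (d ::ₘ s) = Hk C (k + 1) s + conv (dd d (hh C (k + 1))) one s := by
    rw [Hk, conv_cons, dd_one]; ring
  rw [h3, h2]
  simp only [Pi.add_apply, Pi.sub_apply, Finset.sum_apply, Pi.smul_apply, smul_eq_mul, wm, dd_apply]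
  have : ∀ a, Hk C k (a ::ₘ (d - 2 - a) ::ₘ s) = Hk C k ((d - 2 - a) ::ₘ a ::ₘ s) := fun a => by
    rw [Multiset.cons_swap]
  simp only [this]
  ring

section

open Filter Topology

lemma Gamma_half_sq (y : ℝ) (hy : 0 < y) : Real.Gamma (y + 1/2) ^ 2 ≤ y * Real.Gamma y ^ 2 := by
  have h := Real.Gamma_mul_add_mul_le_rpow_Gamma_mul_rpow_Gamma (s := y) (t := y + 1) (a := 1/2) (b := 1/2)
    hy (by positivity) (by norm_num) (by norm_num) (by norm_num)
  rw [show (1/2 * y + 1/2 * (y + 1) : ℝ) = y + 1/2 by ring, ← Real.sqrt_eq_rpow, ← Real.sqrt_eq_rpow] at h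
  have hp := Real.Gamma_pos_of_pos hy
  have hp2 := Real.Gamma_pos_of_pos (show 0 < y + 1/2 by positivity)
  have hp3 := Real.Gamma_pos_of_pos (show 0 < y + 1 by positivity)
  have h2 := pow_le_pow_left₀ hp2.le h 2
  rw [mul_pow, Real.sq_sqrt hp.le, Real.sq_sqrt hp3.le, Real.Gamma_add_one hy.ne'] at h2
  linarith

lemma gam_step_sq (X : ℝ) (hX : 0 < X) : gam (X + 1) ^ 2 * (27 * ((X / 2 + 3/2) ^ 2 * X ^ 2)) ≤
    gam X ^ 2 * (4 * ((3 * X / 2 + 1) ^ 2 * (3 * X / 2 + 2) * (X / 2 + 2))) := by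
  set A := Real.Gamma (3 * X / 2 + 1) with hA
  set A' := Real.Gamma (3 * X / 2 + 5/2) with hA'
  set B := Real.Gamma ((X + 3) / 2) with hB
  set B' := Real.Gamma ((X + 4) / 2) with hB'
  set G := Real.Gamma X with hG
  have pA : 0 < A := Real.Gamma_pos_of_pos (by positivity)
  have pA' : 0 < A' := Real.Gamma_pos_of_pos (by positivity)
  have pB : 0 < B := Real.Gamma_pos_of_pos (by positivity)
  have pB' : 0 < B' := Real.Gamma_pos_of_pos (by positivity)
  have pG : 0 < G := Real.Gamma_pos_of_pos hX
  have i1 : A' ^ 2 ≤ (3 * X / 2 + 2) * ((3 * X / 2 + 1) * A) ^ 2 := by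
    have := Gamma_half_sq (3 * X / 2 + 2) (by positivity)
    rw [show 3 * X / 2 + 2 + 1/2 = 3 * X / 2 + 5/2 by ring, show Real.Gamma (3 * X / 2 + 2) = (3 * X / 2 + 1) * A by
      rw [hA, ← Real.Gamma_add_one (by positivity)]; ring_nf] at this
    exact this
  have i2 : ((X / 2 + 3/2) * B) ^ 2 ≤ (X / 2 + 2) * B' ^ 2 := by
    have := Gamma_half_sq ((X + 4) / 2) (by positivity)
    rw [show (X + 4) / 2 + 1/2 = (X + 3) / 2 + 1 by ring, Real.Gamma_add_one (by positivity)] at this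
    calc ((X / 2 + 3/2) * B) ^ 2 = ((X + 3) / 2 * Real.Gamma ((X + 3) / 2)) ^ 2 := by rw [hB]; ring
      _ ≤ _ := this
      _ = _ := by rw [hB']; ring
  set P := (2:ℝ) ^ X with hP
  set T := (3:ℝ) ^ ((3 * X + 1) / 2) with hT
  have pP : 0 < P := by positivity
  have pT : 0 < T := by positivity
  have hs : 0 < Real.sqrt Real.pi := Real.sqrt_pos.2 Real.pi_pos
  set s := Real.sqrt Real.pi with hs'
  have hT2 : ((3:ℝ) ^ ((3 * (X + 1) + 1) / 2)) ^ 2 = 27 * T ^ 2 := by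
    rw [hT, ← Real.rpow_natCast, ← Real.rpow_natCast, ← Real.rpow_mul (by norm_num), ← Real.rpow_mul (by norm_num),
      show (3 * (X + 1) + 1) / 2 * ((2:ℕ):ℝ) = (3 * X + 1) / 2 * ((2:ℕ):ℝ) + 3 by push_cast; ring,
      Real.rpow_add (by norm_num)]
    norm_num; ring
  have g0 : gam X = P / (s * T) * (A / (B * G)) := rfl
  have g1 : gam (X + 1) ^ 2 = (2 * P) ^ 2 / (s ^ 2 * (27 * T ^ 2)) * (A' ^ 2 / (B' ^ 2 * (X * G) ^ 2)) := by
    unfold gam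
    rw [← hT2, show 3 * (X + 1) / 2 + 1 = 3 * X / 2 + 5/2 by ring, show X + 1 + 3 = X + 4 by ring,
      Real.Gamma_add_one hX.ne', Real.rpow_add (by norm_num), Real.rpow_one]
    rw [← hP, ← hA', ← hB', ← hG, ← hs']
    field_simp
  rw [g1, g0]
  have lhs : (2 * P) ^ 2 / (s ^ 2 * (27 * T ^ 2)) * (A' ^ 2 / (B' ^ 2 * (X * G) ^ 2)) * (27 * ((X / 2 + 3/2) ^ 2 * X ^ 2)) =
      (4 * P ^ 2 / (s ^ 2 * T ^ 2 * G ^ 2)) * (A' ^ 2 * ((X / 2 + 3/2) * B) ^ 2 / (B' ^ 2 * B ^ 2)) := by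
    field_simp
    norm_num
  have rhs : (P / (s * T) * (A / (B * G))) ^ 2 * (4 * ((3 * X / 2 + 1) ^ 2 * (3 * X / 2 + 2) * (X / 2 + 2))) =
      (4 * P ^ 2 / (s ^ 2 * T ^ 2 * G ^ 2)) * (((3 * X / 2 + 2) * ((3 * X / 2 + 1) * A) ^ 2) * ((X / 2 + 2) * B' ^ 2) /
        (B' ^ 2 * B ^ 2)) := by
    field_simp
  rw [lhs, rhs]
  gcongr

/-- gamma at natural numbers -/
def ga (n : ℕ) : ℝ := gam n

lemma ga_pos {n : ℕ} (h : 1 ≤ n) : 0 < ga n := gam_pos _ (by exact_mod_cast h)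

lemma ga_rec {n : ℕ} (h : 1 ≤ n) : ga (n + 2) * (((n:ℝ) + 3) * (n + 1) * n) =
    ga n * ((n + 2) * (n + 4/3) * (n + 2/3)) := by
  have := gam_rec (n : ℝ) (by exact_mod_cast h)
  unfold ga; push_cast; exact this

lemma ga_mono {n : ℕ} (h : 1 ≤ n) : ga n ≤ ga (n + 2) := by
  have h1 := ga_rec h
  have hn : (1:ℝ) ≤ n := by exact_mod_cast h
  have hp := ga_pos h
  have hq : 0 < ((n:ℝ) + 3) * (n + 1) * n := by positivity
  refine le_of_mul_le_mul_right ?_ hq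
  rw [h1]
  apply mul_le_mul_of_nonneg_left _ hp.le
  nlinarith

lemma ga_anti {n : ℕ} (h : 1 ≤ n) : ga (n + 2) * (1 + 1 / ((n + 2 : ℕ) : ℝ)) ≤ ga n * (1 + 1 / (n : ℝ)) := by
  have h1 := ga_rec h
  have hn : (1:ℝ) ≤ n := by exact_mod_cast h
  have hp := ga_pos h
  have e : ga (n + 2) = ga n * ((n + 2) * (n + 4/3) * (n + 2/3)) / (((n:ℝ) + 3) * (n + 1) * n) := by
    rw [← h1]; field_simp
  rw [e, mul_div_assoc, mul_assoc]
  apply mul_le_mul_of_nonneg_left _ hp.le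
  push_cast
  rw [div_mul_eq_mul_div, div_le_iff₀ (by positivity)]
  have : ((1:ℝ) + 1 / (n:ℝ)) * (((n:ℝ) + 3) * (n + 1) * n) = (n + 1) * ((n + 3) * (n + 1)) := by
    field_simp
  rw [this]
  have : (((n:ℝ) + 2) * (n + 4/3) * (n + 2/3)) * (1 + 1 / ((n:ℝ) + 2)) = (n + 4/3) * (n + 2/3) * (n + 3) := by
    field_simp; ring
  rw [this]
  nlinarith

lemma ga_lim_aux {X : ℕ} (h : 1 ≤ X) : ∃ L : ℝ, Tendsto (fun i : ℕ => ga (X + 2 * i)) atTop (𝓝 L) := by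
  have hm : Monotone (fun i : ℕ => ga (X + 2 * i)) := by
    apply monotone_nat_of_le_succ
    intro i
    exact ga_mono (by omega)
  have hb : ∀ i : ℕ, ga (X + 2 * i) * (1 + 1 / ((X + 2 * i : ℕ) : ℝ)) ≤ ga X * (1 + 1 / (X : ℝ)) := by
    intro i
    induction i with
    | zero => simp
    | succ i ih => exact (ga_anti (n := X + 2 * i) (by omega)).trans ih
  refine ⟨_, tendsto_atTop_ciSup hm ⟨ga X * (1 + 1 / (X : ℝ)), ?_⟩⟩
  rintro _ ⟨i, rfl⟩
  refine le_trans ?_ (hb i)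
  have := ga_pos (n := X + 2 * i) (by omega)
  have h2 : (0:ℝ) ≤ 1 / ((X + 2 * i : ℕ) : ℝ) := by positivity
  simp only
  nlinarith

lemma ga_lim_bounds {X : ℕ} (h : 1 ≤ X) {L : ℝ} (hL : Tendsto (fun i : ℕ => ga (X + 2 * i)) atTop (𝓝 L)) :
    ga X ≤ L ∧ L ≤ ga X * (1 + 1 / (X : ℝ)) := by
  have hm : Monotone (fun i : ℕ => ga (X + 2 * i)) := by
    apply monotone_nat_of_le_succ
    intro i
    exact ga_mono (by omega)
  have hb : ∀ i : ℕ, ga (X + 2 * i) * (1 + 1 / ((X + 2 * i : ℕ) : ℝ)) ≤ ga X * (1 + 1 / (X : ℝ)) := by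
    intro i
    induction i with
    | zero => simp
    | succ i ih => exact (ga_anti (n := X + 2 * i) (by omega)).trans ih
  constructor
  · exact hm.ge_of_tendsto hL 0
  · apply le_of_tendsto' hL
    intro i
    refine le_trans ?_ (hb i)
    have := ga_pos (n := X + 2 * i) (by omega)
    have h2 : (0:ℝ) ≤ 1 / ((X + 2 * i : ℕ) : ℝ) := by positivity
    nlinarith

lemma ga_lim_le {X : ℕ} (h : 1 ≤ X) {L L' : ℝ} (hL : Tendsto (fun i : ℕ => ga (X + 2 * i)) atTop (𝓝 L))
    (hL' : Tendsto (fun i : ℕ => ga (X + 1 + 2 * i)) atTop (𝓝 L')) : L' ≤ L := by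
  have hLp : 0 < L := (ga_pos h).trans_le (ga_lim_bounds h hL).1
  set v : ℝ → ℝ := fun w => 4 * ((3/2 + w) ^ 2 * (3/2 + 2 * w) * (1/2 + 2 * w)) / (27 * (1/2 + 3/2 * w) ^ 2) with hv
  have hle : ∀ i : ℕ, ga (X + 1 + 2 * i) ^ 2 ≤ ga (X + 2 * i) ^ 2 * v (1 / ((X + 2 * i : ℕ) : ℝ)) := by
    intro i
    have hn : (0:ℝ) < ((X + 2 * i : ℕ) : ℝ) := by exact_mod_cast (by omega)
    have := gam_step_sq _ hn
    have e : ga (X + 1 + 2 * i) = gam (((X + 2 * i : ℕ) : ℝ) + 1) := by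
      unfold ga; congr 1; push_cast; ring
    rw [e, show ga (X + 2 * i) = gam ((X + 2 * i : ℕ) : ℝ) from rfl]
    set x := ((X + 2 * i : ℕ) : ℝ)
    have hq : 0 < 27 * ((x / 2 + 3/2) ^ 2 * x ^ 2) := by positivity
    rw [← le_div_iff₀ hq] at this
    refine this.trans (le_of_eq ?_)
    rw [mul_div_assoc]
    congr 1
    simp only [hv]
    field_simp
  have h0 : Tendsto (fun i : ℕ => 1 / ((X + 2 * i : ℕ) : ℝ)) atTop (𝓝 0) := by
    have : Tendsto (fun i : ℕ => X + 2 * i) atTop atTop := by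
      apply tendsto_atTop_mono (f := fun i : ℕ => i) (fun i => by omega) tendsto_id
    exact tendsto_one_div_atTop_nhds_zero_nat.comp this
  have hvc : ContinuousAt v 0 := by
    simp only [hv]
    apply ContinuousAt.div
    · fun_prop
    · fun_prop
    · norm_num
  have hv0 : v 0 = 1 := by simp only [hv]; norm_num
  have hvt : Tendsto (fun i : ℕ => v (1 / ((X + 2 * i : ℕ) : ℝ))) atTop (𝓝 1) := by
    have h5 := hvc.tendsto
    rw [hv0] at h5
    exact h5.comp h0
  have := le_of_tendsto_of_tendsto' (hL'.pow 2) ((hL.pow 2).mul hvt) hle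
  rw [mul_one] at this
  exact abs_le_of_sq_le_sq' this hLp.le |>.2

lemma ga_lim : ∃ L : ℝ, 0 < L ∧ ∀ X : ℕ, 1 ≤ X → ga X ≤ L ∧ L ≤ ga X * (1 + 1 / (X : ℝ)) := by
  obtain ⟨L1, h1⟩ := ga_lim_aux (X := 1) le_rfl
  obtain ⟨L2, h2⟩ := ga_lim_aux (X := 2) (by omega)
  have h3 : Tendsto (fun i : ℕ => ga (3 + 2 * i)) atTop (𝓝 L1) := by
    have := (tendsto_add_atTop_iff_nat 1).2 h1
    refine this.congr fun i => ?_
    congr 1; ring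
  have e : L1 = L2 := le_antisymm (ga_lim_le (X := 2) (by omega) h2 h3) (ga_lim_le (X := 1) le_rfl h1 h2)
  subst e
  refine ⟨L1, (ga_pos le_rfl).trans_le (ga_lim_bounds le_rfl h1).1, ?_⟩
  intro X hX
  apply ga_lim_bounds hX
  rcases Nat.even_or_odd' X with ⟨c, rfl | rfl⟩
  · have := (tendsto_add_atTop_iff_nat (c - 1)).2 h2
    refine this.congr fun i => ?_
    congr 1; omega
  · have := (tendsto_add_atTop_iff_nat c).2 h1
    refine this.congr fun i => ?_
    congr 1; omega

/-- ratios of rescaled factorials -/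
def ek (k : ℕ) (X : ℝ) : ℝ := (2/3) ^ k / ∏ i ∈ Finset.range k, (X - (i + 1))

lemma ek_zero (X : ℝ) : ek 0 X = 1 := by simp [ek]

lemma ek_succ (k : ℕ) (X : ℝ) : ek (k + 1) X = ek k X * ((2/3) / (X - (k + 1))) := by
  unfold ek; rw [Finset.prod_range_succ, pow_succ, mul_div_mul_comm]

lemma ek_shift (k : ℕ) (X : ℝ) (hX : (k : ℝ) < X) :
    (X + 1) * X * ek k (X + 2) = (X + 1 - k) * (X - k) * ek k X := by
  induction k with
  | zero => simp [ek_zero]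
  | succ k ih =>
    push_cast at hX
    have := ih (by linarith)
    rw [ek_succ, ek_succ]
    have h1 : X + 2 - (k + 1) ≠ 0 := by linarith
    have h2 : X - (k + 1) ≠ 0 := by linarith
    rw [← mul_assoc, this]
    push_cast
    rw [show X + 2 - ((k:ℝ) + 1) = X + 1 - k by ring] at h1 ⊢
    field_simp
    ring

lemma ek_abs (k : ℕ) (X : ℝ) (hX : 2 * (k : ℝ) ≤ X) (hX1 : 1 ≤ X) : |ek k X| ≤ (4/3) ^ k / X ^ k := by
  induction k with
  | zero => simp [ek_zero]
  | succ k ih =>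
    push_cast at hX
    rw [ek_succ, abs_mul, pow_succ, pow_succ, mul_div_mul_comm]
    apply mul_le_mul (ih (by linarith)) _ (abs_nonneg _) (by positivity)
    have : 0 < X - (k + 1) := by
      have : (0:ℝ) ≤ k := by positivity
      linarith
    rw [abs_of_pos (by positivity), div_le_div_iff₀ this (by linarith)]
    linarith

/-- partial sums of the gamma expansion -/
def SN (C : List ℕ → ℚ) (N : ℕ) (X : ℝ) : ℝ := ∑ k ∈ Finset.range N, (hh C k 0 : ℝ) * ek k X

lemma SN_step {C : List ℕ → ℚ} (hC : IsNormalizedWitten C) (M : ℕ) (X : ℝ) (hX : (M : ℝ) < X) :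
    X * (X + 1) * (X + 3) * SN C (M + 1) (X + 2) - (X + 2) * (X + 4/3) * (X + 2/3) * SN C (M + 1) X =
      ek M X * (4/3 * (M + 1) * (hh C (M + 1) 0 : ℝ) * (X - M) -
        (M + 2) * (M + 4/3) * (M + 2/3) * (hh C M 0 : ℝ)) := by
  induction M with
  | zero =>
    simp only [SN, zero_add, Finset.sum_range_one, ek_zero, hh_one_zero hC, hh_zero_zero]
    push_cast; ring
  | succ M ih =>
    push_cast at hX
    have h1 := ih (by linarith)
    have h2 := ek_shift (M + 1) X (by push_cast; linarith)
    have h3 : (8/9 : ℝ) * (M + 2) * (hh C (M + 2) 0 : ℝ) +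
      2/3 * (3 * (M + 1) ^ 2 + 5 * (M + 1) + 17/9) * (hh C (M + 1) 0 : ℝ) +
      (M + 2) * (M + 4/3) * (M + 2/3) * (hh C M 0 : ℝ) = 0 := by
      have := congrArg (fun q : ℚ => (q : ℝ)) (three_term hC M)
      push_cast at this
      exact this
    have h4 : ek M X = ek (M + 1) X * (3/2 * (X - (M + 1))) := by
      rw [ek_succ]
      have : X - ((M:ℝ) + 1) ≠ 0 := by linarith
      field_simp
    have h5 : ∀ Y, SN C (M + 1 + 1) Y = SN C (M + 1) Y + (hh C (M + 1) 0 : ℝ) * ek (M + 1) Y := by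
      intro Y; unfold SN; rw [Finset.sum_range_succ]
    rw [h5, h5]
    rw [h4] at h1
    push_cast at h2 ⊢
    rw [show M + 1 + 1 = M + 2 by ring]
    linear_combination h1 + (X + 3) * (hh C (M + 1) 0 : ℝ) * h2 -
      (3/2) * (X - (M + 1)) * ek (M + 1) X * h3

lemma decay (f : ℕ → ℝ) (hf : Tendsto f atTop (𝓝 0)) (N : ℕ) (hN : 1 ≤ N) (K : ℝ) (hK : 0 ≤ K) (D : ℕ) (hD : 1 ≤ D)
    (h : ∀ X, D ≤ X → |f (X + 2) - f X| ≤ K / (X : ℝ) ^ (N + 1)) :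
    ∀ X, D ≤ X → |f X| ≤ (3/2 * K) / (X : ℝ) ^ N := by
  intro X hX
  have step : ∀ Y : ℕ, D ≤ Y → K / (Y : ℝ) ^ (N + 1) ≤
      3/2 * K * (1 / (Y : ℝ) ^ N - 1 / ((Y + 2 : ℕ) : ℝ) ^ N) := by
    intro Y hY
    have hy : (1:ℝ) ≤ Y := by exact_mod_cast (hD.trans hY)
    have h1 : ((Y : ℝ) / (Y + 2)) ^ N ≤ (Y : ℝ) / (Y + 2) := by
      apply pow_le_of_le_one (by positivity) _ (by omega)
      rw [div_le_one (by positivity)]; linarith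
    have h2 : 1 / ((Y + 2 : ℕ) : ℝ) ^ N = ((Y : ℝ) / (Y + 2)) ^ N * (1 / (Y : ℝ) ^ N) := by
      push_cast; rw [div_pow]; field_simp
    have h3 : (2/3) * (1 / (Y : ℝ) ^ (N + 1)) ≤ 1 / (Y : ℝ) ^ N - 1 / ((Y + 2 : ℕ) : ℝ) ^ N := by
      rw [h2]
      have h4 : 1 / (Y : ℝ) ^ (N + 1) = 1 / (Y : ℝ) ^ N * (1 / Y) := by rw [pow_succ]; field_simp
      rw [h4]
      have h5 : 0 < 1 / (Y : ℝ) ^ N := by positivity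
      have h6 : (2/3) * (1 / (Y:ℝ)) ≤ 1 - (Y : ℝ) / (Y + 2) := by
        rw [show 1 - (Y : ℝ) / (Y + 2) = 2 / (Y + 2) by field_simp; ring, mul_one_div, div_le_div_iff₀ (by positivity) (by positivity)]
        linarith
      nlinarith
    calc K / (Y : ℝ) ^ (N + 1) = 3/2 * K * ((2/3) * (1 / (Y : ℝ) ^ (N + 1))) := by ring
      _ ≤ _ := by gcongr
  have key : ∀ i : ℕ, |f X| ≤ |f (X + 2 * i)| + 3/2 * K * (1 / (X : ℝ) ^ N - 1 / ((X + 2 * i : ℕ) : ℝ) ^ N) := by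
    intro i
    induction i with
    | zero => simp
    | succ i ih =>
      have h1 := (h (X + 2 * i) (by omega)).trans (step (X + 2 * i) (by omega))
      have h2 : |f (X + 2 * i)| ≤ |f (X + 2 * i + 2)| + |f (X + 2 * i + 2) - f (X + 2 * i)| := by
        have := abs_sub_abs_le_abs_sub (f (X + 2 * i)) (f (X + 2 * i + 2))
        rw [abs_sub_comm] at this; linarith
      rw [show X + 2 * (i + 1) = X + 2 * i + 2 by ring]
      linarith
  have key2 : ∀ i : ℕ, |f X| ≤ |f (X + 2 * i)| + (3/2 * K) / (X : ℝ) ^ N := by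
    intro i
    refine (key i).trans ?_
    have : 0 ≤ 3/2 * K * (1 / ((X + 2 * i : ℕ) : ℝ) ^ N) := by positivity
    have e : (3/2 * K) / (X : ℝ) ^ N = 3/2 * K * (1 / (X : ℝ) ^ N) := by ring
    rw [e]; linarith
  have ht : Tendsto (fun i : ℕ => |f (X + 2 * i)| + (3/2 * K) / (X : ℝ) ^ N) atTop (𝓝 (0 + (3/2 * K) / (X : ℝ) ^ N)) := by
    apply Tendsto.add_const
    have h2 : Tendsto (fun i : ℕ => X + 2 * i) atTop atTop :=
      tendsto_atTop_mono (f := fun i : ℕ => i) (fun i => by omega) tendsto_id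
    have := (hf.comp h2).abs
    rw [abs_zero] at this
    exact this
  rw [zero_add] at ht
  exact ge_of_tendsto' ht key2

lemma SN_abs_bound (C : List ℕ → ℚ) (N : ℕ) : ∃ K : ℝ, 0 ≤ K ∧ ∀ X : ℝ, 2 * (N : ℝ) + 1 ≤ X →
    |SN C (N + 1) X - 1| ≤ K / X := by
  refine ⟨∑ k ∈ Finset.range N, |(hh C (k + 1) 0 : ℝ)| * (4/3) ^ (k + 1), by positivity, ?_⟩
  intro X hX
  have hX1 : 1 ≤ X := by have : (0:ℝ) ≤ N := by positivity
                         linarith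
  unfold SN
  rw [Finset.sum_range_succ', hh_zero_zero, ek_zero]
  push_cast
  rw [mul_one, add_sub_cancel_right, Finset.sum_div]
  refine (Finset.abs_sum_le_sum_abs _ _).trans (Finset.sum_le_sum fun k hk => ?_)
  rw [abs_mul, mul_div_assoc]
  have hk : (k : ℝ) + 1 ≤ N := by exact_mod_cast Finset.mem_range.1 hk
  have h1 := ek_abs (k + 1) X (by push_cast; linarith) hX1
  refine mul_le_mul_of_nonneg_left (h1.trans ?_) (abs_nonneg _)
  apply div_le_div_of_nonneg_left (by positivity) (by positivity)
  exact le_self_pow₀ hX1 (by omega)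

lemma ga_asy {C : List ℕ → ℚ} (hC : IsNormalizedWitten C) {L : ℝ} (hL : 0 < L)
    (hb : ∀ X : ℕ, 1 ≤ X → ga X ≤ L ∧ L ≤ ga X * (1 + 1 / (X : ℝ))) (N : ℕ) :
    ∃ K : ℝ, ∃ D : ℕ, ∀ X : ℕ, D ≤ X → |ga X - L * SN C N X| ≤ K / (X : ℝ) ^ N := by
  rcases N with _ | M
  · refine ⟨L, 1, fun X hX => ?_⟩
    simp only [SN, Finset.range_zero, Finset.sum_empty, mul_zero, sub_zero, pow_zero, div_one]
    rw [abs_of_pos (ga_pos hX)]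
    exact (hb X hX).1
  obtain ⟨K1, hK1, hS⟩ := SN_abs_bound C M
  set w : ℕ → ℝ := fun X => 1 - L * SN C (M + 1) X / ga X with hw
  have hg2 : ∀ X : ℕ, 1 ≤ X → L / 2 ≤ ga X := by
    intro X hX
    have h1 := (hb X hX).2
    have h2 := ga_pos hX
    have h3 : 1 / (X : ℝ) ≤ 1 := by
      rw [div_le_one (by exact_mod_cast hX)]; exact_mod_cast hX
    nlinarith
  have htg : Tendsto ga atTop (𝓝 L) := by
    have h0 : Tendsto (fun X : ℕ => L / (1 + 1 / (X : ℝ))) atTop (𝓝 (L / (1 + 0))) := by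
      apply Tendsto.div tendsto_const_nhds _ (by norm_num)
      exact tendsto_const_nhds.add tendsto_one_div_atTop_nhds_zero_nat
    rw [add_zero, div_one] at h0
    refine tendsto_of_tendsto_of_tendsto_of_le_of_le' h0 tendsto_const_nhds ?_ ?_
    · filter_upwards [eventually_ge_atTop 1] with X hX
      rw [div_le_iff₀ (by positivity)]
      exact (hb X hX).2
    · filter_upwards [eventually_ge_atTop 1] with X hX
      exact (hb X hX).1
  have hts : Tendsto (fun X : ℕ => SN C (M + 1) (X : ℝ)) atTop (𝓝 1) := by
    rw [tendsto_iff_norm_sub_tendsto_zero]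
    refine squeeze_zero' (Eventually.of_forall fun _ => norm_nonneg _) ?_ (tendsto_const_div_atTop_nhds_zero_nat K1)
    filter_upwards [eventually_ge_atTop (2 * M + 1)] with X hX
    rw [Real.norm_eq_abs]
    exact hS X (by exact_mod_cast hX)
  have hw0 : Tendsto w atTop (𝓝 0) := by
    have := (tendsto_const_nhds (x := (1:ℝ))).sub ((hts.const_mul L).div htg hL.ne')
    rw [mul_one, div_self hL.ne', sub_self] at this
    exact this
  set a := |4/3 * ((M:ℝ) + 1) * (hh C (M + 1) 0 : ℝ)| with ha
  set b := |((M:ℝ) + 2) * (M + 4/3) * (M + 2/3) * (hh C M 0 : ℝ)| with hb'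
  set K2 : ℝ := 2 * ((4/3) ^ M * (a + b)) with hK2
  have hdiff : ∀ X : ℕ, 2 * M + 1 ≤ X → |w (X + 2) - w X| ≤ K2 / (X : ℝ) ^ (M + 1 + 1) := by
    intro X hX
    have hX1 : (1:ℝ) ≤ X := by exact_mod_cast (by omega : 1 ≤ X)
    have hXM : 2 * (M:ℝ) + 1 ≤ X := by exact_mod_cast hX
    have hM0 : (0:ℝ) ≤ M := by positivity
    have gp := ga_pos (n := X) (by omega)
    have gp2 := ga_pos (n := X + 2) (by omega)
    have gr := ga_rec (n := X) (by omega)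
    have st := SN_step hC M (X : ℝ) (by linarith)
    set Q : ℝ := ((X:ℝ) + 3) * (X + 1) * X with hQ
    have Qp : 0 < Q := by positivity
    have e : w (X + 2) - w X = - (L / ga (X + 2)) * ((ek M X * (4/3 * (M + 1) * (hh C (M + 1) 0 : ℝ) * (X - M) -
        (M + 2) * (M + 4/3) * (M + 2/3) * (hh C M 0 : ℝ))) / Q) := by
      rw [← st]
      simp only [hw]
      push_cast
      have : 1 / ga X = ((X + 2) * (X + 4/3) * (X + 2/3)) / (ga (X + 2) * Q) := by
        rw [gr]; field_simp
      rw [div_eq_mul_one_div _ (ga X), this]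
      field_simp
      rw [hQ]; ring
    rw [e, abs_mul, abs_neg, abs_of_pos (by positivity), abs_div, abs_of_pos Qp, abs_mul]
    have i1 : L / ga (X + 2) ≤ 2 := by
      rw [div_le_iff₀ gp2]; have := hg2 (X + 2) (by omega); linarith
    have i2 := ek_abs M (X:ℝ) (by linarith) hX1
    have i3 : |4/3 * ((M:ℝ) + 1) * (hh C (M + 1) 0 : ℝ) * (X - M) -
        (M + 2) * (M + 4/3) * (M + 2/3) * (hh C M 0 : ℝ)| ≤ (a + b) * X := by
      refine (abs_sub _ _).trans ?_
      rw [abs_mul, ← ha, ← hb', abs_of_nonneg (by linarith : (0:ℝ) ≤ X - M)]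
      have a0 : 0 ≤ a := abs_nonneg _
      have b0 : 0 ≤ b := abs_nonneg _
      nlinarith
    have i4 : (X:ℝ) ^ 3 ≤ Q := by rw [hQ]; nlinarith [sq_nonneg (X:ℝ)]
    calc L / ga (X + 2) * (|ek M X| * |_| / Q) ≤ 2 * ((4/3) ^ M / (X:ℝ) ^ M * ((a + b) * X) / (X:ℝ) ^ 3) := by
          gcongr
      _ = K2 / (X : ℝ) ^ (M + 1 + 1) := by
          rw [hK2]; field_simp; ring
  have hK2p : 0 ≤ K2 := by positivity
  have hd := decay w hw0 (M + 1) (by omega) K2 hK2p (2 * M + 1) (by omega) hdiff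
  refine ⟨L * (3/2 * K2), 2 * M + 1, fun X hX => ?_⟩
  have gp := ga_pos (n := X) (by omega)
  have e : ga X - L * SN C (M + 1) X = ga X * w X := by
    simp only [hw]; field_simp
  rw [e, abs_mul, abs_of_pos gp, mul_div_assoc]
  exact mul_le_mul (hb X (by omega)).1 (hd X hX) (abs_nonneg _) hL.le

end

/-- rescaled factorial -/
def mf (Y : ℕ) : ℝ := (3/2) ^ Y * ((Y - 1).factorial : ℝ)

lemma mf_pos (Y : ℕ) : 0 < mf Y := by unfold mf; positivity

lemma mf_succ {Y : ℕ} (h : 1 ≤ Y) : mf (Y + 1) = 3/2 * Y * mf Y := by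
  obtain ⟨y, rfl⟩ : ∃ y, Y = y + 1 := ⟨Y - 1, by omega⟩
  unfold mf
  simp only [Nat.add_sub_cancel]
  rw [Nat.factorial_succ, pow_succ]; push_cast; ring

lemma mf_le_succ {Y : ℕ} (h : 1 ≤ Y) : mf Y ≤ mf (Y + 1) := by
  rw [mf_succ h]
  have := mf_pos Y
  have h1 : (1:ℝ) ≤ Y := by exact_mod_cast h
  nlinarith

/-- asymptotic expansions in rescaled factorials -/
def Asy (κ : ℝ) (c : ℕ → ℚ) (w : ℕ) (F : ℕ → ℚ) : Prop :=
  ∀ N : ℕ, ∃ K : ℝ, 0 ≤ K ∧ ∃ D : ℕ, ∀ n, D ≤ n → ∀ X, 2 * n + 1 + w = 3 * X →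
    |(F n : ℝ) - κ * ∑ k ∈ Finset.range N, (c k : ℝ) * mf (X - k)| ≤ K * mf (X - N)

lemma Asy.zero (κ : ℝ) (w : ℕ) : Asy κ 0 w 0 := by
  intro N
  refine ⟨0, le_rfl, 0, fun n _ X _ => ?_⟩
  simp

lemma Asy.add {κ : ℝ} {c c' : ℕ → ℚ} {w : ℕ} {F F' : ℕ → ℚ} (h : Asy κ c w F) (h' : Asy κ c' w F') :
    Asy κ (c + c') w (F + F') := by
  intro N
  obtain ⟨K, hK, D, hD⟩ := h N
  obtain ⟨K', hK', D', hD'⟩ := h' N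
  refine ⟨K + K', by positivity, max D D', fun n hn X hX => ?_⟩
  have h1 := hD n (le_trans (le_max_left _ _) hn) X hX
  have h2 := hD' n (le_trans (le_max_right _ _) hn) X hX
  have e : (((F + F') n : ℚ) : ℝ) - κ * ∑ k ∈ Finset.range N, (((c + c') k : ℚ) : ℝ) * mf (X - k) =
      ((F n : ℝ) - κ * ∑ k ∈ Finset.range N, (c k : ℝ) * mf (X - k)) +
      ((F' n : ℝ) - κ * ∑ k ∈ Finset.range N, (c' k : ℝ) * mf (X - k)) := by
    simp only [Pi.add_apply]; push_cast
    simp only [add_mul, Finset.sum_add_distrib]; ring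
  rw [e, add_mul]
  exact (abs_add_le _ _).trans (add_le_add h1 h2)

lemma Asy.smul {κ : ℝ} {c : ℕ → ℚ} {w : ℕ} {F : ℕ → ℚ} (a : ℚ) (h : Asy κ c w F) :
    Asy κ (a • c) w (a • F) := by
  intro N
  obtain ⟨K, hK, D, hD⟩ := h N
  refine ⟨|(a:ℝ)| * K, by positivity, D, fun n hn X hX => ?_⟩
  have h1 := hD n hn X hX
  have e : (((a • F) n : ℚ) : ℝ) - κ * ∑ k ∈ Finset.range N, (((a • c) k : ℚ) : ℝ) * mf (X - k) =
      a * ((F n : ℝ) - κ * ∑ k ∈ Finset.range N, (c k : ℝ) * mf (X - k)) := by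
    simp only [Pi.smul_apply, smul_eq_mul]; push_cast
    simp only [mul_assoc, ← Finset.mul_sum]; ring
  rw [e, abs_mul, mul_assoc]
  gcongr

lemma Asy.congr {κ : ℝ} {c c' : ℕ → ℚ} {w : ℕ} {F F' : ℕ → ℚ} (h : Asy κ c w F) (hc : ∀ k, c' k = c k)
    (D0 : ℕ) (hF : ∀ n, D0 ≤ n → ∀ X, 2 * n + 1 + w = 3 * X → F' n = F n) : Asy κ c' w F' := by
  intro N
  obtain ⟨K, hK, D, hD⟩ := h N
  refine ⟨K, hK, max D D0, fun n hn X hX => ?_⟩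
  rw [hF n (le_trans (le_max_right _ _) hn) X hX]
  simp only [hc]
  exact hD n (le_trans (le_max_left _ _) hn) X hX

lemma Asy.msum {ι : Type*} {κ : ℝ} {c : ι → ℕ → ℚ} {w : ℕ} {F : ι → ℕ → ℚ} (S : Multiset ι)
    (h : ∀ i ∈ S, Asy κ (c i) w (F i)) :
    Asy κ (fun k => (S.map fun i => c i k).sum) w (fun n => (S.map fun i => F i n).sum) := by
  induction S using Multiset.induction_on with
  | empty => exact Asy.zero κ w
  | cons i S ih =>
    simp only [Multiset.map_cons, Multiset.sum_cons]
    exact (h i (by simp)).add (ih fun j hj => h j (by simp [hj]))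

/-- shift of coefficients -/
def pre (c : ℕ → ℚ) : ℕ → ℚ
  | 0 => 0
  | k + 1 => c k

lemma sum_pre (c : ℕ → ℚ) (f : ℕ → ℝ) (N : ℕ) :
    ∑ k ∈ Finset.range (N + 1), (pre c k : ℝ) * f k = ∑ k ∈ Finset.range N, (c k : ℝ) * f (k + 1) := by
  rw [Finset.sum_range_succ']; simp [pre]

lemma Asy.pre {κ : ℝ} {c : ℕ → ℚ} {w : ℕ} {F : ℕ → ℚ} (h : Asy κ c w F) : Asy κ (pre c) (w + 3) F := by
  intro N
  rcases N with _ | N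
  · obtain ⟨K, hK, D, hD⟩ := h 0
    refine ⟨K, hK, D + 3, fun n hn X hX => ?_⟩
    obtain ⟨Y, rfl⟩ : ∃ Y, X = Y + 1 := ⟨X - 1, by omega⟩
    have h1 := hD n (by omega) Y (by omega)
    simp only [Finset.range_zero, Finset.sum_empty, mul_zero, sub_zero, Nat.sub_zero] at h1 ⊢
    exact h1.trans (mul_le_mul_of_nonneg_left (mf_le_succ (by omega)) hK)
  · obtain ⟨K, hK, D, hD⟩ := h N
    refine ⟨K, hK, D + 3, fun n hn X hX => ?_⟩
    obtain ⟨Y, rfl⟩ : ∃ Y, X = Y + 1 := ⟨X - 1, by omega⟩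
    have h1 := hD n (by omega) Y (by omega)
    rw [sum_pre]
    simpa using h1

lemma Asy.mul_shift {κ : ℝ} {c : ℕ → ℚ} {w : ℕ} {F : ℕ → ℚ} (h : Asy κ c w F) (d : ℕ) :
    Asy κ (c + WittenAsym.pre (fun k => (1/2 * (3 * (k:ℚ) - w) - ((d:ℚ) - 1)) * c k)) (w + (2 * d + 1))
      (fun n => ((n:ℚ) + 1/2) * F (n + d - 1)) := by
  intro N
  set q := WittenAsym.pre (fun k => (1/2 * (3 * (k:ℚ) - w) - ((d:ℚ) - 1)) * c k) with hq
  obtain ⟨K, hK, D, hD⟩ := h N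
  refine ⟨2 * K + |κ * (q N : ℝ)|, by positivity, D + 3 * N + 3, fun n hn X hX => ?_⟩
  obtain ⟨Y, rfl⟩ : ∃ Y, X = Y + 1 := ⟨X - 1, by omega⟩
  have h1 := hD (n + d - 1) (by omega) Y (by omega)
  have hYN : 2 * N + 1 ≤ Y := by omega
  have hnr : (n : ℝ) = (3 * (Y + 1) - w - 2 * d - 2) / 2 := by
    have : ((2 * n + 1 + (w + (2 * d + 1)) : ℕ) : ℝ) = ((3 * (Y + 1) : ℕ) : ℝ) := by rw [hX]
    push_cast at this; linarith
  have hm : ∀ k, k ≤ N → mf (Y + 1 - k) = 3/2 * (Y - k) * mf (Y - k) := by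
    intro k hk
    rw [show Y + 1 - k = Y - k + 1 by omega, mf_succ (by omega), Nat.cast_sub (by omega)]
  have hs : ((n:ℝ) + 1/2) * ∑ k ∈ Finset.range N, (c k : ℝ) * mf (Y - k) =
      ∑ k ∈ Finset.range N, (((c + q) k : ℚ) : ℝ) * mf (Y + 1 - k) + (q N : ℝ) * mf (Y + 1 - N) := by
    have e1 : ∑ k ∈ Finset.range N, (((c + q) k : ℚ) : ℝ) * mf (Y + 1 - k) =
        ∑ k ∈ Finset.range N, (c k : ℝ) * mf (Y + 1 - k) + ∑ k ∈ Finset.range N, (q k : ℝ) * mf (Y + 1 - k) := by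
      rw [← Finset.sum_add_distrib]
      apply Finset.sum_congr rfl; intro k _
      simp only [Pi.add_apply]; push_cast; ring
    have e2 := sum_pre (fun k => (1/2 * (3 * (k:ℚ) - w) - ((d:ℚ) - 1)) * c k) (fun k => mf (Y + 1 - k)) N
    rw [← hq, Finset.sum_range_succ] at e2
    rw [e1, add_assoc, e2, ← Finset.sum_add_distrib, Finset.mul_sum]
    apply Finset.sum_congr rfl; intro k hk
    have hk := Finset.mem_range.1 hk
    rw [hm k hk.le, show Y + 1 - (k + 1) = Y - k by omega, hnr]
    push_cast; ring
  have e : (((((n:ℚ) + 1/2) * F (n + d - 1) : ℚ) : ℝ)) -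
      κ * ∑ k ∈ Finset.range N, (((c + q) k : ℚ) : ℝ) * mf (Y + 1 - k) =
      ((n:ℝ) + 1/2) * ((F (n + d - 1) : ℝ) - κ * ∑ k ∈ Finset.range N, (c k : ℝ) * mf (Y - k)) +
      κ * (q N : ℝ) * mf (Y + 1 - N) := by
    rw [mul_sub, mul_left_comm _ κ, hs]; push_cast; ring
  rw [e, add_mul (2 * K)]
  refine (abs_add_le _ _).trans (add_le_add ?_ ?_)
  · rw [abs_mul, abs_of_pos (by positivity), hm N le_rfl]
    have hp := mf_pos (Y - N)
    have hy : 2 * (N:ℝ) + 1 ≤ Y := by exact_mod_cast hYN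
    have hw : (0:ℝ) ≤ w := by positivity
    have hd : (0:ℝ) ≤ d := by positivity
    have hN0 : (0:ℝ) ≤ N := by positivity
    calc ((n:ℝ) + 1/2) * |_| ≤ ((n:ℝ) + 1/2) * (K * mf (Y - N)) := by gcongr
      _ ≤ (3 * (Y - N)) * (K * mf (Y - N)) := by
          apply mul_le_mul_of_nonneg_right _ (by positivity)
          rw [hnr]; linarith
      _ = _ := by ring
  · rw [abs_mul _ (mf _), abs_of_pos (mf_pos _)]

lemma dd_pos_cc {e : ℕ} (he : e ≠ 0) (d : ℕ) : dd e (cc d) = 0 := by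
  by_cases hd0 : d = 0
  · subst hd0; exact dd_pos_cc_zero he
  by_cases hd : d = 1
  · subst hd; rw [cc_one]; funext s; simp [dd, dlt]
  · rw [cc_ge_two (by omega)]; rfl

lemma Z_ins {C : List ℕ → ℚ} (hC : IsNormalizedWitten C) (n d : ℕ) (hn : 1 ≤ n) (s : Multiset ℕ) :
    Z C (n ::ₘ d ::ₘ s) = ((n:ℚ) + 1/2) * Z C ((n + d - 1) ::ₘ s) + E d (dd n (Z C)) s +
      ∑ a ∈ Finset.range (d - 1), Z C (n ::ₘ a ::ₘ (d - 2 - a) ::ₘ s) + conv (cc d) (dd n (Z C)) s := by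
  have h := congrFun (vir_Z hC d) (n ::ₘ s)
  rw [dd_apply, Pi.add_apply, Pi.add_apply, E_cons, conv_cons, dd_pos_cc (by omega), conv_zero_left,
    Finset.sum_apply] at h
  rw [Multiset.cons_swap, h]
  simp only [sh, dd_apply, Pi.zero_apply, zero_add]
  rw [if_pos (by omega)]
  have : ∀ a, Z C ((d - 2 - a) ::ₘ a ::ₘ n ::ₘ s) = Z C (n ::ₘ a ::ₘ (d - 2 - a) ::ₘ s) := by
    intro a
    congr 1
    rw [Multiset.cons_swap a n, Multiset.cons_swap _ n, Multiset.cons_swap _ a]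
  simp only [this]
  ring

lemma mf_ek (X k : ℕ) (h : k < X) : mf (X - k) = ek k X * mf X := by
  induction k with
  | zero => simp [ek_zero]
  | succ k ih =>
    have h1 := ih (by omega)
    have h2 := mf_succ (Y := X - (k + 1)) (by omega)
    rw [show X - (k + 1) + 1 = X - k by omega, h1, Nat.cast_sub (by omega)] at h2
    rw [ek_succ]
    push_cast at h2
    have h3 : (X:ℝ) - (k + 1) ≠ 0 := by
      have : (k:ℝ) + 1 < X := by exact_mod_cast h
      linarith
    field_simp
    linarith

lemma ek_lower (k : ℕ) (X : ℕ) (hX : k < X) : 1 / (X:ℝ) ^ k ≤ (3/2) ^ k * ek k X := by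
  induction k with
  | zero => simp [ek_zero]
  | succ k ih =>
    have h1 := ih (by omega)
    have h3 : 0 < (X:ℝ) - (k + 1) := by
      have : (k:ℝ) + 1 < X := by exact_mod_cast hX
      linarith
    have hX0 : 0 < (X:ℝ) := by have : (0:ℝ) ≤ k := by positivity
                               linarith
    rw [ek_succ]
    have h4 : 1 / (X:ℝ) ≤ 1 / ((X:ℝ) - (k + 1)) := by
      apply one_div_le_one_div_of_le h3
      have : (0:ℝ) ≤ k := by positivity
      linarith
    calc 1 / (X:ℝ) ^ (k + 1) = 1 / (X:ℝ) ^ k * (1 / X) := by rw [pow_succ]; field_simp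
      _ ≤ (3/2) ^ k * ek k X * (1 / ((X:ℝ) - (k + 1))) := by
          apply mul_le_mul h1 h4 (by positivity)
          exact le_trans (by positivity) h1
      _ = _ := by rw [pow_succ]; ring

lemma Asy_base {C : List ℕ → ℚ} (hC : IsNormalizedWitten C) {L : ℝ} (hL : 0 < L)
    (hb : ∀ X : ℕ, 1 ≤ X → ga X ≤ L ∧ L ≤ ga X * (1 + 1 / (X : ℝ))) :
    Asy (L / 4) (fun k => Hk C k 0) 0 (fun n => Z C {n}) := by
  intro N
  obtain ⟨K, D, hD⟩ := ga_asy hC hL hb N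
  refine ⟨|K| / 4 * (3/2) ^ N, by positivity, 2 * D + 2 * N + 2, fun n hn X hX => ?_⟩
  obtain ⟨g, rfl⟩ : ∃ g, X = 2 * g + 1 := ⟨X / 2, by omega⟩
  obtain rfl : n = 3 * g + 1 := by omega
  have h1 := hD (2 * g + 1) (by omega)
  have hZ : ((Z C {3 * g + 1} : ℚ) : ℝ) = ga (2 * g + 1) / 4 * mf (2 * g + 1) := by
    rw [Z_single, show ({3 * g + 1} : Multiset ℕ) = (([3 * g + 1] : List ℕ) : Multiset ℕ) from rfl, MM_coe hC]
    unfold Ml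
    have hx : XN [3 * g + 1] = 2 * g + 1 := by
      simp only [XN, List.sum_cons, List.sum_nil, List.length_cons, List.length_nil]; omega
    rw [hx]
    push_cast
    rw [C_one hC]
    unfold ga mf; push_cast; ring
  have hS : ∑ k ∈ Finset.range N, (Hk C k 0 : ℝ) * mf (2 * g + 1 - k) =
      SN C N ((2 * g + 1 : ℕ) : ℝ) * mf (2 * g + 1) := by
    unfold SN; rw [Finset.sum_mul]
    apply Finset.sum_congr rfl; intro k hk
    have hk := Finset.mem_range.1 hk
    rw [Hk_empty, mf_ek _ _ (by omega)]; ring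
  simp only
  rw [hZ, hS]
  have e : ga (2 * g + 1) / 4 * mf (2 * g + 1) - L / 4 * (SN C N ((2 * g + 1 : ℕ) : ℝ) * mf (2 * g + 1)) =
    (ga (2 * g + 1) - L * SN C N ((2 * g + 1 : ℕ) : ℝ)) * (mf (2 * g + 1) / 4) := by ring
  have hmp := mf_pos (2 * g + 1)
  have hl := ek_lower N (2 * g + 1) (by omega)
  rw [e, abs_mul, abs_of_pos (by positivity : 0 < mf (2 * g + 1) / 4), mf_ek _ N (by omega)]
  calc |ga (2 * g + 1) - L * SN C N ((2 * g + 1 : ℕ) : ℝ)| * (mf (2 * g + 1) / 4)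
      ≤ (|K| * (1 / ((2 * g + 1 : ℕ) : ℝ) ^ N)) * (mf (2 * g + 1) / 4) := by
        apply mul_le_mul_of_nonneg_right _ (by positivity)
        refine h1.trans ?_
        rw [mul_one_div]; gcongr; exact le_abs_self K
    _ ≤ (|K| * ((3/2) ^ N * ek N ((2 * g + 1 : ℕ) : ℝ))) * (mf (2 * g + 1) / 4) := by gcongr
    _ = _ := by ring

lemma Asy_Z {C : List ℕ → ℚ} (hC : IsNormalizedWitten C) {L : ℝ} (hL : 0 < L)
    (hb : ∀ X : ℕ, 1 ≤ X → ga X ≤ L ∧ L ≤ ga X * (1 + 1 / (X : ℝ))) :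
    ∀ s : Multiset ℕ, Asy (L / 4) (fun k => Hk C k s) (wt s) (fun n => Z C (n ::ₘ s)) := by
  suffices h : ∀ W : ℕ, ∀ s : Multiset ℕ, wt s < W →
      Asy (L / 4) (fun k => Hk C k s) (wt s) (fun n => Z C (n ::ₘ s)) from fun s => h _ s (Nat.lt_succ_self _)
  intro W
  induction W with
  | zero => intro s hs; omega
  | succ W ih =>
    intro s hs
    induction s using Multiset.induction_on with
    | empty => simpa using Asy_base hC hL hb
    | cons d s _ =>
      rw [wt_cons] at hs
      have ih' : ∀ (t : Multiset ℕ), wt t + 3 = wt (d ::ₘ s) →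
          Asy (L / 4) (pre fun k => Hk C k t) (wt (d ::ₘ s)) (fun n => Z C (n ::ₘ t)) := by
        intro t ht
        rw [← ht]
        apply Asy.pre
        apply ih
        rw [wt_cons] at ht
        omega
      have A1 := (ih s (by omega)).mul_shift d
      rw [add_comm (wt s), ← wt_cons] at A1
      have A2 : Asy (L / 4) (pre fun k => E d (Hk C k) s) (wt (d ::ₘ s)) (fun n => E d (dd n (Z C)) s) := by
        have := Asy.msum (κ := L / 4) (w := wt (d ::ₘ s)) s
          (c := fun e => if 1 ≤ e + d then ((e:ℚ) + 1/2) • pre (fun k => Hk C k ((e + d - 1) ::ₘ s.erase e)) else 0)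
          (F := fun e => if 1 ≤ e + d then ((e:ℚ) + 1/2) • (fun n => Z C (n ::ₘ (e + d - 1) ::ₘ s.erase e)) else 0) ?_
        · refine this.congr ?_ 0 ?_
          · intro k
            rcases k with _ | k
            · simp only [pre]
              symm; apply Multiset.sum_eq_zero
              intro x hx
              obtain ⟨e, _, rfl⟩ := Multiset.mem_map.1 hx
              split_ifs <;> simp [pre]
            · simp only [pre, E]
              congr 1; apply Multiset.map_congr rfl; intro e _
              split_ifs <;> simp [pre]
          · intro n _ X _
            simp only [E]
            congr 1; apply Multiset.map_congr rfl; intro e _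
            split_ifs <;> simp [dd]
        · intro e he
          by_cases h : 1 ≤ e + d
          · simp only [if_pos h]
            apply Asy.smul
            apply ih'
            have h2 : wt s = (2 * e + 1) + wt (s.erase e) := by
              conv_lhs => rw [← Multiset.cons_erase he]
              simp
            rw [wt_cons, wt_cons, h2]; omega
          · simp only [if_neg h]
            exact Asy.zero _ _
      have A3 : Asy (L / 4) (pre fun k => ∑ a ∈ Finset.range (d - 1), Hk C k (a ::ₘ (d - 2 - a) ::ₘ s))
          (wt (d ::ₘ s)) (fun n => ∑ a ∈ Finset.range (d - 1), Z C (n ::ₘ a ::ₘ (d - 2 - a) ::ₘ s)) := by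
        have := Asy.msum (κ := L / 4) (w := wt (d ::ₘ s)) (Finset.range (d - 1)).val
          (c := fun a => pre (fun k => Hk C k (a ::ₘ (d - 2 - a) ::ₘ s)))
          (F := fun a n => Z C (n ::ₘ a ::ₘ (d - 2 - a) ::ₘ s)) ?_
        · refine this.congr ?_ 0 ?_
          · intro k
            rcases k with _ | k
            · simp only [pre]; simp
            · simp only [pre]; rfl
          · intro n _ X _; rfl
        · intro a ha
          have ha : a < d - 1 := Finset.mem_range.1 ha
          apply ih'
          simp only [wt_cons]; omega
      have A4 : Asy (L / 4) (pre fun k => conv (cc d) (Hk C k) s) (wt (d ::ₘ s))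
          (fun n => conv (cc d) (dd n (Z C)) s) := by
        have := Asy.msum (κ := L / 4) (w := wt (d ::ₘ s)) s.antidiagonal
          (c := fun p => (cc d p.1) • pre (fun k => Hk C k p.2))
          (F := fun p => (cc d p.1) • (fun n => Z C (n ::ₘ p.2))) ?_
        · refine this.congr ?_ 0 ?_
          · intro k
            rcases k with _ | k
            · simp [pre]
            · simp only [pre, conv]; rfl
          · intro n _ X _; rfl
        · intro p hp
          by_cases h : cc d p.1 = 0
          · simp only [h, zero_smul]; exact Asy.zero _ _
          · apply Asy.smul
            apply ih'
            have h1 := cc_ne h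
            have h2 := Multiset.mem_antidiagonal.1 hp
            rw [wt_cons, ← h2, wt_add]; omega
      refine (((A1.add A2).add A3).add A4).congr ?_ 1 ?_
      · intro k
        simp only [Pi.add_apply]
        rcases k with _ | k
        · simp [pre, Hk_zero, one]
        · simp only [pre]
          rw [Hk_rec hC k d s]; ring
      · intro n hn X _
        simp only [Pi.add_apply]
        exact Z_ins hC n d hn s

/-- weight-homogeneous part of the inverse -/
def Zij (C : List ℕ → ℚ) (j : ℕ) : Multiset ℕ → ℚ := fun t => if wt t = 3 * j then Zi C t else 0

/-- connected coefficients -/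
def Tk (C : List ℕ → ℚ) (k : ℕ) : Multiset ℕ → ℚ :=
  ∑ j ∈ Finset.range (k + 1), conv (hh C (k - j)) (Zij C j)

/-- summed connected coefficients -/
def Gk (C : List ℕ → ℚ) (k : ℕ) : Multiset ℕ → ℚ := conv (Tk C k) one

lemma Gk_eq (C : List ℕ → ℚ) (k : ℕ) :
    Gk C k = ∑ j ∈ Finset.range (k + 1), conv (Hk C (k - j)) (Zij C j) := by
  rw [Gk, Tk, conv_sum_left]
  apply Finset.sum_congr rfl; intro j _
  rw [Hk, conv_assoc, conv_assoc, conv_comm (Zij C j)]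

lemma conv_eq_zero_of {f g : Multiset ℕ → ℚ} {u : Multiset ℕ} (h : ∀ s t, s + t = u → f s * g t = 0) :
    conv f g u = 0 := by
  rw [conv_congr2 (f' := 0) (g' := 0) (fun s t hst => by rw [h s t hst]; simp)]
  rw [conv_zero_left]; rfl

lemma Tk_gt (C : List ℕ → ℚ) (k : ℕ) (s : Multiset ℕ) (h : 3 * k < wt s) : Tk C k s = 0 := by
  rw [Tk, Finset.sum_apply]
  apply Finset.sum_eq_zero; intro j hj
  have hj := Finset.mem_range.1 hj
  apply conv_eq_zero_of
  intro a b hab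
  unfold Zij
  split_ifs with hb
  · rw [hh_gt, zero_mul]
    rw [← hab, wt_add] at h; omega
  · simp

lemma Tk_eq {C : List ℕ → ℚ} (hC : IsNormalizedWitten C) (k : ℕ) (s : Multiset ℕ) (hs : s ≠ 0)
    (h : wt s = 3 * k) : Tk C k s = 0 := by
  have h0 : conv (Z C) (∑ j ∈ Finset.range (k + 1), Zij C j) s = 0 := by
    have : conv (Z C) (∑ j ∈ Finset.range (k + 1), Zij C j) s = conv (Z C) (Zi C) s := by
      apply conv_congr2
      intro a b hab
      congr 1
      rw [Finset.sum_apply]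
      by_cases h3 : 3 ∣ wt b
      · obtain ⟨j, hj⟩ := h3
        rw [← hab, wt_add] at h
        rw [Finset.sum_eq_single j]
        · simp [Zij, hj]
        · intro i _ hi; unfold Zij; rw [if_neg (by omega)]
        · intro hj'; exfalso; apply hj'; rw [Finset.mem_range]; omega
      · rw [Zi_wt hC b h3]
        apply Finset.sum_eq_zero; intro j _
        unfold Zij; rw [if_neg]; intro hb; exact h3 ⟨j, hb⟩
    rw [this, Z_Zi]; simp [dlt, hs]
  rw [conv_sum_right, Finset.sum_apply] at h0
  rw [Tk, Finset.sum_apply, ← h0]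
  apply Finset.sum_congr rfl; intro j hj
  have hj := Finset.mem_range.1 hj
  apply conv_congr2
  intro a b hab
  unfold Zij
  split_ifs with hb
  · rw [hh_eq]
    rw [← hab, wt_add] at h; omega
  · simp

lemma Tk_ge {C : List ℕ → ℚ} (hC : IsNormalizedWitten C) (k : ℕ) (s : Multiset ℕ) (hs : s ≠ 0)
    (h : 3 * k ≤ wt s) : Tk C k s = 0 := by
  rcases h.eq_or_lt with h | h
  · exact Tk_eq hC k s hs h.symm
  · exact Tk_gt C k s h

lemma Tk_empty (C : List ℕ → ℚ) (k : ℕ) : Tk C k 0 = hh C k 0 := by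
  rw [Tk, Finset.sum_apply, Finset.sum_eq_single 0]
  · rw [conv_zero']; simp [Zij, Zi_zero]
  · intro j _ hj
    rw [conv_zero']; simp [Zij, hj]
  · simp

lemma iter_pre (c : ℕ → ℚ) (j k : ℕ) : (pre^[j] c) k = if j ≤ k then c (k - j) else 0 := by
  induction j generalizing k with
  | zero => simp
  | succ j ih =>
    rw [Function.iterate_succ_apply']
    rcases k with _ | k
    · simp [pre]
    · simp only [pre]
      rw [ih]; simp

lemma Asy.iter {κ : ℝ} {c : ℕ → ℚ} {w : ℕ} {F : ℕ → ℚ} (h : Asy κ c w F) (j : ℕ) :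
    Asy κ (WittenAsym.pre^[j] c) (w + 3 * j) F := by
  induction j with
  | zero => exact h
  | succ j ih =>
    rw [Function.iterate_succ_apply', show w + 3 * (j + 1) = w + 3 * j + 3 by ring]
    exact ih.pre

lemma Asy_M {C : List ℕ → ℚ} (hC : IsNormalizedWitten C) {L : ℝ} (hL : 0 < L)
    (hb : ∀ X : ℕ, 1 ≤ X → ga X ≤ L ∧ L ≤ ga X * (1 + 1 / (X : ℝ))) (s : Multiset ℕ) :
    Asy (L / 4) (fun k => Gk C k s) (wt s) (fun n => MM C (n ::ₘ s)) := by
  have := Asy.msum (κ := L / 4) (w := wt s) s.antidiagonal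
    (c := fun p => Zi C p.2 • pre^[wt p.2 / 3] (fun k => Hk C k p.1))
    (F := fun p => Zi C p.2 • (fun n => Z C (n ::ₘ p.1))) ?_
  · refine this.congr ?_ 0 ?_
    · intro k
      rw [Gk_eq, Finset.sum_apply]
      simp only [conv]
      rw [Finset.sum_eq_multiset_sum, Multiset.sum_map_sum_map]
      congr 1; apply Multiset.map_congr rfl; intro p hp
      rw [Pi.smul_apply, smul_eq_mul, iter_pre]
      by_cases h3 : 3 ∣ wt p.2
      · obtain ⟨j, hj⟩ := h3
        rw [hj, Nat.mul_div_cancel_left _ (by norm_num)]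
        change ∑ i ∈ Finset.range (k + 1), Hk C (k - i) p.1 * Zij C i p.2 = _
        split_ifs with hjk
        · rw [Finset.sum_eq_single j]
          · simp [Zij, hj, mul_comm]
          · intro i _ hi; unfold Zij; rw [if_neg (by omega), mul_zero]
          · intro hj'; exfalso; apply hj'; rw [Finset.mem_range]; omega
        · rw [mul_zero]
          apply Finset.sum_eq_zero
          intro i hi
          have := Finset.mem_range.1 hi
          unfold Zij; rw [if_neg (by omega), mul_zero]
      · rw [Zi_wt hC _ h3, zero_mul]
        change ∑ i ∈ Finset.range (k + 1), Hk C (k - i) p.1 * Zij C i p.2 = _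
        apply Finset.sum_eq_zero
        intro i hi
        unfold Zij; rw [if_neg, mul_zero]
        intro hb; exact h3 ⟨i, hb⟩
    · intro n _ X _
      have h := congrFun (dd_Z_Zi C n) s
      rw [dd_apply] at h
      rw [← h]
      simp only [conv, dd_apply, Pi.smul_apply, smul_eq_mul, mul_comm]
  · intro p hp
    by_cases h3 : 3 ∣ wt p.2
    · obtain ⟨j, hj⟩ := h3
      rw [hj, Nat.mul_div_cancel_left _ (by norm_num)]
      apply Asy.smul
      have h2 := Multiset.mem_antidiagonal.1 hp
      rw [← h2, wt_add, hj]
      exact (Asy_Z hC hL hb p.1).iter j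
    · rw [Zi_wt hC _ h3, zero_smul, zero_smul]; exact Asy.zero _ _

/-- indicator of a multiset -/
def ind (e : Multiset ℕ) : Multiset ℕ → ℚ := fun s => if s = e then 1 else 0

lemma dd_ind_mem {e : Multiset ℕ} {d : ℕ} (h : d ∈ e) : dd d (ind e) = ind (e.erase d) := by
  funext s
  simp only [dd, ind]
  have : d ::ₘ s = e ↔ s = e.erase d := by
    constructor
    · rintro rfl; simp
    · rintro rfl; exact Multiset.cons_erase h
  simp [this]

lemma dd_ind_not {e : Multiset ℕ} {d : ℕ} (h : d ∉ e) : dd d (ind e) = 0 := by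
  funext s
  simp only [dd, ind, Pi.zero_apply]
  rw [if_neg]; rintro rfl; simp at h

/-- product of binomials -/
def bn (B : ℕ) (e s : Multiset ℕ) : ℚ := ∏ i ∈ Finset.range B, ((s.count i).choose (e.count i) : ℚ)

lemma ind_one (B : ℕ) (s : Multiset ℕ) : ∀ e : Multiset ℕ, (∀ i ∈ e, i < B) → conv (ind e) one s = bn B e s := by
  induction s using Multiset.induction_on with
  | empty =>
    intro e he
    rw [conv_zero']
    simp only [ind, one, mul_one, bn, Multiset.count_zero]
    by_cases h : e = 0
    · simp [h]
    · rw [if_neg (fun h' => h h'.symm)]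
      obtain ⟨i, hi⟩ := Multiset.exists_mem_of_ne_zero h
      symm; apply Finset.prod_eq_zero (i := i) (Finset.mem_range.2 (he i hi))
      have := Multiset.count_pos.2 hi
      rw [Nat.choose_eq_zero_of_lt this]; simp
  | cons d s ih =>
    intro e he
    rw [conv_cons, dd_one, ih e he]
    by_cases h : d ∈ e
    · rw [dd_ind_mem h, ih (e.erase d) (fun i hi => he i (Multiset.mem_of_mem_erase hi))]
      have hd : d ∈ Finset.range B := Finset.mem_range.2 (he d h)
      unfold bn
      rw [← Finset.mul_prod_erase _ _ hd, ← Finset.mul_prod_erase _ _ hd, ← Finset.mul_prod_erase _ _ hd]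
      have e1 : ∏ i ∈ (Finset.range B).erase d, ((s.count i).choose ((e.erase d).count i) : ℚ) =
          ∏ i ∈ (Finset.range B).erase d, ((s.count i).choose (e.count i) : ℚ) := by
        apply Finset.prod_congr rfl; intro i hi
        rw [Multiset.count_erase_of_ne (Finset.ne_of_mem_erase hi)]
      have e2 : ∏ i ∈ (Finset.range B).erase d, (((d ::ₘ s).count i).choose (e.count i) : ℚ) =
          ∏ i ∈ (Finset.range B).erase d, ((s.count i).choose (e.count i) : ℚ) := by
        apply Finset.prod_congr rfl; intro i hi
        rw [Multiset.count_cons_of_ne (Finset.ne_of_mem_erase hi)]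
      rw [e1, e2, ← add_mul]
      congr 1
      rw [Multiset.count_cons_self, Multiset.count_erase_self]
      have := Multiset.count_pos.2 h
      obtain ⟨m, hm⟩ : ∃ m, e.count d = m + 1 := ⟨e.count d - 1, by omega⟩
      rw [hm, Nat.choose_succ_succ]; push_cast; simp
    · rw [dd_ind_not h, conv_zero_left, Pi.zero_apply, zero_add]
      unfold bn
      apply Finset.prod_congr rfl; intro i hi
      by_cases hid : i = d
      · subst hid; rw [Multiset.count_eq_zero_of_notMem h]; simp
      · rw [Multiset.count_cons_of_ne hid]

open MvPolynomial in
/-- binomial polynomial -/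
def binP (i m : ℕ) : MvPolynomial ℕ ℚ :=
  MvPolynomial.C (1 / (m.factorial : ℚ)) * ∏ j ∈ Finset.range m, (MvPolynomial.X i - MvPolynomial.C (j : ℚ))

lemma prod_desc (c m : ℕ) : ∏ j ∈ Finset.range m, ((c:ℚ) - j) = (c.descFactorial m : ℚ) := by
  induction m with
  | zero => simp
  | succ m ih =>
    rw [Finset.prod_range_succ, ih, Nat.descFactorial_succ]
    by_cases h : m ≤ c
    · rw [Nat.cast_mul, Nat.cast_sub h, mul_comm]
    · rw [Nat.descFactorial_eq_zero_iff_lt.2 (by omega)]; simp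

lemma eval_binP (i m : ℕ) (x : ℕ → ℕ) :
    MvPolynomial.eval (fun j => (x j : ℚ)) (binP i m) = ((x i).choose m : ℚ) := by
  unfold binP
  rw [map_mul, map_prod, MvPolynomial.eval_C]
  simp only [map_sub, MvPolynomial.eval_X, MvPolynomial.eval_C]
  rw [prod_desc, Nat.descFactorial_eq_factorial_mul_choose]
  have := Nat.factorial_ne_zero m
  push_cast; field_simp

/-- weights of variables -/
def wv (d : ℕ) : ℕ := 2 * d + 1

/-- weighted degree bound -/
def WD (n : ℕ) (p : MvPolynomial ℕ ℚ) : Prop := ∀ m ∈ p.support, Finsupp.weight wv m ≤ n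

lemma WD.mono {n n' : ℕ} (h : n ≤ n') {p : MvPolynomial ℕ ℚ} (hp : WD n p) : WD n' p :=
  fun m hm => (hp m hm).trans h

lemma WD.zero (n : ℕ) : WD n 0 := by intro m hm; simp at hm

lemma WD.add {n : ℕ} {p q : MvPolynomial ℕ ℚ} (hp : WD n p) (hq : WD n q) : WD n (p + q) := by
  intro m hm
  rcases Finset.mem_union.1 (MvPolynomial.support_add hm) with h | h
  · exact hp m h
  · exact hq m h

lemma WD.mul {n n' : ℕ} {p q : MvPolynomial ℕ ℚ} (hp : WD n p) (hq : WD n' q) : WD (n + n') (p * q) := by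
  intro m hm
  obtain ⟨a, ha, b, hb, rfl⟩ := Finset.mem_add.1 (MvPolynomial.support_mul p q hm)
  rw [map_add]
  exact add_le_add (hp a ha) (hq b hb)

lemma WD.C (a : ℚ) : WD 0 (MvPolynomial.C a) := by
  intro m hm
  rw [MvPolynomial.mem_support_iff, MvPolynomial.coeff_C] at hm
  have : m = 0 := by by_contra h; exact hm (if_neg fun h' => h h'.symm)
  simp [this]

lemma WD.X (i : ℕ) : WD (2 * i + 1) (MvPolynomial.X i) := by
  intro m hm
  rw [MvPolynomial.support_X, Finset.mem_singleton] at hm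
  subst hm
  rw [Finsupp.weight_single]; simp [wv]

lemma WD.Cmul {n : ℕ} {p : MvPolynomial ℕ ℚ} (hp : WD n p) (a : ℚ) : WD n (MvPolynomial.C a * p) := by
  simpa using (WD.C a).mul hp

lemma WD.sum {ι : Type*} {n : ℕ} (S : Finset ι) (p : ι → MvPolynomial ℕ ℚ) (h : ∀ i ∈ S, WD n (p i)) :
    WD n (∑ i ∈ S, p i) := by
  classical
  induction S using Finset.induction_on with
  | empty => simpa using WD.zero n
  | insert a S ha ih =>
    rw [Finset.sum_insert ha]
    exact (h a (by simp)).add (ih fun i hi => h i (by simp [hi]))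

lemma WD.prod {ι : Type*} {n : ι → ℕ} (S : Finset ι) (p : ι → MvPolynomial ℕ ℚ) (h : ∀ i ∈ S, WD (n i) (p i)) :
    WD (∑ i ∈ S, n i) (∏ i ∈ S, p i) := by
  classical
  induction S using Finset.induction_on with
  | empty => simpa using WD.C 1
  | insert a S ha ih =>
    rw [Finset.sum_insert ha, Finset.prod_insert ha]
    exact (h a (by simp)).mul (ih fun i hi => h i (by simp [hi]))

lemma WD_binP (i m : ℕ) : WD ((2 * i + 1) * m) (binP i m) := by
  unfold binP
  apply WD.Cmul
  have := WD.prod (n := fun _ => 2 * i + 1) (Finset.range m)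
    (fun j => (MvPolynomial.X i - MvPolynomial.C (j : ℚ) : MvPolynomial ℕ ℚ)) ?_
  · simpa [mul_comm] using this
  · intro j _
    rw [sub_eq_add_neg, ← map_neg]
    exact (WD.X i).add ((WD.C _).mono (by omega))

lemma WD.le {n : ℕ} {p : MvPolynomial ℕ ℚ} (h : WD n p) :
    MvPolynomial.weightedTotalDegree (fun d : ℕ => 2 * d + 1) p ≤ n := by
  unfold MvPolynomial.weightedTotalDegree
  exact Finset.sup_le h

lemma sum_wt (B : ℕ) (e : Multiset ℕ) : ∑ i ∈ Finset.range B, (2 * i + 1) * e.count i ≤ wt e := by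
  induction e using Multiset.induction_on with
  | empty => simp
  | cons d e ih =>
    rw [wt_cons]
    simp only [Multiset.count_cons, mul_add, Finset.sum_add_distrib]
    have : ∑ i ∈ Finset.range B, (2 * i + 1) * (if i = d then 1 else 0) ≤ 2 * d + 1 := by
      simp only [mul_ite, mul_one, mul_zero]
      rw [Finset.sum_ite_eq']
      split_ifs <;> omega
    simp only [add_mul, mul_add, Finset.sum_add_distrib] at this ih ⊢
    omega

/-- product of binomial polynomials -/
def bp (B : ℕ) (e : Multiset ℕ) : MvPolynomial ℕ ℚ := ∏ i ∈ Finset.range B, binP i (e.count i)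

lemma WD_bp (B : ℕ) (e : Multiset ℕ) : WD (wt e) (bp B e) :=
  (WD.prod _ _ fun i _ => WD_binP i (e.count i)).mono (sum_wt B e)

lemma bp_supp (B : ℕ) (e : Multiset ℕ) (he : ∀ i ∈ e, 2 ≤ i) : bp B e ∈ MvPolynomial.supported ℚ {i : ℕ | 2 ≤ i} := by
  unfold bp
  apply Subalgebra.prod_mem
  intro i _
  unfold binP
  apply Subalgebra.mul_mem
  · exact Subalgebra.algebraMap_mem _ _
  · apply Subalgebra.prod_mem
    intro j hj
    have hj := Finset.mem_range.1 hj
    have hi : i ∈ e := Multiset.count_pos.1 (by omega)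
    apply Subalgebra.sub_mem
    · exact MvPolynomial.X_mem_supported.2 (he i hi)
    · exact Subalgebra.algebraMap_mem _ _

lemma eval_bp (B : ℕ) (e s : Multiset ℕ) :
    MvPolynomial.eval (fun j => (s.count j : ℚ)) (bp B e) = bn B e s := by
  unfold bp bn
  rw [map_prod]
  apply Finset.prod_congr rfl; intro i _
  exact eval_binP i _ (fun j => s.count j)

/-- finite set of relevant multisets -/
def Sk (k : ℕ) : Finset (Multiset ℕ) :=
  (((3 * k) • Multiset.range (3 * k)).powerset.toFinset).filter (fun e => ∀ i ∈ e, 2 ≤ i)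

lemma mem_Sk_lt {k : ℕ} {e : Multiset ℕ} (h : e ∈ Sk k) : ∀ i ∈ e, i < 3 * k := by
  intro i hi
  unfold Sk at h
  rw [Finset.mem_filter, Multiset.mem_toFinset, Multiset.mem_powerset] at h
  exact Multiset.mem_range.1 (Multiset.mem_of_mem_nsmul (Multiset.mem_of_le h.1 hi))

lemma card_le_wt (e : Multiset ℕ) : e.card ≤ wt e := by
  induction e using Multiset.induction_on with
  | empty => simp
  | cons d e ih => rw [wt_cons, Multiset.card_cons]; omega

lemma mem_Sk {k : ℕ} {e : Multiset ℕ} (h2 : ∀ i ∈ e, 2 ≤ i) (h : e = 0 ∨ wt e < 3 * k) : e ∈ Sk k := by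
  unfold Sk
  rw [Finset.mem_filter, Multiset.mem_toFinset, Multiset.mem_powerset]
  refine ⟨?_, h2⟩
  rcases h with rfl | h
  · exact Multiset.zero_le _
  rw [Multiset.le_iff_count]
  intro i
  by_cases hi : i ∈ e
  · have h3 : wt e = (2 * i + 1) + wt (e.erase i) := by
      conv_lhs => rw [← Multiset.cons_erase hi]
      simp
    have h4 := card_le_wt e
    have h5 := Multiset.count_le_card i e
    rw [Multiset.count_nsmul, Multiset.count_eq_one_of_mem (Multiset.nodup_range _) (Multiset.mem_range.2 (by omega))]
    omega
  · rw [Multiset.count_eq_zero_of_notMem hi]; omega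

/-- the polynomials -/
def Pk (C : List ℕ → ℚ) (k : ℕ) : MvPolynomial ℕ ℚ :=
  ∑ e ∈ Sk k, MvPolynomial.C (Tk C k e) * bp (3 * k) e

lemma Pk_supp (C : List ℕ → ℚ) (k : ℕ) : Pk C k ∈ MvPolynomial.supported ℚ {i : ℕ | 2 ≤ i} := by
  unfold Pk
  apply Subalgebra.sum_mem
  intro e he
  apply Subalgebra.mul_mem
  · exact Subalgebra.algebraMap_mem _ _
  · exact bp_supp _ _ (Finset.mem_filter.1 he).2

lemma Pk_WD {C : List ℕ → ℚ} (hC : IsNormalizedWitten C) (k : ℕ) : WD (3 * k - 1) (Pk C k) := by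
  unfold Pk
  apply WD.sum
  intro e he
  by_cases h0 : e = 0
  · subst h0
    apply WD.Cmul
    exact (WD_bp _ _).mono (by simp)
  by_cases h : 3 * k ≤ wt e
  · rw [Tk_ge hC k e h0 h, map_zero, zero_mul]; exact WD.zero _
  · apply WD.Cmul
    exact (WD_bp _ _).mono (by omega)

lemma Pk_eval {C : List ℕ → ℚ} (hC : IsNormalizedWitten C) (k : ℕ) (s : Multiset ℕ) (hs : ∀ i ∈ s, 2 ≤ i) :
    MvPolynomial.eval (fun j => (s.count j : ℚ)) (Pk C k) = Gk C k s := by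
  have h1 : Gk C k s = conv (∑ e ∈ Sk k, Tk C k e • ind e) one s := by
    unfold Gk
    apply conv_congr _ (fun _ _ => rfl)
    intro t ht
    rw [Finset.sum_apply]
    have ht2 : ∀ i ∈ t, 2 ≤ i := fun i hi => hs i (Multiset.mem_of_le ht hi)
    simp only [Pi.smul_apply, ind, smul_eq_mul, mul_ite, mul_one, mul_zero]
    rw [Finset.sum_ite_eq]
    split_ifs with h
    · rfl
    · apply Tk_ge hC
      · intro h0; exact h (mem_Sk ht2 (Or.inl h0))
      · by_contra h3; exact h (mem_Sk ht2 (Or.inr (by omega)))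
  rw [h1, conv_sum_left, Finset.sum_apply]
  unfold Pk
  rw [map_sum]
  apply Finset.sum_congr rfl; intro e he
  rw [map_mul, MvPolynomial.eval_C, eval_bp, conv_smul_left, Pi.smul_apply, smul_eq_mul,
    ind_one (3 * k) s e (mem_Sk_lt he)]

lemma Pk_eval_zero {C : List ℕ → ℚ} (hC : IsNormalizedWitten C) (k : ℕ) :
    MvPolynomial.eval (fun _ => (0:ℚ)) (Pk C k) = hh C k 0 := by
  have := Pk_eval hC k 0 (by simp)
  simp only [Multiset.count_zero, Nat.cast_zero] at this
  rw [this, Gk, conv_zero', Tk_empty]; simp [one]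

lemma Pk_zero (C : List ℕ → ℚ) : Pk C 0 = 1 := by
  have : Sk 0 = {0} := by
    ext e
    unfold Sk
    simp only [mul_zero, zero_smul, Finset.mem_filter, Multiset.mem_toFinset, Multiset.mem_powerset, Finset.mem_singleton]
    constructor
    · intro h; exact Multiset.le_zero.1 h.1
    · rintro rfl; simp
  unfold Pk
  rw [this, Finset.sum_singleton, Tk_empty, hh_zero_zero]
  simp [bp]

section

open Filter Topology Asymptotics

/-- asymptotic to a power series in `u` -/
def PA (l : Filter ℕ) (u f : ℕ → ℝ) (A : PowerSeries ℝ) : Prop :=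
  ∀ N : ℕ, (fun n => f n - (PowerSeries.trunc N A).eval (u n)) =O[l] (fun n => u n ^ N)

section
variable {l : Filter ℕ} {u : ℕ → ℝ}

lemma poly_bdd (hu : Tendsto u l (𝓝 0)) (p : Polynomial ℝ) :
    (fun n => p.eval (u n)) =O[l] (fun _ => (1:ℝ)) :=
  ((p.continuous.tendsto 0).comp hu).isBigO_one ℝ

lemma poly_small (hu : Tendsto u l (𝓝 0)) (p : Polynomial ℝ) (N : ℕ) (h : ∀ d < N, p.coeff d = 0) :
    (fun n => p.eval (u n)) =O[l] (fun n => u n ^ N) := by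
  obtain ⟨q, rfl⟩ := Polynomial.X_pow_dvd_iff.2 h
  simp only [Polynomial.eval_mul, Polynomial.eval_pow, Polynomial.eval_X]
  simpa using (isBigO_refl (fun n => u n ^ N) l).mul (poly_bdd hu q)

lemma PA.bdd (hu : Tendsto u l (𝓝 0)) {f : ℕ → ℝ} {A : PowerSeries ℝ} (h : PA l u f A) :
    f =O[l] (fun _ => (1:ℝ)) := by
  have h0 := h 0
  simpa only [PowerSeries.trunc_zero', Polynomial.eval_zero, sub_zero, pow_zero] using h0

lemma PA.sub {f g : ℕ → ℝ} {A B : PowerSeries ℝ} (h : PA l u f A) (h' : PA l u g B) :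
    PA l u (fun n => f n - g n) (A - B) := by
  intro N
  refine ((h N).sub (h' N)).congr_left fun n => ?_
  rw [map_sub, Polynomial.eval_sub]; ring

lemma PA.add {f g : ℕ → ℝ} {A B : PowerSeries ℝ} (h : PA l u f A) (h' : PA l u g B) :
    PA l u (fun n => f n + g n) (A + B) := by
  intro N
  refine ((h N).add (h' N)).congr_left fun n => ?_
  rw [map_add, Polynomial.eval_add]; ring

lemma PA.congr {f f' : ℕ → ℝ} {A : PowerSeries ℝ} (h : PA l u f A) (hf : f =ᶠ[l] f') : PA l u f' A := by
  intro N
  refine (h N).congr' ?_ EventuallyEq.rfl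
  filter_upwards [hf] with n hn
  rw [hn]

lemma PA.poly (hu : Tendsto u l (𝓝 0)) (p : Polynomial ℝ) : PA l u (fun n => p.eval (u n)) (p : PowerSeries ℝ) := by
  intro N
  refine (poly_small hu (p - PowerSeries.trunc N (p : PowerSeries ℝ)) N ?_).congr_left fun n => ?_
  · intro d hd
    rw [Polynomial.coeff_sub, PowerSeries.coeff_trunc, if_pos hd, Polynomial.coeff_coe, sub_self]
  · rw [Polynomial.eval_sub]

lemma PA.mul (hu : Tendsto u l (𝓝 0)) {f g : ℕ → ℝ} {A B : PowerSeries ℝ} (h : PA l u f A) (h' : PA l u g B) :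
    PA l u (fun n => f n * g n) (A * B) := by
  intro N
  have h1 := (h N).mul (h'.bdd hu)
  have h2 := (poly_bdd hu (PowerSeries.trunc N A)).mul (h' N)
  have h3 := poly_small hu (PowerSeries.trunc N A * PowerSeries.trunc N B - PowerSeries.trunc N (A * B)) N ?_
  · simp only [mul_one, one_mul] at h1 h2
    refine ((h1.add h2).add h3).congr_left fun n => ?_
    rw [Polynomial.eval_sub, Polynomial.eval_mul]; ring
  · intro d hd
    rw [← PowerSeries.trunc_trunc_mul_trunc, Polynomial.coeff_sub, PowerSeries.coeff_trunc, if_pos hd,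
      ← Polynomial.coe_mul, Polynomial.coeff_coe, sub_self]

lemma PA.tendsto (hu : Tendsto u l (𝓝 0)) {f : ℕ → ℝ} {A : PowerSeries ℝ} (h : PA l u f A) :
    Tendsto f l (𝓝 (PowerSeries.coeff 0 A)) := by
  have h1 := (h 1).trans_tendsto (by simpa using hu)
  have h2 : ∀ n, (PowerSeries.trunc 1 A).eval (u n) = PowerSeries.coeff 0 A := by
    intro n
    rw [Polynomial.eval, PowerSeries.eval₂_trunc_eq_sum_range]; simp
  simp only [h2] at h1
  have h3 := h1.add_const (PowerSeries.coeff 0 A)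
  simpa using h3

lemma PA.div (hu : Tendsto u l (𝓝 0)) {f g : ℕ → ℝ} {Q A : PowerSeries ℝ} (h : PA l u f (Q * A)) (h' : PA l u g A)
    (hA : PowerSeries.coeff 0 A ≠ 0) : PA l u (fun n => f n / g n) Q := by
  intro N
  have hg := h'.tendsto hu
  have hgi := (hg.inv₀ hA).isBigO_one ℝ
  have h1 := (h.sub ((PA.poly hu (PowerSeries.trunc N Q)).mul hu h')) N
  have h2 : PowerSeries.trunc N (Q * A - (PowerSeries.trunc N Q : PowerSeries ℝ) * A) = 0 := by
    rw [map_sub, PowerSeries.trunc_trunc_mul, sub_self]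
  rw [h2] at h1
  simp only [Polynomial.eval_zero, sub_zero] at h1
  have h3 := h1.mul hgi
  simp only [mul_one] at h3
  refine h3.congr' ?_ EventuallyEq.rfl
  filter_upwards [hg.eventually_ne hA] with n hn
  field_simp

lemma PA.of_trunc {f : ℕ → ℝ} {A : PowerSeries ℝ}
    (h : ∀ N, ∃ f' : ℕ → ℝ, ∃ A' : PowerSeries ℝ, PA l u f' A' ∧ PowerSeries.trunc N A' = PowerSeries.trunc N A ∧
      (fun n => f n - f' n) =O[l] (fun n => u n ^ N)) : PA l u f A := by
  intro N
  obtain ⟨f', A', h1, h2, h3⟩ := h N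
  refine ((h1 N).add h3).congr_left fun n => ?_
  rw [h2]; ring

end

/-- power series of `ek` -/
def es : ℕ → PowerSeries ℚ
  | 0 => 1
  | k + 1 => es k * (PowerSeries.C (2/3 : ℚ) * PowerSeries.X) * (1 - PowerSeries.C ((k:ℚ) + 1) * PowerSeries.X)⁻¹

lemma es_rel (k : ℕ) : es (k + 1) * (1 - PowerSeries.C ((k:ℚ) + 1) * PowerSeries.X) =
    es k * (PowerSeries.C (2/3 : ℚ) * PowerSeries.X) := by
  rw [es, mul_assoc, PowerSeries.inv_mul_cancel _ (by simp), mul_one]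

lemma es_dvd (k : ℕ) : (PowerSeries.X : PowerSeries ℚ) ^ k ∣ es k := by
  induction k with
  | zero => simp
  | succ k ih =>
    rw [es, pow_succ]
    apply Dvd.dvd.mul_right
    apply mul_dvd_mul ih
    exact Dvd.intro_left _ rfl

lemma es_coeff {n k : ℕ} (h : n < k) : PowerSeries.coeff n (es k) = 0 :=
  PowerSeries.X_pow_dvd_iff.1 (es_dvd k) n h

/-- combination of the `es` -/
def lin (c : ℕ → ℚ) : PowerSeries ℚ :=
  PowerSeries.mk fun n => ∑ k ∈ Finset.range (n + 1), c k * PowerSeries.coeff n (es k)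

lemma lin_coeff (c : ℕ → ℚ) (n M : ℕ) (h : n < M) :
    PowerSeries.coeff n (lin c) = PowerSeries.coeff n (∑ k ∈ Finset.range M, c k • es k) := by
  rw [lin, PowerSeries.coeff_mk, map_sum]
  have : Finset.range (n + 1) ⊆ Finset.range M := Finset.range_subset_range.2 (by omega)
  simp only [map_smul, smul_eq_mul]
  apply Finset.sum_subset this
  intro k _ hk
  rw [es_coeff, mul_zero]
  simpa using hk

lemma lin_mul_coeff (c : ℕ → ℚ) (B : PowerSeries ℚ) (n : ℕ) :
    PowerSeries.coeff n (lin c * B) = ∑ k ∈ Finset.range (n + 1), PowerSeries.coeff n (es k * B) * c k := by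
  have : PowerSeries.coeff n (lin c * B) = PowerSeries.coeff n ((∑ k ∈ Finset.range (n + 1), c k • es k) * B) := by
    rw [PowerSeries.coeff_mul, PowerSeries.coeff_mul]
    apply Finset.sum_congr rfl; intro p hp
    have := Finset.HasAntidiagonal.mem_antidiagonal.1 hp
    rw [lin_coeff c p.1 (n + 1) (by omega)]
  rw [this, Finset.sum_mul, map_sum]
  apply Finset.sum_congr rfl; intro k _
  rw [smul_mul_assoc, map_smul, smul_eq_mul, mul_comm]

/-- realification -/
abbrev rl : PowerSeries ℚ →+* PowerSeries ℝ := PowerSeries.map (algebraMap ℚ ℝ)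

lemma PA_ek {l : Filter ℕ} {X : ℕ → ℝ} (hX : Tendsto X l atTop) (k : ℕ) :
    PA l (fun n => 1 / X n) (fun n => ek k (X n)) (rl (es k)) := by
  have hu : Tendsto (fun n => 1 / X n) l (𝓝 0) := by
    have := hX.inv_tendsto_atTop
    simp only [one_div]
    exact this
  induction k with
  | zero =>
    have := PA.poly hu (1 : Polynomial ℝ)
    simpa [ek_zero, es] using this
  | succ k ih =>
    have h1 := ih.mul hu (PA.poly hu (Polynomial.C (2/3 : ℝ) * Polynomial.X))
    have h2 := PA.poly hu (1 - Polynomial.C ((k:ℝ) + 1) * Polynomial.X)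
    have e := congrArg rl (es_rel k)
    rw [map_mul, map_mul] at e
    have e1 : rl (PowerSeries.C (2/3 : ℚ) * PowerSeries.X) =
        ((Polynomial.C (2/3 : ℝ) * Polynomial.X : Polynomial ℝ) : PowerSeries ℝ) := by
      simp [rl]
    have gen : ∀ q : ℚ, rl (1 - PowerSeries.C q * PowerSeries.X) =
        ((1 - Polynomial.C (q:ℝ) * Polynomial.X : Polynomial ℝ) : PowerSeries ℝ) := by
      intro q; simp [rl]
    have e2 : rl (1 - PowerSeries.C ((k:ℚ) + 1) * PowerSeries.X) =
        ((1 - Polynomial.C ((k:ℝ) + 1) * Polynomial.X : Polynomial ℝ) : PowerSeries ℝ) := by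
      rw [gen, Rat.cast_add, Rat.cast_natCast, Rat.cast_one]
    rw [e1, e2] at e
    rw [← e] at h1
    have h3 := h1.div hu h2 (by simp)
    refine h3.congr ?_
    filter_upwards [hX.eventually_gt_atTop ((k:ℝ) + 1)] with n hn
    have hk : (0:ℝ) ≤ k := by positivity
    have p1 : 0 < X n := by linarith
    have p2 : 0 < X n - (k + 1) := by linarith
    simp only [Polynomial.eval_mul, Polynomial.eval_sub, Polynomial.eval_one, Polynomial.eval_C, Polynomial.eval_X]
    rw [ek_succ]
    have p3 : 1 - ((k:ℝ) + 1) * (1 / X n) = (X n - (k + 1)) / X n := by field_simp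
    rw [p3]
    field_simp

lemma PA_lin {l : Filter ℕ} {X : ℕ → ℝ} (hX : Tendsto X l atTop) (c : ℕ → ℚ) (f : ℕ → ℝ)
    (h : ∀ N, (fun n => f n - ∑ k ∈ Finset.range N, (c k : ℝ) * ek k (X n)) =O[l] (fun n => (1 / X n) ^ N)) :
    PA l (fun n => 1 / X n) f (rl (lin c)) := by
  have hu : Tendsto (fun n => 1 / X n) l (𝓝 0) := by
    have := hX.inv_tendsto_atTop
    simp only [one_div]
    exact this
  apply PA.of_trunc
  intro N
  refine ⟨_, rl (∑ k ∈ Finset.range N, c k • es k), ?_, ?_, h N⟩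
  · generalize N = M
    induction M with
    | zero =>
      have := PA.poly hu (0 : Polynomial ℝ)
      simpa using this
    | succ M ih =>
      simp only [Finset.sum_range_succ, map_add]
      apply ih.add
      have h1 := (PA.poly hu (Polynomial.C (c M : ℝ))).mul hu (PA_ek hX M)
      have e : rl (c M • es M) = ((Polynomial.C (c M : ℝ) : Polynomial ℝ) : PowerSeries ℝ) * rl (es M) := by
        rw [PowerSeries.smul_eq_C_mul, map_mul]; simp [rl]
      rw [e]
      simpa using h1
  · ext d
    rw [PowerSeries.coeff_trunc, PowerSeries.coeff_trunc]
    split_ifs with hd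
    · rw [PowerSeries.coeff_map, PowerSeries.coeff_map, lin_coeff c d N hd]
    · rfl

/-- the coefficients of the expansion -/
def chatP (C : List ℕ → ℚ) (k : ℕ) : MvPolynomial ℕ ℚ :=
  ∑ j ∈ Finset.range (k + 1),
    MvPolynomial.C (PowerSeries.coeff k (es j * (lin fun i => hh C i 0)⁻¹)) * Pk C j

lemma lin_h_const (C : List ℕ → ℚ) : PowerSeries.constantCoeff (lin fun i => hh C i 0) = 1 := by
  rw [← PowerSeries.coeff_zero_eq_constantCoeff_apply, lin, PowerSeries.coeff_mk]
  simp [es, hh_zero_zero]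

lemma chatP_eval {C : List ℕ → ℚ} (c : ℕ → ℚ) (x : ℕ → ℚ) (h : ∀ j, MvPolynomial.eval x (Pk C j) = c j) (k : ℕ) :
    MvPolynomial.eval x (chatP C k) = PowerSeries.coeff k (lin c * (lin fun i => hh C i 0)⁻¹) := by
  rw [lin_mul_coeff, chatP, map_sum]
  apply Finset.sum_congr rfl; intro j _
  rw [map_mul, MvPolynomial.eval_C, h]

end

lemma chatP_zero (C : List ℕ → ℚ) : chatP C 0 = 1 := by
  rw [chatP, Finset.sum_range_one, es, one_mul, PowerSeries.coeff_zero_eq_constantCoeff_apply,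
    PowerSeries.constantCoeff_inv, lin_h_const, Pk_zero]
  simp

lemma chatP_vars (C : List ℕ → ℚ) (k i : ℕ) (hi : i ∈ (chatP C k).vars) : 2 ≤ i := by
  have : chatP C k ∈ MvPolynomial.supported ℚ {i : ℕ | 2 ≤ i} := by
    unfold chatP
    apply Subalgebra.sum_mem
    intro j _
    apply Subalgebra.mul_mem _ _ (Pk_supp C j)
    exact Subalgebra.algebraMap_mem _ _
  exact MvPolynomial.mem_supported.1 this hi

lemma chatP_eval_zero {C : List ℕ → ℚ} (hC : IsNormalizedWitten C) (k : ℕ) (hk : 1 ≤ k) :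
    MvPolynomial.eval (fun _ => (0 : ℚ)) (chatP C k) = 0 := by
  rw [chatP_eval (fun j => hh C j 0) _ (fun j => Pk_eval_zero hC j),
    PowerSeries.mul_inv_cancel _ (by rw [lin_h_const]; norm_num), PowerSeries.coeff_one, if_neg (by omega)]

lemma chatP_deg {C : List ℕ → ℚ} (hC : IsNormalizedWitten C) (k : ℕ) :
    MvPolynomial.weightedTotalDegree (fun d : ℕ => 2 * d + 1) (chatP C k) ≤ 3 * k - 1 := by
  apply WD.le
  unfold chatP
  apply WD.sum
  intro j hj
  have := Finset.mem_range.1 hj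
  exact ((Pk_WD hC j).mono (by omega)).Cmul _

lemma coe_append (d' : List ℕ) (n : ℕ) : ((d' ++ [n] : List ℕ) : Multiset ℕ) = n ::ₘ (d' : Multiset ℕ) := by
  rw [Multiset.cons_coe, Multiset.coe_eq_coe]
  exact List.perm_append_singleton n d'

lemma X_rel {d' : List ℕ} {n : ℕ} (h : IntegralG (d' ++ [n])) :
    2 * n + 1 + wt (d' : Multiset ℕ) = 3 * XN (d' ++ [n]) := by
  rw [← integralG_X h, wt_coe]; simp; ring

lemma MM_mf {C : List ℕ → ℚ} (hC : IsNormalizedWitten C) (d' : List ℕ) (n : ℕ) :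
    ((MM C (n ::ₘ (d' : Multiset ℕ)) : ℚ) : ℝ) = C (d' ++ [n]) * mf (XN (d' ++ [n])) / 4 := by
  rw [← coe_append, MM_coe hC, Ml, mf]
  push_cast
  ring

/-- the filter of admissible last entries -/
def adm (d' : List ℕ) : Filter ℕ := Filter.atTop ⊓ Filter.principal {n | IntegralG (d' ++ [n])}

lemma adm_ev {d' : List ℕ} {p : ℕ → Prop} :
    (∀ᶠ n in adm d', p n) ↔ ∃ D : ℕ, ∀ n, D ≤ n → IntegralG (d' ++ [n]) → p n := by
  rw [adm, Filter.eventually_inf_principal, Filter.eventually_atTop]; rfl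

lemma adm_X (d' : List ℕ) : Filter.Tendsto (fun n => XN (d' ++ [n])) (adm d') Filter.atTop := by
  rw [Filter.tendsto_atTop]
  intro b
  rw [adm_ev]
  refine ⟨2 * b, fun n hn h => ?_⟩
  have := X_rel h
  omega

lemma PA_C {C : List ℕ → ℚ} (hC : IsNormalizedWitten C) {L : ℝ} (hL : 0 < L)
    (hb : ∀ X : ℕ, 1 ≤ X → ga X ≤ L ∧ L ≤ ga X * (1 + 1 / (X : ℝ))) (d' : List ℕ) :
    PA (adm d') (fun n => 1 / (XN (d' ++ [n]) : ℝ)) (fun n => (C (d' ++ [n]) : ℝ) / L)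
      (rl (lin fun k => Gk C k (d' : Multiset ℕ))) := by
  apply PA_lin (tendsto_natCast_atTop_atTop.comp (adm_X d'))
  intro N
  obtain ⟨K, hK, D, hD⟩ := Asy_M hC hL hb (d' : Multiset ℕ) N
  apply Asymptotics.IsBigO.of_bound (4 * K / L * (4/3) ^ N)
  rw [adm_ev]
  refine ⟨D + 3 * N + 3, fun n hn h => ?_⟩
  have hX := X_rel h
  have h1 := hD n (by omega) _ hX
  have hXN : 2 * N + 1 ≤ XN (d' ++ [n]) := by omega
  rw [MM_mf hC] at h1
  simp only [Function.comp]
  generalize XN (d' ++ [n]) = X at *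
  have hs : ∑ k ∈ Finset.range N, (Gk C k (d' : Multiset ℕ) : ℝ) * mf (X - k) =
      (∑ k ∈ Finset.range N, (Gk C k (d' : Multiset ℕ) : ℝ) * ek k X) * mf X := by
    rw [Finset.sum_mul]
    apply Finset.sum_congr rfl; intro k hk
    have := Finset.mem_range.1 hk
    rw [mf_ek X k (by omega)]; ring
  rw [hs, mf_ek X N (by omega)] at h1
  generalize ∑ k ∈ Finset.range N, (Gk C k (d' : Multiset ℕ) : ℝ) * ek k X = S at *
  have hm := mf_pos X
  have e : (C (d' ++ [n]) : ℝ) * mf X / 4 - L / 4 * (S * mf X) =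
      ((C (d' ++ [n]) : ℝ) / L - S) * (L / 4 * mf X) := by field_simp
  have hp : 0 < L / 4 * mf X := by positivity
  rw [e, abs_mul, abs_of_pos hp] at h1
  have hX1 : (2 * (N:ℝ) + 1) ≤ X := by exact_mod_cast hXN
  have hN : (0:ℝ) ≤ N := by positivity
  have hek := (le_abs_self _).trans (ek_abs N X (by linarith) (by linarith))
  have hXp : (0:ℝ) < X := by linarith
  have h2 : |(C (d' ++ [n]) : ℝ) / L - S| * (L / 4 * mf X) ≤
      (4 * K / L * (4/3) ^ N * (1 / (X:ℝ)) ^ N) * (L / 4 * mf X) := by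
    refine h1.trans ?_
    calc K * (ek N X * mf X) ≤ K * ((4/3) ^ N / (X:ℝ) ^ N * mf X) := by gcongr
      _ = _ := by rw [one_div, inv_pow]; field_simp
  have h3 := le_of_mul_le_mul_right h2 hp
  rw [Real.norm_eq_abs, Real.norm_eq_abs, abs_of_nonneg (a := (1 / (X:ℝ)) ^ N) (by positivity)]
  exact h3

lemma PA_ga {C : List ℕ → ℚ} (hC : IsNormalizedWitten C) {L : ℝ} (hL : 0 < L)
    (hb : ∀ X : ℕ, 1 ≤ X → ga X ≤ L ∧ L ≤ ga X * (1 + 1 / (X : ℝ))) (d' : List ℕ) :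
    PA (adm d') (fun n => 1 / (XN (d' ++ [n]) : ℝ)) (fun n => ga (XN (d' ++ [n])) / L)
      (rl (lin fun k => hh C k 0)) := by
  apply PA_lin (tendsto_natCast_atTop_atTop.comp (adm_X d'))
  intro N
  obtain ⟨K, D, hD⟩ := ga_asy hC hL hb N
  apply Asymptotics.IsBigO.of_bound (K / L)
  filter_upwards [(adm_X d').eventually_ge_atTop D] with n hn
  have h1 := hD _ hn
  simp only [Function.comp]
  generalize XN (d' ++ [n]) = X at *
  rw [SN] at h1
  generalize ∑ k ∈ Finset.range N, (hh C k 0 : ℝ) * ek k X = S at *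
  have e : ga X / L - S = (ga X - L * S) / L := by field_simp
  rw [Real.norm_eq_abs, Real.norm_eq_abs, abs_of_nonneg (a := (1 / (X:ℝ)) ^ N) (by positivity), e, abs_div,
    abs_of_pos hL, one_div, inv_pow, div_mul_eq_mul_div, ← div_eq_mul_inv]
  gcongr

lemma chat_asy {C : List ℕ → ℚ} (hC : IsNormalizedWitten C) (d' : List ℕ) :
    PA (adm d') (fun n => 1 / (XN (d' ++ [n]) : ℝ)) (fun n => Chat C (d' ++ [n]))
      (rl ((lin fun k => Gk C k (d' : Multiset ℕ)) * (lin fun k => hh C k 0)⁻¹)) := by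
  obtain ⟨L, hL, hb⟩ := ga_lim
  have hu : Filter.Tendsto (fun n => 1 / (XN (d' ++ [n]) : ℝ)) (adm d') (nhds 0) :=
    tendsto_one_div_atTop_nhds_zero_nat.comp (adm_X d')
  have h1 := PA_C hC hL hb d'
  have h2 := PA_ga hC hL hb d'
  have e : (lin fun k => Gk C k (d' : Multiset ℕ)) =
      ((lin fun k => Gk C k (d' : Multiset ℕ)) * (lin fun k => hh C k 0)⁻¹) * (lin fun k => hh C k 0) := by
    rw [mul_assoc, PowerSeries.inv_mul_cancel _ (by rw [lin_h_const]; norm_num), mul_one]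
  rw [e, map_mul] at h1
  refine (h1.div hu h2 ?_).congr (Filter.Eventually.of_forall fun n => ?_)
  · rw [PowerSeries.coeff_map, PowerSeries.coeff_zero_eq_constantCoeff_apply, lin_h_const]; simp
  · simp only [Chat, ga]
    exact div_div_div_cancel_right₀ hL.ne' _ _

/-- Polynomiality of the large genus expansion: there are polynomials
`ĉ_k ∈ ℚ[p₂,p₃,…]` (variable `i` of the `MvPolynomial` standing for `p_i`,
only variables `p_i` with `i ≥ 2` occurring), with `ĉ₀ = 1`, `ĉ_k(0,0,…) = 0`
and `deg ĉ_k ≤ 3k−1` for `k ≥ 1` (where `p_d` has degree `2d+1`), such that for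
every fixed `d' ∈ (ℤ_{≥2})^{n−1}` one has, as `d_n → ∞` with `g((d',d_n)) ∈ ℤ`,
`Ĉ(d',d_n) = Σ_{k=0}^{N} ĉ_k(p₂(d'),p₃(d'),…)/X(d)^k + O(X(d)^{−N−1})` for every `N`. -/
theorem polynomiality (C : List ℕ → ℚ) (hC : IsNormalizedWitten C) :
    ∃ chat : ℕ → MvPolynomial ℕ ℚ,
      chat 0 = 1 ∧
      (∀ k : ℕ, ∀ i ∈ (chat k).vars, 2 ≤ i) ∧
      (∀ k : ℕ, 1 ≤ k → MvPolynomial.eval (fun _ => (0 : ℚ)) (chat k) = 0) ∧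
      (∀ k : ℕ, 1 ≤ k →
        MvPolynomial.weightedTotalDegree (fun d : ℕ => 2 * d + 1) (chat k) ≤ 3 * k - 1) ∧
      (∀ d' : List ℕ, (∀ x ∈ d', 2 ≤ x) → ∀ N : ℕ, ∃ K : ℝ, ∃ D : ℕ,
        ∀ dn : ℕ, D ≤ dn → IntegralG (d' ++ [dn]) →
          |Chat C (d' ++ [dn]) -
              ∑ k ∈ Finset.range (N + 1),
                ((MvPolynomial.eval (fun i : ℕ => (d'.count i : ℚ)) (chat k) : ℚ) : ℝ) /
                  (XN (d' ++ [dn]) : ℝ) ^ k| ≤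
            K / (XN (d' ++ [dn]) : ℝ) ^ (N + 1)) := by
  refine ⟨chatP C, chatP_zero C, chatP_vars C, chatP_eval_zero hC, fun k _ => chatP_deg hC k, ?_⟩
  intro d' hd N
  obtain ⟨K, hK⟩ := (chat_asy hC d' (N + 1)).bound
  obtain ⟨D, hD⟩ := adm_ev.1 hK
  refine ⟨K, D, fun n hn h => ?_⟩
  have h1 := hD n hn h
  have hev : ∀ k, MvPolynomial.eval (fun i : ℕ => (d'.count i : ℚ)) (chatP C k) =
      PowerSeries.coeff k ((lin fun k => Gk C k (d' : Multiset ℕ)) * (lin fun k => hh C k 0)⁻¹) := by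
    intro k
    apply chatP_eval
    intro j
    have := Pk_eval hC j (d' : Multiset ℕ) (fun i hi => hd i (Multiset.mem_coe.1 hi))
    simpa only [Multiset.coe_count] using this
  rw [Polynomial.eval, PowerSeries.eval₂_trunc_eq_sum_range] at h1
  rw [Real.norm_eq_abs, Real.norm_eq_abs, abs_of_nonneg (a := (1 / (XN (d' ++ [n]) : ℝ)) ^ (N + 1)) (by positivity),
    one_div, inv_pow, ← div_eq_mul_inv] at h1
  refine le_of_eq_of_le ?_ h1
  congr 2
  apply Finset.sum_congr rfl; intro k _
  rw [hev, PowerSeries.coeff_map]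
  simp only [one_div, inv_pow]
  rw [← div_eq_mul_inv]
  rfl

end WittenAsym
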